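/- Let D be a squarefree positive integer with an even number of distinct prime factors (so D ≥ 6) and let N be a positive integer with gcd(D, N) = 1. Then, as real numbers, φ(D)·ψ(N)/12 − e₁(D, N)/4 − e₃(D, N)/3 > (DN/12)·(1/(e^γ·log(log D) + 3/log(log D))) − (7/3)·√(DN). (Via the genus formula g(X₀^D(N)) = 1 + φ(D)ψ(N)/12 − e₁(D,N)/4 − e₃(D,N)/3, this is the lower bound g(X₀^D(N)) − 1 > (DN/12)·(1/(e^γ log log D + 3/log log D)) − 7√(DN)/3.) -/

import Mathlib

open scoped BigOperators

/-- The Dedekind psi function `ψ(N) = N ∏_{p ∣ N} (1 + 1/p)`, as a real number. -/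
noncomputable def dedekindPsi (N : ℕ) : ℝ :=
  N * ∏ p ∈ N.primeFactors, (1 + 1 / (p : ℝ))

/-- The Kronecker symbol `(-4|p)`: `0` at `p = 2`, and the Legendre symbol
`(-4|p)` at odd primes `p` (junk value `0` at non-primes). -/
noncomputable def chiFour (p : ℕ) : ℤ :=
  if hp : p.Prime then (if p = 2 then 0 else @legendreSym p ⟨hp⟩ (-4)) else 0

/-- The Kronecker symbol `(-3|p)`: `-1` at `p = 2`, and the Legendre symbol
`(-3|p)` at odd primes `p` (junk value `0` at non-primes). -/
noncomputable def chiThree (p : ℕ) : ℤ :=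
  if hp : p.Prime then (if p = 2 then -1 else @legendreSym p ⟨hp⟩ (-3)) else 0

/-- `e₁(D, N) = ∏_{p ∣ D} (1 - (-4|p)) ⬝ ∏_{p ∣ N} (1 + (-4|p))`, the number of
CM points of discriminant `-4` on `X₀^D(N)`. -/
noncomputable def eOne (D N : ℕ) : ℤ :=
  (∏ p ∈ D.primeFactors, (1 - chiFour p)) * ∏ p ∈ N.primeFactors, (1 + chiFour p)

/-- `e₃(D, N) = ∏_{p ∣ D} (1 - (-3|p)) ⬝ ∏_{p ∣ N} (1 + (-3|p))`, the number of
CM points of discriminant `-3` on `X₀^D(N)`. -/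
noncomputable def eThree (D N : ℕ) : ℤ :=
  (∏ p ∈ D.primeFactors, (1 - chiThree p)) * ∏ p ∈ N.primeFactors, (1 + chiThree p)

section Helpers

section PartNoA

open Complex Filter Topology Metric Set

/-- divide an entire function by the full power of `(z - a)` -/
lemma had_divide (g : ℂ → ℂ) (hg : Differentiable ℂ g) (a : ℂ) (hne : analyticOrderAt g a ≠ ⊤) :
    ∃ h : ℂ → ℂ, Differentiable ℂ h ∧ h a ≠ 0 ∧
      ∀ z, g z = (z - a) ^ (analyticOrderNatAt g a) * h z := by
  have hga : AnalyticAt ℂ g a := hg.analyticAt a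
  set n := analyticOrderNatAt g a with hn
  have h1 : analyticOrderAt g a = n := (Nat.cast_analyticOrderNatAt hne).symm
  obtain ⟨l, hl, hl0, hev⟩ := (hga.analyticOrderAt_eq_natCast).1 h1
  have hself := hev.self_of_nhds
  refine ⟨fun z => if z = a then l a else g z / (z - a) ^ n, ?_, by simpa using hl0, ?_⟩
  · intro z
    by_cases hz : z = a
    · subst hz
      have : (fun w => if w = z then l z else g w / (w - z) ^ n) =ᶠ[𝓝 z] l := by
        filter_upwards [hev] with w hw
        by_cases hwz : w = z
        · simp [hwz]
        · have : (w - z) ^ n ≠ 0 := pow_ne_zero _ (sub_ne_zero.2 hwz)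
          simp only [hwz, if_false, hw, smul_eq_mul]
          field_simp
      exact (hl.differentiableAt).congr_of_eventuallyEq this
    · have : (fun w => if w = a then l a else g w / (w - a) ^ n) =ᶠ[𝓝 z]
          fun w => g w / (w - a) ^ n := by
        filter_upwards [isOpen_ne.mem_nhds hz] with w hw
        simp [show w ≠ a from hw]
      refine DifferentiableAt.congr_of_eventuallyEq ?_ this
      exact (hg z).div (by fun_prop) (pow_ne_zero _ (sub_ne_zero.2 hz))
  · intro z
    by_cases hz : z = a
    · subst hz
      simpa using hself
    · have : (z - a) ^ n ≠ 0 := pow_ne_zero _ (sub_ne_zero.2 hz)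
      simp only [hz, if_false]
      field_simp

lemma had_order_ne_top (G : ℂ → ℂ) (hG : Differentiable ℂ G) (h0 : G 0 = 1) (a : ℂ) :
    analyticOrderAt G a ≠ ⊤ := by
  intro h
  have hana : AnalyticOnNhd ℂ G univ := fun z _ => hG.analyticAt z
  rw [analyticOrderAt_eq_top] at h
  have := hana.eqOn_zero_of_preconnected_of_eventuallyEq_zero isPreconnected_univ (mem_univ a) h
  have h1 := this (mem_univ 0)
  simp [h0] at h1

/-- extract finitely many zeros -/
lemma had_extract (G : ℂ → ℂ) (hG : Differentiable ℂ G) (h0 : G 0 = 1) (T : Finset ℂ) :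
    ∃ g : ℂ → ℂ, Differentiable ℂ g ∧ (∀ a ∈ T, g a ≠ 0) ∧
      ∀ z, G z = (∏ a ∈ T, (z - a) ^ (analyticOrderNatAt G a)) * g z := by
  classical
  induction T using Finset.induction_on with
  | empty => exact ⟨G, hG, by simp, by simp⟩
  | insert b T hb ih =>
    obtain ⟨g, hg, hgT, hGg⟩ := ih
    have hP : Differentiable ℂ (fun z => ∏ a ∈ T, (z - a) ^ (analyticOrderNatAt G a)) := by
      fun_prop
    have hord : analyticOrderAt G b = analyticOrderAt g b := by
      have e : G = (fun z => ∏ a ∈ T, (z - a) ^ (analyticOrderNatAt G a)) * g := by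
        ext z; exact hGg z
      have h2 := analyticOrderAt_mul (hP.analyticAt b) (hg.analyticAt b)
      rw [← e] at h2
      rw [h2]
      have : analyticOrderAt (fun z => ∏ a ∈ T, (z - a) ^ (analyticOrderNatAt G a)) b = 0 := by
        rw [analyticOrderAt_eq_zero]
        right
        apply Finset.prod_ne_zero_iff.2
        intro a ha
        apply pow_ne_zero
        rw [sub_ne_zero]
        rintro rfl
        exact hb ha
      rw [this, zero_add]
    have hne : analyticOrderAt g b ≠ ⊤ := hord ▸ had_order_ne_top G hG h0 b
    obtain ⟨h, hh, hhb, hgh⟩ := had_divide g hg b hne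
    refine ⟨h, hh, ?_, ?_⟩
    · intro a ha
      rcases Finset.mem_insert.1 ha with rfl | ha
      · exact hhb
      · have := hgT a ha
        rw [hgh] at this
        exact right_ne_zero_of_mul this
    · intro z
      rw [Finset.prod_insert hb, hGg, hgh]
      have : analyticOrderNatAt g b = analyticOrderNatAt G b := by
        simp [analyticOrderNatAt, hord]
      rw [this]; ring

lemma had_zeros_finite (G : ℂ → ℂ) (hG : Differentiable ℂ G) (h0 : G 0 = 1) (R : ℝ) :
    ({a | G a = 0} ∩ closedBall 0 R).Finite := by
  have hana : AnalyticOnNhd ℂ G univ := fun z _ => hG.analyticAt z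
  by_contra hinf
  obtain ⟨x, hx, hacc⟩ := Set.Infinite.exists_accPt_of_subset_isCompact hinf
    (isCompact_closedBall (0:ℂ) R) inter_subset_right
  have hfr : ∃ᶠ z in 𝓝[≠] x, G z = 0 := by
    rw [accPt_iff_frequently_nhdsNE] at hacc
    exact hacc.mono fun z hz => hz.1
  have := hana.eqOn_zero_of_preconnected_of_frequently_eq_zero isPreconnected_univ (mem_univ x) hfr
  have h1 := this (mem_univ 0)
  simp [h0] at h1

/-- zero-free function with controlled growth has small log-derivative -/
lemma had_logDeriv_small (h : ℂ → ℂ) (hh : Differentiable ℂ h) (R M : ℝ) (hR : 0 < R) (hM : 0 < M)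
    (hz : ∀ z ∈ ball (0:ℂ) R, h z ≠ 0) (h0 : h 0 = 1)
    (hb : ∀ z ∈ ball (0:ℂ) R, ‖h z‖ ≤ Real.exp M) (w : ℂ) (hw : ‖w‖ ≤ R / 4) :
    ‖logDeriv h w‖ ≤ 8 * M / R := by
  have hd : DifferentiableOn ℂ (fun z => deriv h z / h z) (ball 0 R) :=
    DifferentiableOn.div (hh.deriv.differentiableOn) hh.differentiableOn hz
  obtain ⟨l, hl0, hl⟩ := hd.isExactOn_ball.with_val_at 0 0
  have hld : DifferentiableOn ℂ l (ball 0 R) :=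
    fun z hz => (hl z hz).differentiableAt.differentiableWithinAt
  -- h = exp l
  have hexp : ∀ z ∈ ball (0:ℂ) R, h z = exp (l z) := by
    have hconst : ∀ z ∈ ball (0:ℂ) R, h z * exp (-l z) = h 0 * exp (-l 0) := by
      intro z hzR
      refine IsOpen.is_const_of_deriv_eq_zero (f := fun z => h z * exp (-l z)) isOpen_ball
        (convex_ball (0:ℂ) R).isPreconnected ?_ ?_ hzR (mem_ball_self hR)
      · exact hh.differentiableOn.mul (hld.neg.cexp)
      · intro y hy
        have h1 := (hh y).hasDerivAt.mul ((hl y hy).neg.cexp)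
        have h2 := h1.deriv
        have h3 := hz y hy
        change deriv (h * fun z => exp (-l z)) y = 0
        simp only [Pi.neg_apply] at h2
        rw [h2]
        field_simp
        ring
    intro z hzR
    have := hconst z hzR
    rw [h0, hl0, neg_zero, Complex.exp_zero, mul_one, Complex.exp_neg] at this
    field_simp at this
    exact this
  have hre : MapsTo l (ball 0 R) {z | z.re ≤ M} := by
    intro z hzR
    have h1 := hb z hzR
    rw [hexp z hzR, Complex.norm_exp] at h1
    exact Real.exp_le_exp.1 h1
  have hbound : ∀ z ∈ ball (0:ℂ) R, ‖z‖ ≤ R / 2 → ‖l z‖ ≤ 2 * M := by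
    intro z hzR hz2
    have := Complex.borelCaratheodory_zero hM hld hre hR hzR hl0
    refine this.trans ?_
    rw [div_le_iff₀ (by linarith)]
    nlinarith
  have hball : closedBall w (R/4) ⊆ ball 0 R := by
    intro z hz
    rw [mem_closedBall, dist_eq_norm] at hz
    rw [mem_ball_zero_iff]
    calc ‖z‖ = ‖(z - w) + w‖ := by ring_nf
      _ ≤ ‖z - w‖ + ‖w‖ := norm_add_le _ _
      _ < R := by linarith
  have hwb : w ∈ ball (0:ℂ) R := hball (mem_closedBall_self (by linarith))
  have hder : deriv l w = logDeriv h w := by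
    rw [(hl w hwb).deriv]; rfl
  rw [← hder]
  have := Complex.norm_deriv_le_of_forall_mem_sphere_norm_le (c := w) (R := R/4) (C := 2 * M) (f := l)
    (by linarith) ?_ ?_
  · refine this.trans (le_of_eq ?_)
    field_simp
    norm_num
  · refine DifferentiableOn.diffContOnCl ?_
    refine hld.mono (Subset.trans ?_ hball)
    exact closure_ball_subset_closedBall
  · intro z hz
    have hz' : z ∈ closedBall w (R/4) := sphere_subset_closedBall hz
    refine hbound z (hball hz') ?_
    rw [mem_sphere, dist_eq_norm] at hz
    calc ‖z‖ = ‖(z - w) + w‖ := by ring_nf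
      _ ≤ ‖z - w‖ + ‖w‖ := norm_add_le _ _
      _ ≤ R / 2 := by linarith

/-- zeros in the closed ball -/
noncomputable def hadZ (G : ℂ → ℂ) (hG : Differentiable ℂ G) (h0 : G 0 = 1) (R : ℝ) : Finset ℂ :=
  (had_zeros_finite G hG h0 R).toFinset

lemma mem_hadZ (G : ℂ → ℂ) (hG : Differentiable ℂ G) (h0 : G 0 = 1) (R : ℝ) (a : ℂ) :
    a ∈ hadZ G hG h0 R ↔ G a = 0 ∧ ‖a‖ ≤ R := by
  simp [hadZ]

lemma had_main_bound (G : ℂ → ℂ) (hG : Differentiable ℂ G) (h0 : G 0 = 1) (M R : ℝ)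
    (hR : 0 < R) (hM : 0 < M) (hb : ∀ z, ‖z‖ ≤ 3 * R → ‖G z‖ ≤ Real.exp M) (w : ℂ)
    (hw : ‖w‖ ≤ R / 4) (hGw : G w ≠ 0) :
    ‖logDeriv G w - ∑ a ∈ hadZ G hG h0 R, (analyticOrderNatAt G a : ℂ) / (w - a)‖ ≤ 8 * M / R := by
  set T := hadZ G hG h0 R with hT
  obtain ⟨g, hg, hgT, hGg⟩ := had_extract G hG h0 T
  set m := fun a => analyticOrderNatAt G a with hm
  set P : ℂ → ℂ := fun z => ∏ a ∈ T, (z - a) ^ (m a) with hP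
  have hPd : Differentiable ℂ P := by rw [hP]; fun_prop
  have hGPg : ∀ z, G z = P z * g z := hGg
  have hg0 : g 0 ≠ 0 := by
    have := hGPg 0
    rw [h0] at this
    exact right_ne_zero_of_mul (this ▸ one_ne_zero)
  have hgz : ∀ z, ‖z‖ ≤ R → g z ≠ 0 := by
    intro z hz hgz
    have : G z = 0 := by rw [hGPg, hgz, mul_zero]
    exact hgT z ((mem_hadZ G hG h0 R z).2 ⟨this, hz⟩) hgz
  set h : ℂ → ℂ := fun z => g z / g 0 with hh
  have hhd : Differentiable ℂ h := hg.div_const _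
  -- bound on sphere
  have hsph : ∀ z ∈ sphere (0:ℂ) (3*R), ‖h z‖ ≤ Real.exp M := by
    intro z hz
    rw [mem_sphere_zero_iff_norm] at hz
    have hPz : ‖P 0‖ ≤ ‖P z‖ := by
      simp only [hP, norm_prod, norm_pow]
      apply Finset.prod_le_prod
      · intro a _; positivity
      · intro a ha
        have ha' := ((mem_hadZ G hG h0 R a).1 ha).2
        apply pow_le_pow_left₀ (norm_nonneg _)
        have := norm_sub_norm_le z a
        simp only [zero_sub, norm_neg]
        linarith
    have e1 : ‖P 0‖ * ‖g 0‖ = 1 := by rw [← norm_mul, ← hGPg, h0, norm_one]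
    have hg0' : 0 < ‖g 0‖ := norm_pos_iff.2 hg0
    have e2 : ‖h z‖ = ‖P 0‖ * ‖g z‖ := by
      rw [hh]; simp only [norm_div]
      rw [div_eq_iff hg0'.ne', mul_right_comm, e1, one_mul]
    rw [e2]
    calc ‖P 0‖ * ‖g z‖ ≤ ‖P z‖ * ‖g z‖ := by gcongr
      _ = ‖G z‖ := by rw [hGPg, norm_mul]
      _ ≤ _ := hb z hz.le
  have hball : ∀ z ∈ ball (0:ℂ) R, ‖h z‖ ≤ Real.exp M := by
    intro z hz
    refine Complex.norm_le_of_forall_mem_frontier_norm_le (U := ball (0:ℂ) (3*R)) isBounded_ball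
      hhd.diffContOnCl ?_ ?_
    · rw [frontier_ball _ (by positivity)]; exact hsph
    · apply subset_closure
      rw [mem_ball_zero_iff] at hz ⊢
      linarith
  have key := had_logDeriv_small h hhd R M hR hM
    (fun z hz => div_ne_zero (hgz z (mem_ball_zero_iff.1 hz).le) hg0) (by simp [hh, hg0]) hball w hw
  have hlogh : logDeriv h w = logDeriv g w := by
    simp only [logDeriv_apply, hh, deriv_div_const]
    field_simp
  have hPw : P w ≠ 0 := by
    rw [hGPg] at hGw; exact left_ne_zero_of_mul hGw
  have hgw : g w ≠ 0 := by
    rw [hGPg] at hGw; exact right_ne_zero_of_mul hGw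
  have e1 : logDeriv G w = logDeriv P w + logDeriv g w := by
    have : G = fun z => P z * g z := by ext z; exact hGPg z
    conv_lhs => rw [this]
    exact logDeriv_mul w hPw hgw (hPd w) (hg w)
  have e2 : logDeriv P w = ∑ a ∈ T, (m a : ℂ) / (w - a) := by
    rw [hP]
    rw [logDeriv_prod (fun a ha => (Finset.prod_ne_zero_iff.1 hPw) a ha) (by intro a _; fun_prop)]
    refine Finset.sum_congr rfl fun a ha => ?_
    rw [logDeriv_fun_pow (by fun_prop)]
    simp [logDeriv_apply]
    ring
  rw [e1, e2, add_sub_cancel_left, ← hlogh]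
  exact key

lemma had_tendsto (G : ℂ → ℂ) (hG : Differentiable ℂ G) (h0 : G 0 = 1) (C : ℝ) (hC : 0 < C)
    (hb : ∀ z, ‖G z‖ ≤ Real.exp (C * (1 + ‖z‖) ^ (3/4 : ℝ))) (w : ℂ) (hGw : G w ≠ 0) :
    Tendsto (fun R : ℝ => ∑ a ∈ hadZ G hG h0 R, (analyticOrderNatAt G a : ℂ) / (w - a)) atTop
      (𝓝 (logDeriv G w)) := by
  rw [tendsto_iff_norm_sub_tendsto_zero]
  have hlim : Tendsto (fun R : ℝ => 8 * C * (4:ℝ) ^ (3/4:ℝ) * R ^ (-(1/4) : ℝ)) atTop (𝓝 0) := by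
    have := (tendsto_rpow_neg_atTop (show (0:ℝ) < 1/4 by norm_num)).const_mul
      (8 * C * (4:ℝ) ^ (3/4:ℝ))
    simpa using this
  refine squeeze_zero' (Eventually.of_forall fun _ => norm_nonneg _) ?_ hlim
  filter_upwards [eventually_ge_atTop (4 * ‖w‖ + 1)] with R hR
  have hw0 := norm_nonneg w
  have hRp : 0 < R := by linarith
  have := had_main_bound G hG h0 (C * (1 + 3 * R) ^ (3/4 : ℝ)) R hRp (by positivity) ?_ w
    (by linarith) hGw
  · rw [norm_sub_rev]
    refine this.trans ?_
    have h1 : (1 + 3 * R) ^ (3/4 : ℝ) ≤ (4 * R) ^ (3/4 : ℝ) :=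
      Real.rpow_le_rpow (by positivity) (by linarith) (by norm_num)
    rw [Real.mul_rpow (by norm_num) hRp.le] at h1
    have h2 : R ^ (-(1/4) : ℝ) = R ^ (3/4 : ℝ) / R := by
      rw [eq_div_iff hRp.ne']
      nth_rewrite 2 [← Real.rpow_one R]
      rw [← Real.rpow_add hRp]; norm_num
    rw [h2]
    calc 8 * (C * (1 + 3 * R) ^ (3/4 : ℝ)) / R ≤ 8 * (C * (4 ^ (3/4 : ℝ) * R ^ (3/4 : ℝ))) / R := by
          gcongr
      _ = _ := by ring
  · intro z hz
    refine (hb z).trans ?_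
    gcongr

lemma had_order_zero (G : ℂ → ℂ) (a : ℂ) (ha : G a ≠ 0) : analyticOrderNatAt G a = 0 := by
  have : analyticOrderAt G a = 0 := by rw [analyticOrderAt_eq_zero]; right; exact ha
  simp [analyticOrderNatAt, this]

lemma had_order_pos (G : ℂ → ℂ) (hG : Differentiable ℂ G) (h0 : G 0 = 1) (a : ℂ) (ha : G a = 0) :
    1 ≤ analyticOrderNatAt G a := by
  rw [Nat.one_le_iff_ne_zero]
  intro h
  have h1 := Nat.cast_analyticOrderNatAt (had_order_ne_top G hG h0 a)
  rw [h] at h1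
  have := h1.symm
  simp only [Nat.cast_zero] at this
  rw [analyticOrderAt_eq_zero] at this
  rcases this with h2 | h2
  · exact h2 (hG.analyticAt a)
  · exact h2 ha

lemma had_exists_R (G : ℂ → ℂ) (hG : Differentiable ℂ G) (h0 : G 0 = 1) (S : Finset ℂ) :
    ∃ R0 : ℝ, ∀ R, R0 ≤ R → ∀ a ∈ S, a ∉ hadZ G hG h0 R → G a ≠ 0 := by
  refine ⟨∑ a ∈ S, ‖a‖, fun R hR a ha hn h => hn ((mem_hadZ G hG h0 R a).2 ⟨h, ?_⟩)⟩
  exact (Finset.single_le_sum (f := fun a : ℂ => ‖a‖) (fun _ _ => norm_nonneg _) ha).trans hR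

/-- sums over the zeros of a summable function converge along balls -/
lemma had_hasSum {E : Type*} [NormedAddCommGroup E] (G : ℂ → ℂ) (hG : Differentiable ℂ G) (h0 : G 0 = 1) (f : ℂ → E)
    (hf : ∀ a, G a ≠ 0 → f a = 0) (s : E) (hs : HasSum f s) :
    Tendsto (fun R : ℝ => ∑ a ∈ hadZ G hG h0 R, f a) atTop (𝓝 s) := by
  classical
  rw [Metric.tendsto_atTop]
  intro ε hε
  obtain ⟨S, hS⟩ := (Metric.tendsto_atTop.1 hs) ε hε
  obtain ⟨R0, hR0⟩ := had_exists_R G hG h0 S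
  refine ⟨R0, fun R hR => ?_⟩
  have : ∑ a ∈ hadZ G hG h0 R, f a = ∑ a ∈ hadZ G hG h0 R ∪ S, f a := by
    apply Finset.sum_subset Finset.subset_union_left
    intro a ha hn
    rcases Finset.mem_union.1 ha with h | h
    · exact absurd h hn
    · exact hf a (hR0 R hR a h hn)
  rw [this]
  exact hS _ (Finset.subset_union_right)

/-- nonnegative terms with convergent ball sums are summable -/
lemma had_summable (G : ℂ → ℂ) (hG : Differentiable ℂ G) (h0 : G 0 = 1) (f : ℂ → ℝ)
    (hf : ∀ a, G a ≠ 0 → f a = 0) (hf0 : ∀ a, 0 ≤ f a) (s : ℝ)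
    (hs : Tendsto (fun R : ℝ => ∑ a ∈ hadZ G hG h0 R, f a) atTop (𝓝 s)) : HasSum f s := by
  classical
  have hmono : Monotone (fun R : ℝ => ∑ a ∈ hadZ G hG h0 R, f a) := by
    intro R R' hRR
    apply Finset.sum_le_sum_of_subset_of_nonneg
    · intro a ha
      rw [mem_hadZ] at ha ⊢
      exact ⟨ha.1, ha.2.trans hRR⟩
    · intro a _ _; exact hf0 a
  have hle : ∀ R, ∑ a ∈ hadZ G hG h0 R, f a ≤ s := hmono.ge_of_tendsto hs
  have hsum : Summable f := by
    refine summable_of_sum_le hf0 (c := s) fun S => ?_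
    obtain ⟨R0, hR0⟩ := had_exists_R G hG h0 S
    refine le_trans ?_ (hle R0)
    rw [← Finset.sum_filter_add_sum_filter_not S (fun a => a ∈ hadZ G hG h0 R0)]
    have : ∑ a ∈ S with ¬ a ∈ hadZ G hG h0 R0, f a = 0 := by
      apply Finset.sum_eq_zero
      intro a ha
      rw [Finset.mem_filter] at ha
      exact hf a (hR0 R0 le_rfl a ha.1 ha.2)
    rw [this, add_zero]
    apply Finset.sum_le_sum_of_subset_of_nonneg
    · intro a ha; exact (Finset.mem_filter.1 ha).2
    · intro a _ _; exact hf0 a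
  have h2 := had_hasSum G hG h0 f hf _ hsum.hasSum
  have := tendsto_nhds_unique h2 hs
  rw [← this]
  exact hsum.hasSum

end PartNoA

section PartNoB

open Complex Filter Topology Metric Set MeasureTheory

lemma xi_strip_bound : ∃ B : ℝ, ∀ s : ℂ, 0 ≤ s.re → s.re ≤ 2 → ‖completedRiemannZeta₀ s‖ ≤ B := by
  set P := HurwitzZeta.hurwitzEvenFEPair 0 with hP
  have hm : ∀ s : ℂ, MellinConvergent P.f_modif s := fun s =>
    (P.isStrongFEPair_toStrongFEPair.hasMellin s).1
  have h0 := (hm 0).norm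
  have h1 := (hm 1).norm
  refine ⟨((∫ t in Ioi (0:ℝ), ‖((t:ℂ) ^ ((0:ℂ) - 1)) • P.f_modif t‖) +
    (∫ t in Ioi (0:ℝ), ‖((t:ℂ) ^ ((1:ℂ) - 1)) • P.f_modif t‖)) / 2, fun s hs0 hs2 => ?_⟩
  have e : completedRiemannZeta₀ s = mellin P.f_modif (s / 2) / 2 := rfl
  rw [e, norm_div, Complex.norm_ofNat]
  apply div_le_div_of_nonneg_right _ (by norm_num)
  rw [← integral_add h0 h1]
  unfold mellin
  refine (norm_integral_le_integral_norm _).trans ?_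
  apply setIntegral_mono_on (hm (s/2)).norm (h0.add h1) measurableSet_Ioi
  intro t ht
  have ht' : (0:ℝ) < t := ht
  simp only [norm_smul, Complex.norm_cpow_eq_rpow_re_of_pos ht', Pi.add_apply]
  rw [← add_mul]
  apply mul_le_mul_of_nonneg_right _ (norm_nonneg _)
  have hre : (s / 2 - 1).re = s.re / 2 - 1 := by simp
  have hre0 : ((0:ℂ) - 1).re = -1 := by simp
  have hre1 : ((1:ℂ) - 1).re = 0 := by simp
  rw [hre, hre0, hre1]
  rcases le_total t 1 with h | h
  · have := Real.rpow_le_rpow_of_exponent_ge ht' h (show (-1:ℝ) ≤ s.re/2 - 1 by linarith)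
    have h2 : (0:ℝ) ≤ t ^ (0:ℝ) := by positivity
    exact le_add_of_le_of_nonneg this h2
  · have := Real.rpow_le_rpow_of_exponent_le h (show s.re/2 - 1 ≤ (0:ℝ) by linarith)
    have h2 : (0:ℝ) ≤ t ^ (-1:ℝ) := by positivity
    exact le_add_of_nonneg_of_le h2 this

noncomputable def xiX (s : ℂ) : ℂ := s * (s - 1) * completedRiemannZeta₀ s + 1

lemma xiX_diff : Differentiable ℂ xiX := by
  unfold xiX
  have := differentiable_completedZeta₀
  fun_prop

lemma xiX_one_sub (s : ℂ) : xiX (1 - s) = xiX s := by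
  unfold xiX
  rw [completedRiemannZeta₀_one_sub]; ring

lemma xiX_eq (s : ℂ) (hs : 0 < s.re) (hs1 : s ≠ 1) :
    xiX s = s * (s - 1) * (Gammaℝ s * riemannZeta s) := by
  have hs0 : s ≠ 0 := by rintro rfl; simp at hs
  rw [riemannZeta_def_of_ne_zero hs0, mul_div_cancel₀ _ (Gammaℝ_ne_zero_of_re_pos hs),
    completedRiemannZeta_eq]
  unfold xiX
  have : (1 - s) ≠ 0 := sub_ne_zero.2 (Ne.symm hs1)
  field_simp
  ring

lemma norm_Gamma_le_re (s : ℂ) (hs : 0 < s.re) : ‖Complex.Gamma s‖ ≤ Real.Gamma s.re := by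
  rw [Complex.Gamma_eq_integral hs, Real.Gamma_eq_integral hs, Complex.GammaIntegral]
  refine (norm_integral_le_integral_norm _).trans (le_of_eq ?_)
  apply setIntegral_congr_fun measurableSet_Ioi
  intro t ht
  have ht' : (0:ℝ) < t := ht
  simp only [norm_mul, Complex.norm_cpow_eq_rpow_re_of_pos ht']
  rw [Complex.norm_real, Real.norm_of_nonneg (Real.exp_nonneg _)]
  simp

lemma Gamma_le_growth (x : ℝ) (hx : 1 ≤ x) : Real.Gamma x ≤ Real.exp ((x+2) * Real.log (x+2)) := by
  have h1 : Real.Gamma (x + 1) = x * Real.Gamma x := Real.Gamma_add_one (by linarith)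
  have hG : 0 < Real.Gamma x := Real.Gamma_pos_of_pos (by linarith)
  have h2 : Real.Gamma x ≤ Real.Gamma (x + 1) := by rw [h1]; nlinarith
  have h3 : Real.Gamma (x + 1) ≤ Real.Gamma (⌊x⌋₊ + 1 + 1) := by
    apply Real.Gamma_strictMonoOn_Ici.monotoneOn
    · simp only [mem_Ici]; linarith
    · simp only [mem_Ici]
      have : (1:ℝ) ≤ ⌊x⌋₊ := by
        exact_mod_cast (Nat.one_le_floor_iff x).2 hx
      linarith
    · have := (Nat.lt_floor_add_one x).le
      linarith
  have h4 : Real.Gamma (⌊x⌋₊ + 1 + 1) = ((⌊x⌋₊ + 1).factorial : ℝ) := by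
    have := Real.Gamma_nat_eq_factorial (⌊x⌋₊ + 1)
    rw [← this]; push_cast; rfl
  have h5 : ((⌊x⌋₊ + 1).factorial : ℝ) ≤ ((⌊x⌋₊ + 1 : ℕ) : ℝ) ^ (⌊x⌋₊ + 1) := by
    exact_mod_cast Nat.factorial_le_pow _
  have hfl : (⌊x⌋₊ : ℝ) ≤ x := Nat.floor_le (by linarith)
  have h6 : ((⌊x⌋₊ + 1 : ℕ) : ℝ) ^ (⌊x⌋₊ + 1) ≤ (x + 2) ^ (⌊x⌋₊ + 1) := by
    apply pow_le_pow_left₀ (by positivity)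
    push_cast; linarith
  have h7 : (x + 2) ^ (⌊x⌋₊ + 1) = Real.exp ((⌊x⌋₊ + 1 : ℕ) * Real.log (x+2)) := by
    rw [Real.exp_nat_mul, Real.exp_log (by linarith)]
  have h8 : Real.exp ((⌊x⌋₊ + 1 : ℕ) * Real.log (x+2)) ≤ Real.exp ((x+2) * Real.log (x+2)) := by
    apply Real.exp_le_exp.2
    apply mul_le_mul_of_nonneg_right _ (Real.log_nonneg (by linarith))
    push_cast; linarith
  linarith

lemma norm_zeta_le_two (s : ℂ) (hs : 2 ≤ s.re) : ‖riemannZeta s‖ ≤ 2 := by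
  rw [zeta_eq_tsum_one_div_nat_cpow (by linarith)]
  have hs2 : HasSum (fun n : ℕ => 1 / (n:ℝ)^2) (Real.pi^2/6) := hasSum_zeta_two
  refine (tsum_of_norm_bounded hs2 fun n => ?_).trans ?_
  · rcases Nat.eq_zero_or_pos n with rfl | hn
    · have : s ≠ 0 := by rintro rfl; norm_num at hs
      simp [this]
    · rw [norm_div, norm_one, Complex.norm_natCast_cpow_of_pos hn]
      apply one_div_le_one_div_of_le (by positivity)
      rw [← Real.rpow_natCast]
      exact Real.rpow_le_rpow_of_exponent_le (by exact_mod_cast hn) (by exact_mod_cast hs)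
  · have := Real.pi_lt_d2
    have := Real.pi_gt_three
    nlinarith

lemma xi_growth : ∃ C : ℝ, 0 < C ∧ ∀ s : ℂ, 1/2 ≤ s.re →
    ‖xiX s‖ ≤ Real.exp (C * (1 + ‖s‖) ^ (3/2 : ℝ)) := by
  obtain ⟨B, hB⟩ := xi_strip_bound
  have hB0 : 0 ≤ B := (norm_nonneg _).trans (hB 1 (by simp) (by simp))
  refine ⟨B + 10, by linarith, fun s hs => ?_⟩
  set y := 1 + ‖s‖ with hy
  have hns := norm_nonneg s
  have hy1 : 1 ≤ y := by linarith
  have hy32 : y ≤ y ^ (3/2 : ℝ) := by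
    nth_rewrite 1 [← Real.rpow_one y]
    exact Real.rpow_le_rpow_of_exponent_le hy1 (by norm_num)
  have hsq : y ^ 2 ≤ Real.exp (2 * y) := by
    have := Real.add_one_le_exp y
    have h2 : Real.exp (2 * y) = Real.exp y ^ 2 := by rw [← Real.exp_nat_mul]; norm_num
    rw [h2]
    gcongr
    linarith
  have hss : ‖s * (s - 1)‖ ≤ y ^ 2 := by
    rw [norm_mul]
    have : ‖s - 1‖ ≤ ‖s‖ + 1 := by simpa using norm_sub_le s 1
    nlinarith [norm_nonneg (s-1)]
  rcases le_total s.re 2 with h2 | h2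
  · have h3 : ‖xiX s‖ ≤ y ^ 2 * B + 1 := by
      unfold xiX
      refine (norm_add_le _ _).trans ?_
      rw [norm_mul, norm_one]
      have := hB s (by linarith) h2
      gcongr
    have h4 : y ^ 2 * B + 1 ≤ Real.exp (2 * y) * Real.exp B := by
      have hb := Real.add_one_le_exp B
      have hy2 : 1 ≤ y ^ 2 := by nlinarith
      calc y^2 * B + 1 ≤ y^2 * (B + 1) := by nlinarith
        _ ≤ _ := by gcongr
    rw [← Real.exp_add] at h4
    refine (h3.trans h4).trans (Real.exp_le_exp.2 ?_)
    nlinarith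
  · have hs1 : s ≠ 1 := by rintro rfl; norm_num at h2
    rw [xiX_eq s (by linarith) hs1, norm_mul, norm_mul (Gammaℝ s), Gammaℝ_def, norm_mul (_ ^ _)]
    have hre : (s / 2).re = s.re / 2 := by simp
    have hpi : ‖(Real.pi : ℂ) ^ (-s/2)‖ ≤ 1 := by
      rw [Complex.norm_cpow_eq_rpow_re_of_pos Real.pi_pos]
      apply Real.rpow_le_one_of_one_le_of_nonpos (by linarith [Real.pi_gt_three])
      have : (-s/2).re = -s.re/2 := by simp
      rw [this]; linarith
    have hsre : s.re ≤ ‖s‖ := Complex.re_le_norm s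
    have hG : ‖Gamma (s/2)‖ ≤ Real.exp ((2*y) * Real.log (2*y)) := by
      refine (norm_Gamma_le_re _ (by rw [hre]; linarith)).trans ?_
      refine (Gamma_le_growth _ (by rw [hre]; linarith)).trans ?_
      rw [hre]
      apply Real.exp_le_exp.2
      have h5 : s.re/2 + 2 ≤ 2 * y := by linarith
      apply mul_le_mul h5 _ (Real.log_nonneg (by linarith)) (by linarith)
      exact Real.log_le_log (by linarith) h5
    have hlog : (2*y) * Real.log (2*y) ≤ 6 * y ^ (3/2:ℝ) := by
      have h6 : Real.log (2*y) ≤ 2 * (2*y) ^ (1/2 : ℝ) := by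
        have := Real.log_le_rpow_div (show 0 ≤ 2 * y by linarith) (show (0:ℝ) < 1/2 by norm_num)
        linarith
      have h7 : (2*y) ^ (1/2:ℝ) ≤ (3/2) * y ^ (1/2 : ℝ) := by
        rw [Real.mul_rpow (by norm_num) (by linarith)]
        gcongr
        rw [← Real.sqrt_eq_rpow]
        rw [Real.sqrt_le_left (by norm_num)]; norm_num
      have h8 : y * y ^ (1/2:ℝ) = y ^ (3/2:ℝ) := by
        nth_rewrite 1 [← Real.rpow_one y]
        rw [← Real.rpow_add (by linarith)]; norm_num
      rw [← h8]
      nlinarith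
    have h9 : ‖riemannZeta s‖ ≤ Real.exp 1 :=
      (norm_zeta_le_two s h2).trans (by have := Real.add_one_le_exp 1; linarith)
    calc ‖s * (s - 1)‖ * (‖(Real.pi : ℂ) ^ (-s/2)‖ * ‖Gamma (s/2)‖ * ‖riemannZeta s‖)
        ≤ Real.exp (2 * y) * (1 * Real.exp (6 * y ^ (3/2:ℝ)) * Real.exp 1) := by
          gcongr
          · exact hss.trans hsq
          · exact hG.trans (Real.exp_le_exp.2 hlog)
      _ = Real.exp (2 * y + 6 * y ^ (3/2:ℝ) + 1) := by
          rw [one_mul, Real.exp_add, Real.exp_add]; ring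
      _ ≤ _ := by
          apply Real.exp_le_exp.2
          nlinarith

end PartNoB

section PartNoC

open Complex Filter Topology Metric Set MeasureTheory

lemma xiX_half (z : ℂ) : xiX (1/2 + z) = xiX (1/2 - z) := by
  rw [← xiX_one_sub]; congr 1; ring

noncomputable def xiG (w : ℂ) : ℂ := xiX (1/2 + (w + 1/4) ^ (1/2 : ℂ))

lemma xiX_of_sq (z y : ℂ) (h : z ^ 2 = y ^ 2) : xiX (1/2 + z) = xiX (1/2 + y) := by
  rcases sq_eq_sq_iff_eq_or_eq_neg.1 h with h | h
  · rw [h]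
  · rw [h, xiX_half y, sub_eq_add_neg]

lemma cpow_half_sq (v : ℂ) : (v ^ (1/2 : ℂ)) ^ 2 = v := by
  rw [← Complex.cpow_nat_mul]; norm_num

lemma xiG_eq (s : ℂ) : xiG (s * (s - 1)) = xiX s := by
  have : xiX s = xiX (1/2 + (s - 1/2)) := by congr 1; ring
  rw [this, xiG]
  apply xiX_of_sq
  rw [cpow_half_sq]; ring

lemma xiG_diff : Differentiable ℂ xiG := by
  set F : ℂ → ℂ := fun v => xiX (1/2 + v ^ (1/2 : ℂ)) with hF
  suffices h : Differentiable ℂ F by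
    have : xiG = fun w => F (w + 1/4) := by ext w; rfl
    rw [this]; fun_prop
  have hsl : ∀ v ∈ slitPlane, DifferentiableAt ℂ F v := by
    intro v hv
    have : DifferentiableAt ℂ (fun v : ℂ => 1/2 + v ^ (1/2 : ℂ)) v :=
      (differentiableAt_id.cpow_const hv).const_add _
    exact (xiX_diff _).comp v this
  have hF2 : F = fun v => xiX (1/2 + I * (-v) ^ (1/2:ℂ)) := by
    ext v
    apply xiX_of_sq
    rw [mul_pow, cpow_half_sq, cpow_half_sq, I_sq]; ring
  have hsl2 : ∀ v, -v ∈ slitPlane → DifferentiableAt ℂ F v := by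
    intro v hv
    rw [hF2]
    have : DifferentiableAt ℂ (fun v : ℂ => 1/2 + I * (-v) ^ (1/2 : ℂ)) v :=
      ((DifferentiableAt.cpow_const differentiableAt_id.neg hv).const_mul I).const_add _
    exact (xiX_diff _).comp v this
  have hne : ∀ v, v ≠ 0 → DifferentiableAt ℂ F v := by
    intro v hv
    by_cases h1 : v ∈ slitPlane
    · exact hsl v h1
    · apply hsl2
      rw [mem_slitPlane_iff] at h1 ⊢
      push Not at h1
      left
      have : v.re ≠ 0 := fun h => hv (Complex.ext h h1.2)
      simp only [neg_re]
      have := lt_of_le_of_ne h1.1 this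
      linarith
  have hcont : ContinuousAt F 0 := by
    apply (xiX_diff.continuous.continuousAt).comp
    apply continuousAt_const.add
    exact Complex.continuousAt_cpow_const_of_re_pos (Or.inl le_rfl) (by norm_num)
  intro v
  by_cases hv : v = 0
  · subst hv
    have : DifferentiableOn ℂ F univ := by
      rw [← Complex.differentiableOn_compl_singleton_and_continuousAt_iff (c := (0:ℂ)) univ_mem]
      refine ⟨fun v hv => (hne v ?_).differentiableWithinAt, hcont⟩
      simpa using hv
    exact (this 0 (mem_univ _)).differentiableAt univ_mem
  · exact hne v hv

lemma xiG_zero : xiG 0 = 1 := by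
  have := xiG_eq 1
  simp only [sub_self, mul_zero] at this
  rw [this]; simp [xiX]

lemma sqrt_re_nonneg (v : ℂ) : 0 ≤ (v ^ (1/2 : ℂ)).re := by
  rcases eq_or_ne v 0 with rfl | hv
  · simp
  rw [Complex.cpow_def_of_ne_zero hv, Complex.exp_re]
  apply mul_nonneg (Real.exp_nonneg _)
  apply Real.cos_nonneg_of_mem_Icc
  have h1 : (Complex.log v * (1/2)).im = v.arg / 2 := by
    have : (1/2 : ℂ) = ((1/2 : ℝ) : ℂ) := by norm_num
    rw [this, Complex.im_mul_ofReal, Complex.log_im]; ring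
  rw [h1]
  have := Complex.neg_pi_lt_arg v
  have := Complex.arg_le_pi v
  constructor <;> linarith

lemma xiG_growth : ∃ C : ℝ, 0 < C ∧ ∀ w : ℂ, ‖xiG w‖ ≤ Real.exp (C * (1 + ‖w‖) ^ (3/4 : ℝ)) := by
  obtain ⟨C, hC, h⟩ := xi_growth
  refine ⟨C * (5/2:ℝ) ^ (3/2:ℝ), by positivity, fun w => ?_⟩
  refine (h _ ?_).trans (Real.exp_le_exp.2 ?_)
  · have := sqrt_re_nonneg (w + 1/4)
    have h2 : (1/2 : ℂ).re = 1/2 := by norm_num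
    rw [Complex.add_re, h2]; linarith
  · rw [mul_assoc]
    apply mul_le_mul_of_nonneg_left _ hC.le
    have hn := norm_nonneg w
    have e : (5/2:ℝ) ^ (3/2:ℝ) * (1 + ‖w‖) ^ (3/4:ℝ) = ((5/2) * (1 + ‖w‖) ^ (1/2:ℝ)) ^ (3/2:ℝ) := by
      rw [Real.mul_rpow (by norm_num) (by positivity), ← Real.rpow_mul (by positivity)]; norm_num
    rw [e]
    apply Real.rpow_le_rpow (by positivity) _ (by norm_num)
    have h1 : ‖(1/2 : ℂ) + (w + 1/4) ^ (1/2:ℂ)‖ ≤ 1/2 + (1 + ‖w‖) ^ (1/2:ℝ) := by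
      refine (norm_add_le _ _).trans ?_
      have e1 : ‖(1/2:ℂ)‖ = 1/2 := by norm_num
      rw [e1]
      gcongr
      have e2 : (1/2:ℂ) = ((1/2:ℝ):ℂ) := by norm_num
      rcases eq_or_ne (w + 1/4) 0 with h0 | h0
      · rw [h0]; simp; positivity
      rw [e2, Complex.norm_cpow_real]
      apply Real.rpow_le_rpow (norm_nonneg _) _ (by norm_num)
      refine (norm_add_le _ _).trans ?_
      have e3 : ‖(1/4:ℂ)‖ = 1/4 := by norm_num
      rw [e3]; linarith
    have h2 : (1:ℝ) ≤ (1 + ‖w‖) ^ (1/2:ℝ) := Real.one_le_rpow (by linarith) (by norm_num)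
    linarith

lemma xiX_zero_re (s : ℂ) (hs : xiX s = 0) : s.re < 1 := by
  by_contra hge
  push Not at hge
  by_cases h1 : s = 1
  · subst h1; simp [xiX] at hs
  · rw [xiX_eq s (by linarith) h1] at hs
    have hs0 : s ≠ 0 := by rintro rfl; norm_num at hge
    have := riemannZeta_ne_zero_of_one_le_re hge
    have h3 := Gammaℝ_ne_zero_of_re_pos (show 0 < s.re by linarith)
    simp [hs0, sub_ne_zero.2 h1, this, h3] at hs

lemma xiG_zero_data (l : ℂ) (h : xiG (-l) = 0) :
    ∃ ρ : ℂ, 1/2 ≤ ρ.re ∧ ρ.re < 1 ∧ xiX ρ = 0 ∧ l = ρ * (1 - ρ) := by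
  refine ⟨1/2 + (-l + 1/4) ^ (1/2:ℂ), ?_, xiX_zero_re _ h, h, ?_⟩
  · have := sqrt_re_nonneg (-l + 1/4)
    have h2 : (1/2 : ℂ).re = 1/2 := by norm_num
    rw [Complex.add_re, h2]; linarith
  · have := cpow_half_sq (-l + 1/4)
    linear_combination this

lemma xiX_conj (s : ℂ) (hs : 0 < s.re) : xiX ((starRingEnd ℂ) s) = (starRingEnd ℂ) (xiX s) := by
  by_cases h1 : s = 1
  · subst h1; simp [xiX]
  have h2 : (starRingEnd ℂ) s ≠ 1 := by
    intro h; apply h1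
    have := congrArg (starRingEnd ℂ) h
    simpa using this
  rw [xiX_eq s hs h1, xiX_eq _ (by simpa using hs) h2, riemannZeta_conj, Gammaℝ_def, Gammaℝ_def]
  have e1 : (starRingEnd ℂ) s / 2 = (starRingEnd ℂ) (s / 2) := by simp [map_ofNat]
  have e2 : (Real.pi : ℂ) ^ (-(starRingEnd ℂ) s / 2) = (starRingEnd ℂ) ((Real.pi:ℂ) ^ (-s/2)) := by
    rw [Complex.cpow_def_of_ne_zero (by simp [Real.pi_ne_zero]),
      Complex.cpow_def_of_ne_zero (by simp [Real.pi_ne_zero]), ← Complex.exp_conj]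
    simp [← Complex.ofReal_log Real.pi_pos.le, map_ofNat]
  rw [e1, Complex.Gamma_conj, e2]
  simp

lemma xiG_zero_conj (l : ℂ) (h : xiG (-l) = 0) : xiG (-((starRingEnd ℂ) l)) = 0 := by
  obtain ⟨ρ, h1, h2, h3, rfl⟩ := xiG_zero_data l h
  have := xiX_conj ρ (by linarith)
  rw [h3, map_zero, ← xiG_eq] at this
  rw [← this]; congr 1
  simp; ring

end PartNoC

section PartNoD

open Complex Filter Topology Metric Set MeasureTheory

/-- multiplicity of `l` : order of `xiG` at `-l` -/
noncomputable def mm (l : ℂ) : ℝ := analyticOrderNatAt xiG (-l)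

lemma mm_nonneg (l : ℂ) : 0 ≤ mm l := Nat.cast_nonneg _

lemma mm_zero (l : ℂ) (h : xiG (-l) ≠ 0) : mm l = 0 := by
  simp [mm, had_order_zero xiG (-l) h]

lemma mm_pos (l : ℂ) (h : xiG (-l) = 0) : 1 ≤ mm l := by
  have := had_order_pos xiG xiG_diff xiG_zero (-l) h
  unfold mm; exact_mod_cast this

lemma xiG_of_mm (l : ℂ) (h : mm l ≠ 0) : xiG (-l) = 0 := by
  by_contra h'; exact h (mm_zero l h')

/-- data of the zero in rectangular form -/
lemma zero_rect (l : ℂ) (h : xiG (-l) = 0) : 0 < l.re ∧ l.im ^ 2 ≤ l.re := by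
  obtain ⟨ρ, h1, h2, h3, rfl⟩ := xiG_zero_data l h
  have e1 : (ρ * (1 - ρ)).re = ρ.re * (1 - ρ.re) + ρ.im ^ 2 := by simp; ring
  have e2 : (ρ * (1 - ρ)).im = ρ.im * (1 - 2 * ρ.re) := by simp; ring
  rw [e1, e2]
  have hb : 0 < ρ.re * (1 - ρ.re) := mul_pos (by linarith) (by linarith)
  refine ⟨by positivity, ?_⟩
  have : (1 - 2 * ρ.re)^2 ≤ 1 := by nlinarith
  rw [mul_pow]
  nlinarith [sq_nonneg ρ.im]

lemma inv_re_pos (l : ℂ) (h : 0 < l.re) : 0 < (1 / l).re := by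
  rw [one_div, Complex.inv_re]
  have : l ≠ 0 := by rintro rfl; simp at h
  exact div_pos h (Complex.normSq_pos.2 this)

lemma hasSum_neg_iff' (f : ℂ → ℂ) (s : ℂ) : HasSum (fun l => f (-l)) s ↔ HasSum f s :=
  (Equiv.neg ℂ).hasSum_iff

lemma zeros_hasSum_re :
    HasSum (fun l : ℂ => mm l * (1 / l).re) (logDeriv xiG 0).re := by
  obtain ⟨C, hC, hb⟩ := xiG_growth
  have h := had_tendsto xiG xiG_diff xiG_zero C hC hb 0 (by rw [xiG_zero]; exact one_ne_zero)
  have h2 := (Complex.continuous_re.tendsto _).comp h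
  have h3 : HasSum (fun a : ℂ => mm (-a) * (1 / (-a)).re) (logDeriv xiG 0).re := by
    apply had_summable xiG xiG_diff xiG_zero
    · intro a ha
      rw [mm_zero (-a) (by simpa using ha), zero_mul]
    · intro a
      by_cases ha : xiG a = 0
      · apply mul_nonneg (mm_nonneg _)
        exact (inv_re_pos _ (zero_rect (-a) (by simpa using ha)).1).le
      · rw [mm_zero (-a) (by simpa using ha), zero_mul]
    · refine h2.congr fun R => ?_
      simp only [Function.comp, Complex.re_sum]
      refine Finset.sum_congr rfl fun a _ => ?_
      rw [zero_sub, mm, neg_neg, div_eq_mul_one_div, ← Complex.ofReal_natCast, Complex.re_ofReal_mul]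
  rw [← (Equiv.neg ℂ).hasSum_iff]  at h3
  simpa only [Function.comp_def, Equiv.neg_apply, neg_neg] using h3

lemma zeros_summable_re : Summable (fun l : ℂ => mm l * (1 / l).re) := zeros_hasSum_re.summable

lemma norm_sq_rect (l : ℂ) : ‖l‖ ^ 2 = l.re ^ 2 + l.im ^ 2 := by
  rw [Complex.sq_norm, Complex.normSq_apply]; ring

lemma inv_re_eq (l : ℂ) : (1 / l).re = l.re / (l.re ^ 2 + l.im ^ 2) := by
  rw [one_div, Complex.inv_re, Complex.normSq_apply]; ring_nf

lemma inv_re_ge (l : ℂ) (h1 : 0 < l.re) (h2 : l.im ^ 2 ≤ l.re) : 1 / (l.re + 1) ≤ (1 / l).re := by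
  rw [inv_re_eq, div_le_div_iff₀ (by linarith) (by positivity)]
  nlinarith

/-- lower bound for the real parts, coming from convergence alone -/
lemma finite_small (R : ℝ) : {l : ℂ | mm l ≠ 0 ∧ ‖l‖ ≤ R}.Finite := by
  have := had_zeros_finite xiG xiG_diff xiG_zero R
  have h2 := this.preimage (f := fun l : ℂ => -l) neg_injective.injOn
  apply h2.subset
  rintro l ⟨h1, h3⟩
  exact ⟨xiG_of_mm l h1, by simpa using h3⟩

lemma zeros_summable (w : ℂ) : Summable (fun l : ℂ => (mm l : ℂ) / (w + l)) := by
  refine Summable.of_norm_bounded_eventually (zeros_summable_re.mul_left 6) ?_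
  have hfin := finite_small (2 * ‖w‖ + 2)
  rw [Filter.eventually_cofinite]
  apply hfin.subset
  intro l hl
  simp only [mem_ofPred_eq] at hl ⊢
  by_contra hcon
  apply hl
  by_cases h0 : mm l = 0
  · simp [h0]
  have hlarge : 2 * ‖w‖ + 2 < ‖l‖ := by
    by_contra h'; exact hcon ⟨h0, not_lt.1 h'⟩
  obtain ⟨h1, h2⟩ := zero_rect l (xiG_of_mm l h0)
  have hw := norm_nonneg w
  have h3 : ‖l‖ / 2 ≤ ‖w + l‖ := by
    have := norm_sub_norm_le l (-w)
    rw [norm_neg, sub_neg_eq_add, add_comm l w] at this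
    linarith
  have hlp : 0 < ‖l‖ := by linarith
  rw [norm_div, Complex.norm_real, Real.norm_of_nonneg (mm_nonneg l)]
  have h4 : 1 / ‖w + l‖ ≤ 6 * (1/l).re := by
    have h5 : 1 / ‖w + l‖ ≤ 2 / ‖l‖ := by
      rw [div_le_div_iff₀ (by linarith) hlp]; linarith
    have h6 : 2 / ‖l‖ ≤ 6 * (1/l).re := by
      rw [inv_re_eq, ← norm_sq_rect]
      rw [div_le_iff₀ hlp]
      have : 6 * (l.re / ‖l‖ ^ 2) * ‖l‖ = 6 * l.re / ‖l‖ := by field_simp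
      rw [this, le_div_iff₀ hlp]
      have h7 := norm_sq_rect l
      -- ‖l‖² ≤ a² + a; ‖l‖ ≥ 2
      have h8 : ‖l‖ ^ 2 ≤ l.re ^ 2 + l.re := by linarith
      nlinarith
    linarith
  calc mm l / ‖w + l‖ = mm l * (1 / ‖w + l‖) := by ring
    _ ≤ mm l * (6 * (1/l).re) := mul_le_mul_of_nonneg_left h4 (mm_nonneg l)
    _ = _ := by ring

lemma zeros_hasSum (w : ℂ) (hw : xiG w ≠ 0) :
    HasSum (fun l : ℂ => (mm l : ℂ) / (w + l)) (logDeriv xiG w) := by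
  have hs := (zeros_summable w).hasSum
  obtain ⟨C, hC, hb⟩ := xiG_growth
  have h := had_tendsto xiG xiG_diff xiG_zero C hC hb w hw
  have h2 : HasSum (fun a : ℂ => (mm (-a) : ℂ) / (w + -a)) (∑' l : ℂ, (mm l : ℂ) / (w + l)) :=
    (Equiv.neg ℂ).hasSum_iff.2 hs
  have h3 := had_hasSum xiG xiG_diff xiG_zero _ ?_ _ h2
  · have : Tendsto (fun R : ℝ => ∑ a ∈ hadZ xiG xiG_diff xiG_zero R, (mm (-a) : ℂ) / (w + -a))
        atTop (𝓝 (logDeriv xiG w)) := by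
      refine h.congr fun R => Finset.sum_congr rfl fun a _ => ?_
      simp [mm, sub_eq_add_neg]
    rw [tendsto_nhds_unique this h3]
    exact hs
  · intro a ha
    rw [mm_zero (-a) (by simpa using ha)]; simp

lemma logDeriv_xiX (s : ℂ) : logDeriv xiX s = (2 * s - 1) * logDeriv xiG (s * (s - 1)) := by
  have e : xiX = xiG ∘ (fun s => s * (s - 1)) := by ext s; exact (xiG_eq s).symm
  conv_lhs => rw [e]
  rw [logDeriv_comp (xiG_diff _) (by fun_prop)]
  have : HasDerivAt (fun s : ℂ => s * (s - 1)) (2 * s - 1) s := by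
    have := (hasDerivAt_id' s).fun_mul ((hasDerivAt_id' s).sub_const 1)
    exact this.congr_deriv (by ring)
  rw [this.deriv]; ring

lemma logDeriv_xiG_zero : logDeriv xiG 0 = completedRiemannZeta₀ 1 := by
  have h := logDeriv_xiX 1
  norm_num at h
  rw [← h, logDeriv_apply]
  have h1 : xiX 1 = 1 := by simp [xiX]
  rw [h1, div_one]
  have : HasDerivAt xiX (completedRiemannZeta₀ 1) 1 := by
    have hd := (differentiable_completedZeta₀ 1).hasDerivAt
    have := (((hasDerivAt_id' (1:ℂ)).fun_mul ((hasDerivAt_id' (1:ℂ)).sub_const 1)).fun_mul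
      hd).add_const 1
    exact this.congr_deriv (by simp)
  exact this.deriv

lemma zeta0_val : (completedRiemannZeta₀ 1) =
    (((Real.eulerMascheroniConstant - Real.log (4 * Real.pi)) / 2 + 1 : ℝ) : ℂ) := by
  rw [completedRiemannZeta₀_one]
  push_cast [Complex.ofReal_log (show (0:ℝ) ≤ 4 * Real.pi by positivity)]
  rfl

end PartNoD

section PartNoE

open Complex Filter Topology Metric Set MeasureTheory

noncomputable def rdig (x : ℝ) : ℝ := deriv Real.Gamma x / Real.Gamma x

lemma rdig_eq (x : ℝ) (hx : 0 < x) : Complex.digamma (x : ℂ) = (rdig x : ℂ) := by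
  have hne : ∀ m : ℕ, (x:ℂ) ≠ -m := by
    intro m h
    have := congrArg Complex.re h
    simp at this
    have h2 : (0:ℝ) ≤ m := Nat.cast_nonneg m
    linarith
  have hner : ∀ m : ℕ, x ≠ -m := by
    intro m h
    have h2 : (0:ℝ) ≤ m := Nat.cast_nonneg m
    linarith
  have h1 := (Complex.differentiableAt_Gamma (x:ℂ) hne).hasDerivAt.comp_ofReal
  have h2 := (Real.differentiableAt_Gamma hner).hasDerivAt.ofReal_comp
  have h3 : (fun y : ℝ => Complex.Gamma (y:ℂ)) = fun y : ℝ => ((Real.Gamma y : ℝ) : ℂ) := by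
    ext y; exact Complex.Gamma_ofReal y
  rw [h3] at h1
  have h4 := h1.unique h2
  rw [Complex.digamma_def, logDeriv_apply, h4, Complex.Gamma_ofReal, rdig]
  push_cast; rfl

lemma rdig_hasDeriv (x : ℝ) (hx : 0 < x) : HasDerivAt (Real.log ∘ Real.Gamma) (rdig x) x := by
  have hner : ∀ m : ℕ, x ≠ -m := by
    intro m h
    have h2 : (0:ℝ) ≤ m := Nat.cast_nonneg m
    linarith
  exact (Real.differentiableAt_Gamma hner).hasDerivAt.log (Real.Gamma_pos_of_pos hx).ne'

lemma rdig_slope (x : ℝ) (hx : 0 < x) : slope (Real.log ∘ Real.Gamma) x (x+1) = Real.log x := by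
  rw [slope_def_field]
  simp only [Function.comp, add_sub_cancel_left, div_one]
  rw [Real.Gamma_add_one hx.ne', Real.log_mul hx.ne' (Real.Gamma_pos_of_pos hx).ne']
  ring

lemma rdig_le_log (x : ℝ) (hx : 0 < x) : rdig x ≤ Real.log x := by
  rw [← rdig_slope x hx]
  exact Real.convexOn_log_Gamma.le_slope_of_hasDerivAt hx (show (0:ℝ) < x + 1 by linarith)
    (by linarith) (rdig_hasDeriv x hx)

lemma log_le_rdig (x : ℝ) (hx : 0 < x) : Real.log x ≤ rdig (x + 1) := by
  rw [← rdig_slope x hx]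
  exact Real.convexOn_log_Gamma.slope_le_of_hasDerivAt hx (show (0:ℝ) < x + 1 by linarith)
    (by linarith) (rdig_hasDeriv (x+1) (by linarith))

lemma rdig_add_one (x : ℝ) (hx : 0 < x) : rdig (x + 1) = rdig x + 1 / x := by
  have hne : ∀ m : ℕ, (x:ℂ) ≠ -m := by
    intro m h
    have := congrArg Complex.re h
    simp at this
    have h2 : (0:ℝ) ≤ m := Nat.cast_nonneg m
    linarith
  have h := Complex.digamma_apply_add_one (x:ℂ) hne
  have e : (x:ℂ) + 1 = ((x + 1 : ℝ) : ℂ) := by push_cast; rfl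
  rw [e, rdig_eq _ (by linarith), rdig_eq x hx] at h
  rw [one_div]
  exact_mod_cast h

lemma rdig_add_nat (x : ℝ) (hx : 0 < x) (n : ℕ) :
    rdig (x + n) = rdig x + ∑ k ∈ Finset.range n, 1 / (x + k) := by
  induction n with
  | zero => simp
  | succ n ih =>
    rw [Finset.sum_range_succ, ← add_assoc, ← ih, ← rdig_add_one _ (by positivity)]
    congr 1; push_cast; ring

lemma rdig_tendsto (x : ℝ) (hx : 0 < x) :
    Tendsto (fun n : ℕ => rdig (x + n) - rdig (1 + n)) atTop (𝓝 0) := by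
  -- |rdig(y) - log y| ≤ 1/y
  have hb : ∀ y : ℝ, 0 < y → |rdig y - Real.log y| ≤ 1 / y := by
    intro y hy
    have h1 := rdig_le_log y hy
    have h2 := log_le_rdig y hy
    rw [rdig_add_one y hy] at h2
    have h3 : 0 < 1 / y := by positivity
    rw [abs_le]
    constructor
    · linarith
    · linarith
  have hl : ∀ y : ℝ, 0 < y → Tendsto (fun n : ℕ => rdig (y + n) - Real.log n) atTop (𝓝 0) := by
    intro y hy
    have h1 : Tendsto (fun n : ℕ => rdig (y + n) - Real.log (y + n)) atTop (𝓝 0) := by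
      have : Tendsto (fun n : ℕ => 1 / (y + (n:ℝ))) atTop (𝓝 0) := by
        apply Tendsto.const_div_atTop
        exact tendsto_atTop_add_const_left _ _ tendsto_natCast_atTop_atTop
      refine squeeze_zero_norm (fun n => ?_) this
      exact hb _ (by positivity)
    have h2 : Tendsto (fun n : ℕ => Real.log (y + n) - Real.log n) atTop (𝓝 0) := by
      have h3 : Tendsto (fun n : ℕ => Real.log (y / n + 1)) atTop (𝓝 0) := by
        have : Tendsto (fun n : ℕ => y / (n:ℝ) + 1) atTop (𝓝 (0 + 1)) :=
          (tendsto_natCast_atTop_atTop.const_div_atTop y).add_const 1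
        rw [zero_add] at this
        have h4 := this.log one_ne_zero
        rwa [Real.log_one] at h4
      refine h3.congr' ?_
      filter_upwards [eventually_gt_atTop 0] with n hn
      have hn' : (0:ℝ) < n := by exact_mod_cast hn
      rw [← Real.log_div (by positivity) (by positivity)]
      congr 1; field_simp
    have := h1.add h2
    rw [add_zero] at this
    exact this.congr fun n => by ring
  have := (hl x hx).sub (hl 1 one_pos)
  rw [sub_zero] at this
  exact this.congr fun n => by ring

lemma rdig_one : rdig 1 = -Real.eulerMascheroniConstant := by
  have := rdig_eq 1 one_pos
  rw [Complex.ofReal_one, Complex.digamma_one] at this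
  exact_mod_cast this.symm

lemma rdig_series (x : ℝ) (hx : 0 < x) :
    Tendsto (fun n : ℕ => ∑ k ∈ Finset.range n, (1 / ((k:ℝ) + 1) - 1 / (k + x))) atTop
      (𝓝 (rdig x + Real.eulerMascheroniConstant)) := by
  have h := (rdig_tendsto x hx).const_sub (rdig x + Real.eulerMascheroniConstant)
  rw [sub_zero] at h
  refine h.congr fun n => ?_
  rw [rdig_add_nat x hx, rdig_add_nat 1 one_pos, rdig_one, Finset.sum_sub_distrib]
  have e1 : ∑ k ∈ Finset.range n, 1 / ((k:ℝ) + 1) = ∑ k ∈ Finset.range n, 1 / (1 + (k:ℝ)) :=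
    Finset.sum_congr rfl fun k _ => by rw [add_comm]
  have e2 : ∑ k ∈ Finset.range n, 1 / ((k:ℝ) + x) = ∑ k ∈ Finset.range n, 1 / (x + (k:ℝ)) :=
    Finset.sum_congr rfl fun k _ => by rw [add_comm]
  rw [e1, e2]; ring

lemma dig_term_bound (R : ℝ) (z : ℂ) (hz : 1/2 < z.re) (hR : ‖z‖ < R) (k : ℕ) :
    ‖1 / ((k:ℂ) + 1) - 1 / (k + z)‖ ≤ 2 * (R + 1) * (1 / ((k:ℝ) + 1) ^ 2) := by
  have hk : (0:ℝ) ≤ k := Nat.cast_nonneg k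
  have h1 : ((k:ℝ) + 1) / 2 ≤ ‖(k:ℂ) + z‖ := by
    refine le_trans ?_ (Complex.re_le_norm _)
    simp; linarith
  have hk1 : ((k:ℂ) + 1) ≠ 0 := by exact_mod_cast Nat.succ_ne_zero k
  have hkz : ((k:ℂ) + z) ≠ 0 := norm_pos_iff.1 (by linarith)
  have e : 1 / ((k:ℂ) + 1) - 1 / (k + z) = (z - 1) / ((k + 1) * (k + z)) := by
    field_simp; ring
  rw [e, norm_div, norm_mul]
  have e2 : ‖(k:ℂ) + 1‖ = k + 1 := by
    have : ((k:ℂ) + 1) = ((k + 1 : ℕ) : ℂ) := by push_cast; rfl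
    rw [this, Complex.norm_natCast]; push_cast; rfl
  rw [e2]
  have h3 : ‖z - 1‖ ≤ R + 1 := by
    have := norm_sub_le z 1
    rw [norm_one] at this; linarith
  have hR0 : 0 ≤ R + 1 := (norm_nonneg _).trans h3
  calc ‖z - 1‖ / ((k + 1) * ‖(k:ℂ) + z‖) ≤ (R + 1) / ((k + 1) * ((k + 1)/2)) := by gcongr
    _ = _ := by field_simp

lemma summable_inv_sq_succ : Summable (fun k : ℕ => 1 / ((k:ℝ) + 1) ^ 2) := by
  have := (summable_nat_add_iff 1).2 (Real.summable_one_div_nat_pow.2 (show 1 < 2 by norm_num))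
  simpa using this

lemma dig_hasSum (z : ℂ) (hz : 1/2 < z.re) :
    HasSum (fun k : ℕ => 1 / ((k:ℂ) + 1) - 1 / (k + z))
      (Complex.digamma z + Real.eulerMascheroniConstant) := by
  set R := ‖z‖ + 2 with hR
  set U : Set ℂ := {z | 1/2 < z.re} ∩ ball 0 R with hU
  have hsum : Summable (fun k : ℕ => 2 * (R + 1) * (1 / ((k:ℝ) + 1) ^ 2)) :=
    summable_inv_sq_succ.mul_left _
  have hUo : IsOpen U := (isOpen_lt continuous_const Complex.continuous_re).inter isOpen_ball
  have hUc : IsPreconnected U :=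
    ((convex_halfSpace_re_gt (1/2)).inter (convex_ball _ _)).isPreconnected
  have hbd : ∀ (k : ℕ) (w : ℂ), w ∈ U →
      ‖1 / ((k:ℂ) + 1) - 1 / (k + w)‖ ≤ 2 * (R + 1) * (1 / ((k:ℝ) + 1) ^ 2) := fun k w hw =>
    dig_term_bound R w hw.1 (mem_ball_zero_iff.1 hw.2) k
  have hd : DifferentiableOn ℂ (fun w => ∑' k : ℕ, (1 / ((k:ℂ) + 1) - 1 / (k + w))) U := by
    apply differentiableOn_tsum_of_summable_norm hsum _ hUo hbd
    intro k w hw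
    have : (k:ℂ) + w ≠ 0 := by
      intro h
      have := congrArg Complex.re h
      have h1 : 1/2 < w.re := hw.1
      have hk : (0:ℝ) ≤ k := Nat.cast_nonneg k
      simp at this; linarith
    apply DifferentiableAt.differentiableWithinAt
    fun_prop (disch := assumption)
  have hneU : ∀ w : ℂ, 1/2 < w.re → ∀ m : ℕ, w ≠ -m := by
    intro w hw m h
    have := congrArg Complex.re h
    have hk : (0:ℝ) ≤ m := Nat.cast_nonneg m
    simp at this; linarith
  have hdig : DifferentiableOn ℂ (fun w => Complex.digamma w + Real.eulerMascheroniConstant) U := by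
    apply DifferentiableOn.add_const
    have hGo : DifferentiableOn ℂ Complex.Gamma U := fun w hw =>
      (Complex.differentiableAt_Gamma w (hneU w hw.1)).differentiableWithinAt
    apply (hGo.deriv hUo).div hGo
    intro w hw
    exact Complex.Gamma_ne_zero (hneU w hw.1)
  have heq : EqOn (fun w => ∑' k : ℕ, (1 / ((k:ℂ) + 1) - 1 / (k + w)))
      (fun w => Complex.digamma w + Real.eulerMascheroniConstant) U := by
    have h1U : (1:ℂ) ∈ U := ⟨by norm_num, by rw [mem_ball_zero_iff, norm_one]; linarith [norm_nonneg z]⟩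
    refine (hd.analyticOnNhd hUo).eqOn_of_preconnected_of_frequently_eq
      (hdig.analyticOnNhd hUo) hUc h1U ?_
    -- real points near 1
    have hreal : ∀ x : ℝ, (x:ℂ) ∈ U → (∑' k : ℕ, (1 / ((k:ℂ) + 1) - 1 / (k + (x:ℂ)))) =
        Complex.digamma x + Real.eulerMascheroniConstant := by
      intro x hx
      have hx0 : 0 < x := by have : 1/2 < x := hx.1; linarith
      have hs : Summable (fun k : ℕ => (1 / ((k:ℂ) + 1) - 1 / (k + (x:ℂ)))) :=
        Summable.of_norm_bounded hsum (fun k => hbd k _ hx)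
      have t1 := hs.hasSum.tendsto_sum_nat
      have t2 := (Complex.continuous_ofReal.tendsto _).comp (rdig_series x hx0)
      rw [rdig_eq x hx0, ← Complex.ofReal_add]
      refine tendsto_nhds_unique t1 (t2.congr fun n => ?_)
      simp [Function.comp]
    have ht : Tendsto (fun n : ℕ => ((1 + 1 / ((n:ℝ) + 1) : ℝ) : ℂ)) atTop (𝓝[≠] 1) := by
      apply tendsto_nhdsWithin_of_tendsto_nhds_of_eventually_within
      · have : Tendsto (fun n : ℕ => (1 + 1 / ((n:ℝ) + 1) : ℝ)) atTop (𝓝 (1 + 0)) :=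
          tendsto_one_div_add_atTop_nhds_zero_nat.const_add 1
        have := (Complex.continuous_ofReal.tendsto _).comp this
        simpa [Function.comp_def] using this
      · refine Eventually.of_forall fun n => ?_
        have : (0:ℝ) < 1 / ((n:ℝ) + 1) := by positivity
        simp only [mem_compl_iff, mem_singleton_iff]
        intro h
        have h2 : (1 + 1 / ((n:ℝ) + 1) : ℝ) = 1 := by exact_mod_cast h
        linarith
    refine ht.frequently (Eventually.frequently ?_)
    have hU1 : ∀ᶠ n : ℕ in atTop, ((1 + 1 / ((n:ℝ) + 1) : ℝ) : ℂ) ∈ U :=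
      (ht.mono_right nhdsWithin_le_nhds).eventually (hUo.mem_nhds h1U)
    filter_upwards [hU1] with n hn
    exact hreal _ hn
  have hzU : z ∈ U := ⟨hz, by rw [mem_ball_zero_iff]; linarith⟩
  have hs : Summable (fun k : ℕ => (1 / ((k:ℂ) + 1) - 1 / (k + z))) :=
    Summable.of_norm_bounded hsum (fun k => hbd k _ hzU)
  have e := heq hzU
  beta_reduce at e
  rw [← e]
  exact hs.hasSum

end PartNoE

section PartNoF

open Complex Filter Topology Metric Set MeasureTheory

lemma dig_step (w : ℂ) (hw : 1/2 < w.re) :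
    -(1 / w).re ≤ Real.log ‖w‖ - Real.log ‖w + 1‖ +
      (1 / (w.re + |w.im| - 1/2) - 1 / (w.re + |w.im| + 1/2)) := by
  have hw0 : w ≠ 0 := by intro h; rw [h] at hw; simp at hw; linarith
  have hw1 : w + 1 ≠ 0 := by
    intro h; have := congrArg Complex.re h; simp at this; linarith
  have hn : 0 < normSq w := normSq_pos.mpr hw0
  have hn1 : 0 < normSq (w+1) := normSq_pos.mpr hw1
  have e1 : Real.log ‖w‖ = 1/2 * Real.log (normSq w) := by
    rw [normSq_eq_norm_sq, Real.log_pow]; push_cast; ring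
  have e2 : Real.log ‖w+1‖ = 1/2 * Real.log (normSq (w+1)) := by
    rw [normSq_eq_norm_sq, Real.log_pow]; push_cast; ring
  have h1 : Real.log (normSq (w+1) / normSq w) ≤ normSq (w+1) / normSq w - 1 :=
    Real.log_le_sub_one_of_pos (by positivity)
  rw [Real.log_div hn1.ne' hn.ne'] at h1
  have e3 : normSq (w+1) / normSq w - 1 = 2 * (1/w).re + 1 / normSq w := by
    rw [one_div w, Complex.inv_re]
    field_simp
    simp [normSq_apply]; ring
  set t := w.re + |w.im| with ht
  have hab : 0 ≤ |w.im| := abs_nonneg _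
  have ht0 : 1/2 < t := by linarith
  have h2 : 1 / normSq w ≤ 2 * (1 / (t - 1/2) - 1 / (t + 1/2)) := by
    have h3 : t^2 ≤ 2 * normSq w := by
      rw [normSq_apply]
      have : w.im * w.im = |w.im| * |w.im| := (abs_mul_abs_self _).symm
      rw [this, ht]; nlinarith [sq_nonneg (w.re - |w.im|)]
    have e4 : 1 / (t - 1/2) - 1 / (t + 1/2) = 1 / (t^2 - 1/4) := by
      have h7 : t - 1/2 ≠ 0 := by linarith
      have h8 : t + 1/2 ≠ 0 := by linarith
      rw [div_sub_div _ _ h7 h8]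
      congr 1 <;> ring
    rw [e4, div_le_iff₀ hn]
    have h5 : 0 < t^2 - 1/4 := by nlinarith
    rw [mul_assoc, one_div, ← div_eq_inv_mul, mul_div_assoc', le_div_iff₀ h5]
    linarith
  rw [e1, e2]
  linarith

lemma dig_partial (z : ℂ) (hz : 1/2 < z.re) (n : ℕ) :
    -∑ k ∈ Finset.range n, (1 / ((k:ℂ) + z)).re ≤ Real.log ‖z‖ - Real.log ‖z + n‖ +
      (1 / (z.re + |z.im| - 1/2) - 1 / (z.re + |z.im| + n - 1/2)) := by
  induction n with
  | zero => simp
  | succ n ih =>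
    rw [Finset.sum_range_succ]
    have hn : (0:ℝ) ≤ n := Nat.cast_nonneg n
    have h := dig_step (z + n) (by simp; linarith)
    have e1 : z + n + 1 = z + ((n+1 : ℕ) : ℂ) := by push_cast; ring
    have e2 : (z + (n:ℂ)).re = z.re + n := by simp
    have e3 : (z + (n:ℂ)).im = z.im := by simp
    rw [e1, e2, e3] at h
    rw [add_comm (n:ℂ) z]
    have e4 : z.re + n + |z.im| - 1/2 = z.re + |z.im| + n - 1/2 := by ring
    have e5 : z.re + n + |z.im| + 1/2 = z.re + |z.im| + ((n+1:ℕ):ℝ) - 1/2 := by push_cast; ring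
    rw [e4, e5] at h
    linarith

lemma dig_re_le (z : ℂ) (hz : 1/2 < z.re) :
    (Complex.digamma z).re ≤ Real.log ‖z‖ + 1 / (z.re + |z.im| - 1/2) := by
  have h1 := (Complex.hasSum_re (dig_hasSum z hz)).tendsto_sum_nat
  have h2 := Real.tendsto_harmonic_sub_log
  have h3 := h1.sub h2
  have e : (Complex.digamma z + Real.eulerMascheroniConstant).re - Real.eulerMascheroniConstant
      = (Complex.digamma z).re := by simp
  rw [e] at h3
  refine le_of_tendsto h3 ?_
  filter_upwards [eventually_ge_atTop 1] with n hn
  have h4 := dig_partial z hz n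
  have hn' : (1:ℝ) ≤ n := by exact_mod_cast hn
  have h5 : Real.log n ≤ Real.log ‖z + n‖ := by
    apply Real.log_le_log (by linarith)
    calc (n:ℝ) ≤ (z + n).re := by simp; linarith
      _ ≤ ‖z + n‖ := Complex.re_le_norm _
  have h6 : 0 ≤ 1 / (z.re + |z.im| + n - 1/2) := by
    have := abs_nonneg z.im
    apply div_nonneg zero_le_one; linarith
  have e2 : ∑ k ∈ Finset.range n, (1 / ((k:ℂ) + 1) - 1 / (k + z)).re
     = (harmonic n : ℝ) - ∑ k ∈ Finset.range n, (1 / ((k:ℂ) + z)).re := by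
    simp only [Complex.sub_re, Finset.sum_sub_distrib]
    congr 1
    rw [harmonic]
    push_cast
    refine Finset.sum_congr rfl fun k _ => ?_
    have : (1 / ((k:ℂ) + 1)) = (((k:ℝ) + 1)⁻¹ : ℝ) := by push_cast; rw [one_div]
    rw [this, ofReal_re]
  rw [e2]
  linarith

end PartNoF

section PartNoG

open Complex Filter Topology Metric Set MeasureTheory

lemma log_up (x : ℝ) (hx : 0 ≤ x) : Real.log (1 + x) ≤ (x + x / (1 + x)) / 2 := by
  have h := Real.self_le_sinh_iff.mpr (Real.log_nonneg (by linarith : (1:ℝ) ≤ 1 + x))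
  rw [Real.sinh_log (by linarith)] at h
  refine h.trans (le_of_eq ?_)
  field_simp
  ring

lemma log_lo (x : ℝ) (hx : 0 ≤ x) : 2 * x / (x + 2) ≤ Real.log (1 + x) :=
  Real.le_log_one_add_of_nonneg hx

lemma gamma_up (n : ℕ) : Real.eulerMascheroniConstant ≤ harmonic n - Real.log (n + 1/2) := by
  have hanti : Antitone (fun n : ℕ => (harmonic n : ℝ) - Real.log (n + 1/2)) := by
    refine antitone_nat_of_succ_le fun n => ?_
    rw [harmonic_succ]
    push_cast
    have hn : (0:ℝ) ≤ n := Nat.cast_nonneg n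
    have h := log_lo (1 / ((n:ℝ) + 1/2)) (by positivity)
    have e : 1 + 1 / ((n:ℝ) + 1/2) = (n + 1 + 1/2) / (n + 1/2) := by field_simp; ring
    rw [e, Real.log_div (by positivity) (by positivity)] at h
    have e2 : 2 * (1 / ((n:ℝ) + 1/2)) / (1 / ((n:ℝ) + 1/2) + 2) = (n + 1 : ℝ)⁻¹ := by
      field_simp; ring
    rw [e2] at h
    linarith
  have ht : Tendsto (fun n : ℕ => (harmonic n : ℝ) - Real.log (n + 1/2)) atTop
      (𝓝 Real.eulerMascheroniConstant) := by
    have h1 := Real.tendsto_harmonic_sub_log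
    have h2 := Real.tendsto_harmonic_sub_log_add_one
    refine tendsto_of_tendsto_of_tendsto_of_le_of_le' h2 h1 ?_ ?_
    · filter_upwards with n
      have hn : (0:ℝ) ≤ n := Nat.cast_nonneg n
      have := Real.log_le_log (by positivity : (0:ℝ) < n + 1/2) (by linarith : (n:ℝ) + 1/2 ≤ n + 1)
      linarith
    · filter_upwards [eventually_ge_atTop 1] with n hn
      have hn : (1:ℝ) ≤ n := by exact_mod_cast hn
      have := Real.log_le_log (by positivity : (0:ℝ) < n) (by linarith : (n:ℝ) ≤ n + 1/2)
      linarith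
  exact hanti.le_of_tendsto ht n

lemma gamma_lo (n : ℕ) : (harmonic (n+1) : ℝ) - Real.log (n + 1) - 1 / (2 * (n + 1)) ≤
    Real.eulerMascheroniConstant := by
  have hmono : Monotone (fun n : ℕ => (harmonic (n+1) : ℝ) - Real.log (n + 1) - 1 / (2 * (n + 1))) := by
    refine monotone_nat_of_le_succ fun n => ?_
    rw [harmonic_succ (n+1)]
    push_cast
    have hn : (0:ℝ) ≤ n := Nat.cast_nonneg n
    have h := log_up (1 / ((n:ℝ) + 1)) (by positivity)
    have e : 1 + 1 / ((n:ℝ) + 1) = (n + 1 + 1) / (n + 1) := by field_simp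
    rw [e, Real.log_div (by positivity) (by positivity)] at h
    have e2 : (1 / ((n:ℝ) + 1) + 1 / (n + 1) / ((n + 1 + 1) / (n + 1))) / 2 =
      1 / (2 * ((n:ℝ) + 1)) + 1 / (2 * (n + 1 + 1)) := by
      field_simp
    have e3 : ((n:ℝ) + 1 + 1)⁻¹ = 2 * (1 / (2 * (n + 1 + 1))) := by field_simp
    rw [e2] at h
    rw [e3]
    linarith
  have ht : Tendsto (fun n : ℕ => (harmonic (n+1) : ℝ) - Real.log (n + 1) - 1 / (2 * (n + 1))) atTop
      (𝓝 Real.eulerMascheroniConstant) := by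
    have h1 := (tendsto_add_atTop_iff_nat 1).mpr Real.tendsto_harmonic_sub_log
    have h2 : Tendsto (fun n : ℕ => 1 / (2 * ((n:ℝ) + 1))) atTop (𝓝 0) := by
      have := (tendsto_one_div_add_atTop_nhds_zero_nat (𝕜 := ℝ)).const_mul (1/2)
      simp only [mul_zero] at this
      refine this.congr fun n => ?_
      field_simp
    have := h1.sub h2
    rw [sub_zero] at this
    refine this.congr fun n => ?_
    push_cast; rfl
  exact hmono.ge_of_tendsto ht n

lemma log3_bd : 1.0986 ≤ Real.log 3 ∧ Real.log 3 ≤ 1.09862 := by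
  have h1 := Real.log_two_gt_d9
  have h2 := Real.log_two_lt_d9
  have h3 := log_up (13/243) (by norm_num)
  have h4 := log_lo (13/243) (by norm_num)
  have e : Real.log (1 + 13/243) = 8 * Real.log 2 - 5 * Real.log 3 := by
    rw [show (1 + 13/243 : ℝ) = 2^8 / 3^5 by norm_num, Real.log_div (by norm_num) (by norm_num),
      Real.log_pow, Real.log_pow]; norm_num
  rw [e] at h3 h4
  norm_num at h3 h4 ⊢
  constructor <;> linarith

lemma logpi_bd : 1.1447 ≤ Real.log Real.pi ∧ Real.log Real.pi ≤ 1.1448 := by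
  have hp1 := Real.pi_gt_d6
  have hp2 := Real.pi_lt_d6
  obtain ⟨h3, h4⟩ := log3_bd
  have e1 : Real.log 3.141592 = Real.log 3 + Real.log (1 + 0.141592/3) := by
    rw [← Real.log_mul (by norm_num) (by norm_num)]; norm_num
  have e2 : Real.log 3.141593 = Real.log 3 + Real.log (1 + 0.141593/3) := by
    rw [← Real.log_mul (by norm_num) (by norm_num)]; norm_num
  have h5 := Real.log_le_log (by norm_num) hp1.le
  have h6 := Real.log_le_log (by positivity) hp2.le
  have h7 := log_lo (0.141592/3) (by norm_num)
  have h8 := log_up (0.141593/3) (by norm_num)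
  rw [e1] at h5; rw [e2] at h6
  norm_num at h3 h4 h5 h6 h7 h8 ⊢
  constructor <;> linarith

lemma gamma_bd : 0.5768 ≤ Real.eulerMascheroniConstant ∧ Real.eulerMascheroniConstant ≤ 0.5774 := by
  have h1 := Real.log_two_gt_d9
  have h2 := Real.log_two_lt_d9
  have h3 := gamma_up 16
  have h4 := gamma_lo 15
  have e : ((harmonic 16 : ℚ) : ℝ) = 2436559/720720 := by
    have : harmonic 16 = 2436559/720720 := by
      simp only [harmonic, Finset.sum_range_succ]; norm_num
    rw [this]; norm_num
  have e1 : Real.log ((16:ℕ) + 1/2 : ℝ) = 4 * Real.log 2 + Real.log (1 + 1/32) := by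
    rw [show (4:ℝ) * Real.log 2 = Real.log (2^4) by rw [Real.log_pow]; norm_num, 
      ← Real.log_mul (by norm_num) (by norm_num)]; norm_num
  have e2 : Real.log ((15:ℕ) + 1 : ℝ) = 4 * Real.log 2 := by
    rw [show (4:ℝ) * Real.log 2 = Real.log (2^4) by rw [Real.log_pow]; norm_num]; norm_num
  have h5 := log_lo (1/32) (by norm_num)
  rw [e, e1] at h3
  rw [show 15 + 1 = 16 from rfl, e, e2] at h4
  norm_num at h3 h4 h5 ⊢
  constructor <;> linarith

/-- the sum over zeros -/
lemma xi_const_bd : (Real.eulerMascheroniConstant - Real.log (4 * Real.pi)) / 2 + 1 ≤ 0.0233 := by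
  have h1 := Real.log_two_gt_d9
  have h2 := gamma_bd.2
  have h3 := logpi_bd.1
  have e : Real.log (4 * Real.pi) = 2 * Real.log 2 + Real.log Real.pi := by
    rw [Real.log_mul (by norm_num) Real.pi_ne_zero, show (4:ℝ) = 2^2 by norm_num, Real.log_pow]
    norm_num
  rw [e]
  norm_num at h2 h3 ⊢
  linarith

end PartNoG

section PartNoH

open Complex Filter Topology Metric Set MeasureTheory

noncomputable def vM (s : ℂ) : ℂ := LSeries (fun n => (ArithmeticFunction.vonMangoldt n : ℂ)) s

lemma vM_eq (s : ℂ) (hs : 1 < s.re) : vM s = - logDeriv riemannZeta s := by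
  rw [vM, ArithmeticFunction.LSeries_vonMangoldt_eq_deriv_riemannZeta_div hs, logDeriv_apply]
  ring

lemma vM_hasSum (s : ℂ) (hs : 1 < s.re) :
    HasSum (fun n : ℕ => (ArithmeticFunction.vonMangoldt n : ℂ) * (n : ℂ) ^ (-s)) (vM s) := by
  have h := (ArithmeticFunction.LSeriesSummable_vonMangoldt hs).hasSum
  have e : (fun n : ℕ => (ArithmeticFunction.vonMangoldt n : ℂ) * (n : ℂ) ^ (-s)) =
      LSeries.term (fun n => (ArithmeticFunction.vonMangoldt n : ℂ)) s := by
    ext n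
    rw [LSeries.term_def₀ (by simp)]
  rw [e]; exact h

lemma vM_formula (s : ℂ) (hs : 1 < s.re) :
    vM s = 1 / (s - 1) + 1/2 * digamma (s / 2 + 1) - (Real.log Real.pi / 2 : ℝ) - logDeriv xiX s := by
  have hs0 : s ≠ 0 := by rintro rfl; simp at hs; linarith
  have hs1 : s ≠ 1 := by rintro rfl; simp at hs
  have hs1' : s - 1 ≠ 0 := sub_ne_zero.mpr hs1
  have hz := riemannZeta_ne_zero_of_one_le_re hs.le
  have hG : Gamma (s/2) ≠ 0 := Gamma_ne_zero_of_re_pos (by simp; linarith)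
  have hm : ∀ m : ℕ, s / 2 ≠ -m := by
    intro m h
    have := congrArg Complex.re h
    simp at this
    have h2 : (0:ℝ) ≤ m := Nat.cast_nonneg m
    linarith
  have hpi : (Real.pi : ℂ) ≠ 0 := by exact_mod_cast Real.pi_ne_zero
  have hev : xiX =ᶠ[𝓝 s] fun s => (s * (s - 1)) * (((Real.pi : ℂ) ^ (-s/2) * Gamma (s/2)) * riemannZeta s) := by
    have hopen : IsOpen {z : ℂ | 1 < z.re} := isOpen_lt continuous_const continuous_re
    filter_upwards [hopen.mem_nhds hs] with z hz
    have hz' : 1 < z.re := hz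
    rw [xiX_eq z (by linarith) (by rintro rfl; simp at hz')]
    rfl
  have h1 : logDeriv xiX s = _ := (logDeriv_congr_nhds hev).eq_of_nhds
  have hpd : HasDerivAt (fun z : ℂ => (Real.pi : ℂ) ^ (-z/2)) ((Real.pi:ℂ) ^ (-s/2) * log Real.pi * (-1/2)) s := by
    have := ((hasDerivAt_id' s).neg.div_const 2).const_cpow (c := (Real.pi:ℂ)) (Or.inl hpi)
    exact this
  have hgd : DifferentiableAt ℂ (fun z : ℂ => Gamma (z / 2)) s := by
    have := differentiableAt_Gamma (s/2) hm
    exact this.comp s (by fun_prop)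
  have hzd : DifferentiableAt ℂ riemannZeta s := differentiableAt_riemannZeta hs1
  have hp0 : (Real.pi : ℂ) ^ (-s/2) ≠ 0 := by simp [hpi]
  rw [logDeriv_mul s (f := fun s : ℂ => s * (s - 1))
      (g := fun s : ℂ => (Real.pi : ℂ) ^ (-s/2) * Gamma (s/2) * riemannZeta s)
      (mul_ne_zero hs0 hs1') (mul_ne_zero (mul_ne_zero hp0 hG) hz) (by fun_prop)
      ((hpd.differentiableAt.mul hgd).mul hzd),
    logDeriv_mul s (f := fun s : ℂ => s) (g := fun s : ℂ => s - 1) hs0 hs1' (by fun_prop) (by fun_prop),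
    logDeriv_mul s (f := fun s : ℂ => (Real.pi : ℂ) ^ (-s/2) * Gamma (s/2)) (g := riemannZeta)
      (mul_ne_zero hp0 hG) hz (hpd.differentiableAt.mul hgd) hzd,
    logDeriv_mul s (f := fun s : ℂ => (Real.pi : ℂ) ^ (-s/2)) (g := fun s : ℂ => Gamma (s/2))
      hp0 hG hpd.differentiableAt hgd] at h1
  have e1 : logDeriv (fun z : ℂ => (Real.pi : ℂ) ^ (-z/2)) s = - (Real.log Real.pi / 2 : ℝ) := by
    rw [logDeriv_apply, hpd.deriv]
    push_cast [Complex.ofReal_log Real.pi_pos.le]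
    field_simp
  have e2 : logDeriv (fun z : ℂ => Gamma (z/2)) s = 1/2 * digamma (s/2) := by
    have : HasDerivAt (fun z : ℂ => z / 2) (1/2) s := (hasDerivAt_id' s).div_const 2
    have h := logDeriv_comp (f := Gamma) (g := fun z : ℂ => z / 2) (x := s)
      (differentiableAt_Gamma (s/2) hm) this.differentiableAt
    rw [this.deriv] at h
    rw [show (fun z : ℂ => Gamma (z/2)) = Gamma ∘ (fun z : ℂ => z / 2) from rfl, h, digamma_def]
    ring
  have e3 : logDeriv (fun z : ℂ => z - 1) s = 1 / (s - 1) := by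
    rw [logDeriv_apply]; simp
  have e4 : logDeriv (fun z : ℂ => z) s = 1 / s := logDeriv_id' s
  have e5 := Complex.digamma_apply_add_one (s/2) hm
  rw [e1, e2, e3, e4] at h1
  rw [vM_eq s hs, h1, e5]
  field_simp
  ring

lemma xiX_ne_zero (s : ℂ) (hs : 1 < s.re) : xiX s ≠ 0 := by
  intro h
  have := xiX_zero_re s h
  linarith

lemma xi_hasSum (s : ℂ) (hs : 1 < s.re) :
    HasSum (fun l : ℂ => (mm l : ℂ) * ((2 * s - 1) / (s * (s - 1) + l))) (logDeriv xiX s) := by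
  rw [logDeriv_xiX]
  have h := (zeros_hasSum (s * (s-1)) (by rw [xiG_eq]; exact xiX_ne_zero s hs)).mul_left (2 * s - 1)
  refine h.congr_fun fun l => ?_ 
  ring

lemma xi_term (s ρ : ℂ) (hs : 1 < s.re) (h1 : 0 ≤ ρ.re) (h2 : ρ.re ≤ 1) :
    (2 * s - 1) / (s * (s - 1) + ρ * (1 - ρ)) = 1 / (s - ρ) + 1 / (s - (1 - ρ)) := by
  have e1 : s - ρ ≠ 0 := by
    intro h; have := congrArg Complex.re h; simp at this; linarith
  have e2 : s - (1 - ρ) ≠ 0 := by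
    intro h; have := congrArg Complex.re h; simp at this; linarith
  rw [div_add_div _ _ e1 e2]
  congr 1 <;> ring

lemma inv_re_nonneg (w : ℂ) (h : 0 < w.re) : 0 ≤ (1 / w).re := (inv_re_pos w h).le

lemma xi_term_nonneg (s l : ℂ) (hs : 1 < s.re) :
    0 ≤ ((mm l : ℂ) * ((2 * s - 1) / (s * (s - 1) + l))).re := by
  by_cases hm : mm l = 0
  · simp [hm]
  obtain ⟨ρ, h1, h2, h3, rfl⟩ := xiG_zero_data l (xiG_of_mm l hm)
  rw [xi_term s ρ hs (by linarith) h2.le, re_ofReal_mul]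
  apply mul_nonneg (mm_nonneg _)
  rw [add_re]
  have a1 := inv_re_nonneg (s - ρ) (by simp; linarith)
  have a2 := inv_re_nonneg (s - (1 - ρ)) (by simp; linarith)
  linarith

lemma xi_re_nonneg (s : ℂ) (hs : 1 < s.re) : 0 ≤ (logDeriv xiX s).re :=
  (Complex.hasSum_re (xi_hasSum s hs)).nonneg fun l => xi_term_nonneg s l hs

lemma xi_re_ge (s ρ : ℂ) (hs : 1 < s.re) (h1 : 1/2 ≤ ρ.re) (h2 : ρ.re < 1) (h3 : xiX ρ = 0) :
    (1 / (s - ρ)).re ≤ (logDeriv xiX s).re := by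
  have h := le_hasSum (Complex.hasSum_re (xi_hasSum s hs)) (ρ * (1 - ρ)) fun l _ => xi_term_nonneg s l hs
  refine le_trans ?_ h
  have hm : 1 ≤ mm (ρ * (1 - ρ)) := by
    apply mm_pos
    rw [show -(ρ * (1 - ρ)) = ρ * (ρ - 1) by ring, xiG_eq, h3]
  rw [xi_term s ρ hs (by linarith) h2.le, re_ofReal_mul, add_re]
  have a1 := inv_re_nonneg (s - ρ) (by simp; linarith)
  have a2 := inv_re_nonneg (s - (1 - ρ)) (by simp; linarith)
  nlinarith

lemma xiLog0_re : (logDeriv xiG 0).re ≤ 0.0233 := by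
  rw [logDeriv_xiG_zero, zeta0_val, ofReal_re]; exact xi_const_bd

lemma zero_a (l : ℂ) (h : xiG (-l) = 0) : 41 ≤ l.re := by
  obtain ⟨h1, h2⟩ := zero_rect l h
  have h3 := le_hasSum zeros_hasSum_re l fun j hj => by
    by_cases hm : mm j = 0
    · simp [hm]
    · exact mul_nonneg (mm_nonneg _) (inv_re_pos j (zero_rect j (xiG_of_mm j hm)).1).le
  have h4 := inv_re_ge l h1 h2
  have h5 := mm_pos l h
  have h6 := inv_re_pos l h1
  have h7 : 1 / (l.re + 1) ≤ 0.0233 := by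
    have := xiLog0_re; nlinarith
  rw [div_le_iff₀ (by linarith)] at h7
  norm_num at h7
  linarith

lemma zero_a' (l : ℂ) (h : xiG (-l) = 0) (him : l.im ≠ 0) : 84.8 ≤ l.re := by
  obtain ⟨h1, h2⟩ := zero_rect l h
  have hne : l ≠ (starRingEnd ℂ) l := by
    intro e
    have := congrArg Complex.im e
    simp at this
    apply him; linarith
  have h3 := sum_le_hasSum {l, (starRingEnd ℂ) l} (fun j hj => by
    by_cases hm : mm j = 0
    · simp [hm]
    · exact mul_nonneg (mm_nonneg _) (inv_re_pos j (zero_rect j (xiG_of_mm j hm)).1).le) zeros_hasSum_re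
  rw [Finset.sum_pair hne] at h3
  have h4 := inv_re_ge l h1 h2
  have h4' := inv_re_ge ((starRingEnd ℂ) l) (by simpa using h1) (by simpa using h2)
  rw [conj_re] at h4'
  have h5 := mm_pos l h
  have h5' := mm_pos _ (xiG_zero_conj l h)
  have h6 := inv_re_pos l h1
  have h6' := inv_re_pos ((starRingEnd ℂ) l) (by simpa using h1)
  have h7 : 2 * (1 / (l.re + 1)) ≤ 0.0233 := by
    have := xiLog0_re; nlinarith
  rw [← mul_div_assoc, div_le_iff₀ (by linarith)] at h7
  norm_num at h7 ⊢
  linarith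

end PartNoH

section PartNoI

open Complex Filter Topology Metric Set MeasureTheory

lemma ncpow_re (n : ℕ) (σ t : ℝ) (hn : n ≠ 0) :
    ((n:ℂ) ^ (-((σ:ℂ) + t * I))).re = Real.exp (-σ * Real.log n) * Real.cos (t * Real.log n) := by
  have hn' : (n:ℂ) ≠ 0 := by exact_mod_cast hn
  rw [cpow_def_of_ne_zero hn', ← Complex.natCast_log, Complex.exp_re]
  generalize Real.log n = L
  have e1 : ((L : ℂ) * -((σ:ℂ) + t * I)).re = -σ * L := by
    simp; ring
  have e2 : ((L : ℂ) * -((σ:ℂ) + t * I)).im = -(t * L) := by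
    simp; ring
  rw [e1, e2, Real.cos_neg]

lemma three_four_one (σ t : ℝ) (hσ : 1 < σ) :
    0 ≤ 3 * (vM σ).re + 4 * (vM (σ + t * I)).re + (vM (σ + (2 * t : ℝ) * I)).re := by
  have h0 := Complex.hasSum_re (vM_hasSum ((σ:ℂ) + (0:ℝ) * I) (by simpa using hσ))
  have h1 := Complex.hasSum_re (vM_hasSum ((σ:ℂ) + t * I) (by simpa using hσ))
  have h2 := Complex.hasSum_re (vM_hasSum ((σ:ℂ) + (2 * t : ℝ) * I) (by simpa using hσ))
  have h := ((h0.mul_left 3).add (h1.mul_left 4)).add h2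
  have e : (σ:ℂ) + (0:ℝ) * I = σ := by simp
  rw [e] at h
  refine h.nonneg fun n => ?_
  rcases eq_or_ne n 0 with rfl | hn
  · simp
  have e0 := ncpow_re n σ 0 hn
  rw [e] at e0
  simp only [re_ofReal_mul, ncpow_re n _ _ hn, e0]
  have hΛ := ArithmeticFunction.vonMangoldt_nonneg (n := n)
  have hE := Real.exp_pos (-σ * Real.log n)
  have c2 : Real.cos (2 * t * Real.log n) = 2 * Real.cos (t * Real.log n) ^ 2 - 1 := by
    rw [mul_assoc, Real.cos_two_mul]
  rw [c2, zero_mul, Real.cos_zero]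
  have : 0 ≤ (ArithmeticFunction.vonMangoldt n * Real.exp (-σ * Real.log n)) *
     (2 * (1 + Real.cos (t * Real.log n))^2) := by positivity
  nlinarith [this]

lemma vM_real_le (σ : ℝ) (hσ : 1 < σ) :
    (vM σ).re ≤ 1 / (σ - 1) + 1/2 * Real.log (σ / 2 + 1) - Real.log Real.pi / 2 := by
  have h := vM_formula σ (by simpa using hσ)
  have h2 := xi_re_nonneg σ (by simpa using hσ)
  have e : (σ:ℂ) / 2 + 1 = ((σ / 2 + 1 : ℝ) : ℂ) := by push_cast; ring
  have e3 : 1 / ((σ:ℂ) - 1) = ((1 / (σ - 1) : ℝ) : ℂ) := by push_cast; ring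
  have e4 : (1/2 : ℂ) * (rdig (σ/2+1) : ℂ) = ((1/2 * rdig (σ/2+1) : ℝ) : ℂ) := by push_cast; ring
  rw [e, rdig_eq _ (by linarith), e3, e4] at h
  have h3 := congrArg Complex.re h
  rw [sub_re, sub_re, add_re, ofReal_re, ofReal_re, ofReal_re] at h3
  have h4 := rdig_le_log (σ/2+1) (by linarith)
  linarith

lemma vM_complex_le (σ t : ℝ) (hσ : 1 < σ) (ht : t ≠ 0) :
    (vM (σ + t * I)).re ≤ (σ - 1) / t^2 + 1/4 * Real.log (((σ + 2)^2 + t^2) / 4)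
      + 1 / (σ + 1 + |t|) - Real.log Real.pi / 2 - (logDeriv xiX (σ + t * I)).re := by
  have h := congrArg Complex.re (vM_formula (σ + t * I) (by simpa using hσ))
  rw [sub_re, sub_re, add_re, ofReal_re] at h
  have e1 : (1 / ((σ:ℂ) + t * I - 1)).re ≤ (σ - 1) / t^2 := by
    rw [inv_re_eq]
    simp
    apply div_le_div_of_nonneg_left (by linarith) (by positivity)
    nlinarith [sq_nonneg (σ - 1)]
  set z : ℂ := ((σ:ℂ) + t * I) / 2 + 1 with hz
  have zre : z.re = σ / 2 + 1 := by simp [hz]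
  have zim : z.im = t / 2 := by simp [hz]
  have h2 := dig_re_le z (by rw [zre]; linarith)
  have e2 : Real.log ‖z‖ = 1/2 * Real.log (((σ + 2)^2 + t^2) / 4) := by
    have : ((σ + 2)^2 + t^2) / 4 = ‖z‖^2 := by
      rw [norm_sq_rect, zre, zim]; ring
    rw [this, Real.log_pow]; push_cast; ring
  have e3 : z.re + |z.im| - 1/2 = (σ + 1 + |t|) / 2 := by
    rw [zre, zim, abs_div]; norm_num; ring
  rw [e2, e3] at h2
  have e4 : (1/2 * digamma z).re = 1/2 * (digamma z).re := by
    have : (1/2 : ℂ) = ((1/2 : ℝ) : ℂ) := by push_cast; ring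
    rw [this, re_ofReal_mul]
  have e5 : 1 / ((σ + 1 + |t|) / 2) = 2 * (1 / (σ + 1 + |t|)) := by
    have := abs_nonneg t
    field_simp
  rw [e4] at h
  rw [e5] at h2
  linarith

set_option maxHeartbeats 1000000 in
lemma zero_free_core (ρ : ℂ) (h1 : 1/2 ≤ ρ.re) (h2 : ρ.re < 1) (h3 : xiX ρ = 0) (h4 : 84.5 ≤ ρ.im^2) :
    2 / (35 * Real.log (1 + ρ.im^2 / 36)) ≤ 1 - ρ.re := by
  set t := ρ.im with ht
  have ht0 : t ≠ 0 := by rintro h; rw [h] at h4; norm_num at h4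
  have habs : 9.19 ≤ |t| := by
    apply abs_le_of_sq_le_sq' _ _ |>.2 <;> [skip; positivity]
    rw [sq_abs]; norm_num at h4 ⊢; linarith
  set G := 1 + t^2/36 with hG
  have hG1 : 3.347 ≤ G := by rw [hG]; norm_num at h4 ⊢; linarith
  have hlG : 1.2 ≤ Real.log G := by
    have a1 := log3_bd.1
    have : Real.log 3.347 = Real.log 3 + Real.log (1 + 0.347/3) := by
      rw [← Real.log_mul (by norm_num) (by norm_num)]; norm_num
    have a2 := log_lo (0.347/3) (by norm_num)
    have a3 := Real.log_le_log (by norm_num) hG1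
    rw [this] at a3
    norm_num at a1 a2 a3 ⊢
    linarith
  set ℓ := Real.log G with hℓ
  set d := 2 / (5 * ℓ) with hd
  have hd0 : 0 < d := by positivity
  have hd1 : d ≤ 1/3 := by rw [hd, div_le_iff₀ (by positivity)]; linarith
  have k1 := three_four_one (1 + d) t (by linarith)
  have k2 := vM_real_le (1 + d) (by linarith)
  have k3 := vM_complex_le (1 + d) t (by linarith) ht0
  have k4 := vM_complex_le (1 + d) (2 * t) (by linarith) (by simpa using ht0)
  have k5 := xi_re_ge (((1 + d : ℝ) : ℂ) + t * I) ρ (by simp; linarith) h1 h2 h3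
  have k6 := xi_re_nonneg (((1 + d : ℝ) : ℂ) + (2 * t : ℝ) * I) (by simp; linarith)
  have e1 : ((1 + d : ℝ) : ℂ) + t * I - ρ = ((1 + d - ρ.re : ℝ) : ℂ) := by
    apply Complex.ext <;> simp [ht]
  have e2 : 1 / (((1 + d - ρ.re : ℝ) : ℂ)) = ((1 / (1 + d - ρ.re) : ℝ) : ℂ) := by push_cast; ring
  rw [e1, e2, ofReal_re] at k5
  have b1 : (1 + d - 1) / t^2 ≤ 0.004 := by
    rw [div_le_iff₀ (by positivity)]; norm_num at h4 ⊢; linarith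
  have b2 : (1 + d - 1) / (2*t)^2 ≤ 0.001 := by
    rw [div_le_iff₀ (by positivity)]; norm_num at h4 ⊢; nlinarith
  have b3 : 1 / (1 + d + 1 + |t|) ≤ 0.0894 := by
    rw [div_le_iff₀ (by positivity)]; norm_num at habs ⊢; linarith
  have b4 : 1 / (1 + d + 1 + |2*t|) ≤ 0.0491 := by
    rw [abs_mul, abs_two, div_le_iff₀ (by positivity)]; norm_num at habs ⊢; linarith
  have l1 := Real.log_two_lt_d9
  have l1' := Real.log_two_gt_d9
  have l3 := log3_bd.2
  have b5 : Real.log ((1 + d + 2)^2 + t^2) ≤ 2 * Real.log 2 + 2 * Real.log 3 + ℓ := by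
    have : Real.log (2^2 * 3^2 * G) = 2 * Real.log 2 + 2 * Real.log 3 + ℓ := by
      rw [Real.log_mul (by norm_num) (by positivity), Real.log_mul (by norm_num) (by norm_num),
        Real.log_pow, Real.log_pow]; norm_num; rfl
    rw [← this]
    apply Real.log_le_log (by positivity)
    rw [hG]; nlinarith
  have b6 : Real.log ((1 + d + 2)^2 + (2*t)^2) ≤ 4 * Real.log 2 + 2 * Real.log 3 + ℓ := by
    have : Real.log (2^4 * 3^2 * G) = 4 * Real.log 2 + 2 * Real.log 3 + ℓ := by
      rw [Real.log_mul (by norm_num) (by positivity), Real.log_mul (by norm_num) (by norm_num),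
        Real.log_pow, Real.log_pow]; norm_num; rfl
    rw [← this]
    apply Real.log_le_log (by positivity)
    rw [hG]; nlinarith
  have b7 : Real.log ((1 + d) / 2 + 1) ≤ Real.log 2 := by
    apply Real.log_le_log (by positivity); linarith
  have lp := logpi_bd.1
  have e4 : Real.log 4 = 2 * Real.log 2 := by
    rw [show (4:ℝ) = 2^2 by norm_num, Real.log_pow]; norm_num
  rw [Real.log_div (by positivity) (by norm_num), e4] at k3 k4
  have e5 : 1 / (1 + d - 1) = 5 * ℓ / 2 := by rw [hd]; field_simp; ring
  rw [e5] at k2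
  have main : 4 * (1 / (1 + d - ρ.re)) ≤ 35/4 * ℓ := by
    norm_num at b1 b2 b3 b4 lp l3 l1 k1 k2 k3 k4 k5 k6 b5 b6 b7 ⊢
    linarith
  have hpos : 0 < 1 + d - ρ.re := by linarith
  rw [← mul_div_assoc, div_le_iff₀ hpos] at main
  have e6 : ℓ * d = 2/5 := by rw [hd]; field_simp
  rw [div_le_iff₀ (by positivity)]
  linarith

end PartNoI

section PartNoJ

open Complex Filter Topology Metric Set MeasureTheory

noncomputable def zrho (l : ℂ) : ℂ := if h : xiG (-l) = 0 then (xiG_zero_data l h).choose else 1/2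

lemma zrho_spec (l : ℂ) (h : xiG (-l) = 0) :
    1/2 ≤ (zrho l).re ∧ (zrho l).re < 1 ∧ xiX (zrho l) = 0 ∧ l = zrho l * (1 - zrho l) := by
  rw [zrho, dif_pos h]
  exact (xiG_zero_data l h).choose_spec

lemma zrho_re (l : ℂ) : 1/2 ≤ (zrho l).re ∧ (zrho l).re < 1 := by
  by_cases h : xiG (-l) = 0
  · exact ⟨(zrho_spec l h).1, (zrho_spec l h).2.1⟩
  · rw [zrho, dif_neg h]; norm_num

lemma zero_free (l : ℂ) (h : xiG (-l) = 0) :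
    1 / (1 - (zrho l).re) ≤ 35 * (1/2 * Real.log (1 + l.re / 36)) := by
  obtain ⟨h1, h2, h3, h4⟩ := zrho_spec l h
  set ρ := zrho l with hρ
  have e1 : l.re = ρ.re * (1 - ρ.re) + ρ.im ^ 2 := by rw [h4]; simp; ring
  have e2 : l.im = ρ.im * (1 - 2 * ρ.re) := by rw [h4]; simp; ring
  have ha := zero_a l h
  rcases eq_or_lt_of_le h1 with he | hlt
  · rw [← he]
    have : Real.log 2 ≤ Real.log (1 + l.re / 36) := Real.log_le_log (by norm_num) (by linarith)
    have := Real.log_two_gt_d9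
    norm_num at this ⊢; linarith
  · have him : l.im ≠ 0 := by
      rw [e2]
      apply mul_ne_zero
      · rintro h0; rw [h0] at e1; nlinarith
      · linarith
    have ha' := zero_a' l h him
    have hg : 84.5 ≤ ρ.im ^ 2 := by norm_num at ha' ⊢; nlinarith [sq_nonneg (ρ.re - 1/2)]
    have hc := zero_free_core ρ h1 h2 h3 hg
    have hle : Real.log (1 + ρ.im^2/36) ≤ Real.log (1 + l.re/36) := by
      apply Real.log_le_log (by positivity)
      have : 0 ≤ ρ.re * (1 - ρ.re) := mul_nonneg (by linarith) (by linarith)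
      linarith
    have hpos : 0 < Real.log (1 + ρ.im^2/36) := by
      apply Real.log_pos; norm_num at hg; linarith
    rw [div_le_iff₀ (by positivity)] at hc
    rw [div_le_iff₀ (by linarith)]
    have : (1 - ρ.re) * Real.log (1 + ρ.im^2/36) ≤ (1 - ρ.re) * Real.log (1 + l.re/36) :=
      mul_le_mul_of_nonneg_left hle (by linarith)
    linarith

/-- weights -/
noncomputable def zw (l : ℂ) : ℝ := mm l / l.re

lemma zw_nonneg (l : ℂ) : 0 ≤ zw l := by
  by_cases hm : mm l = 0
  · simp [zw, hm]
  · exact div_nonneg (mm_nonneg l) (by linarith [zero_a l (xiG_of_mm l hm)])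

lemma zw_le (l : ℂ) : zw l ≤ 42/41 * (mm l * (1/l).re) := by
  by_cases hm : mm l = 0
  · simp [zw, hm]
  have h := xiG_of_mm l hm
  have ha := zero_a l h
  obtain ⟨h1, h2⟩ := zero_rect l h
  have h3 := inv_re_ge l h1 h2
  have h4 : 1 / l.re ≤ 42/41 * (1 / (l.re + 1)) := by
    rw [mul_one_div, div_le_div_iff₀ (by linarith) (by linarith)]; linarith
  have h5 : 1 / l.re ≤ 42/41 * (1/l).re := by linarith
  have := mul_le_mul_of_nonneg_left h5 (mm_nonneg l)
  rw [zw]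
  calc _ = mm l * (1 / l.re) := by ring
    _ ≤ _ := this
    _ = _ := by ring

lemma zw_summable : Summable zw :=
  Summable.of_nonneg_of_le zw_nonneg zw_le (zeros_summable_re.mul_left _)

lemma zw_tsum : ∑' l, zw l ≤ 0.0239 := by
  have h1 := zw_summable.tsum_le_tsum zw_le (zeros_summable_re.mul_left _)
  rw [tsum_mul_left, zeros_hasSum_re.tsum_eq] at h1
  have := xiLog0_re
  norm_num at this ⊢
  linarith

noncomputable def sB (σ : ℝ) : ℝ := (1 / (σ - 1) + 1/2 * Real.log (σ / 2 + 1) - Real.log Real.pi / 2) / (2 * σ - 1)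

lemma vM_re_nonneg (σ : ℝ) (hσ : 1 < σ) : 0 ≤ (vM σ).re := by
  have h0 := Complex.hasSum_re (vM_hasSum ((σ:ℂ) + (0:ℝ) * I) (by simpa using hσ))
  have e : (σ:ℂ) + (0:ℝ) * I = σ := by simp
  rw [e] at h0
  refine h0.nonneg fun n => ?_
  rcases eq_or_ne n 0 with rfl | hn
  · simp
  have e0 := ncpow_re n σ 0 hn
  rw [e] at e0
  have hΛ := ArithmeticFunction.vonMangoldt_nonneg (n := n)
  rw [re_ofReal_mul, e0, zero_mul, Real.cos_zero]
  positivity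

lemma xi_real_le (σ : ℝ) (hσ : 1 < σ) :
    (logDeriv xiX σ).re ≤ 1 / (σ - 1) + 1/2 * Real.log (σ / 2 + 1) - Real.log Real.pi / 2 := by
  have h := vM_formula σ (by simpa using hσ)
  have h2 := vM_re_nonneg σ hσ
  have e : (σ:ℂ) / 2 + 1 = ((σ / 2 + 1 : ℝ) : ℂ) := by push_cast; ring
  have e3 : 1 / ((σ:ℂ) - 1) = ((1 / (σ - 1) : ℝ) : ℂ) := by push_cast; ring
  have e4 : (1/2 : ℂ) * (rdig (σ/2+1) : ℂ) = ((1/2 * rdig (σ/2+1) : ℝ) : ℂ) := by push_cast; ring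
  rw [e, rdig_eq _ (by linarith), e3, e4] at h
  have h3 := congrArg Complex.re h
  rw [sub_re, sub_re, add_re, ofReal_re, ofReal_re, ofReal_re] at h3
  have h4 := rdig_le_log (σ/2+1) (by linarith)
  linarith

lemma zsum_finite_sigma (σ : ℝ) (hσ : 1 < σ) (F : Finset ℂ) :
    ∑ l ∈ F, mm l / (σ^2 + l.re) ≤ sB σ := by
  have hp : 0 < 2 * σ - 1 := by linarith
  rw [sB, le_div_iff₀ hp]
  refine le_trans ?_ (xi_real_le σ hσ)
  have h := sum_le_hasSum F (fun l _ => xi_term_nonneg σ l (by simpa using hσ))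
    (Complex.hasSum_re (xi_hasSum σ (by simpa using hσ)))
  refine le_trans ?_ h
  rw [Finset.sum_mul]
  refine Finset.sum_le_sum fun l _ => ?_
  by_cases hm : mm l = 0
  · simp [hm]
  obtain ⟨h1, h2⟩ := zero_rect l (xiG_of_mm l hm)
  have e : ((mm l : ℂ) * ((2 * (σ:ℂ) - 1) / (σ * (σ - 1) + l))).re =
      mm l * (2 * σ - 1) * (1 / ((σ:ℂ) * (σ - 1) + l)).re := by
    have : (mm l : ℂ) * ((2 * (σ:ℂ) - 1) / (σ * (σ - 1) + l)) =
      ((mm l * (2 * σ - 1) : ℝ) : ℂ) * (1 / ((σ:ℂ) * (σ - 1) + l)) := by push_cast; ring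
    rw [this, re_ofReal_mul]
  rw [e]
  have h3 : 1 / (σ^2 + l.re) ≤ (1 / ((σ:ℂ) * (σ - 1) + l)).re := by
    rw [inv_re_eq]
    have e1 : ((σ:ℂ) * (σ - 1) + l).re = σ * (σ - 1) + l.re := by simp
    have e2 : ((σ:ℂ) * (σ - 1) + l).im = l.im := by simp
    rw [e1, e2]
    have hq : 0 < σ * (σ - 1) := by nlinarith
    rw [div_le_div_iff₀ (by positivity) (by positivity)]
    nlinarith
  calc mm l / (σ^2 + l.re) * (2 * σ - 1) = mm l * (2 * σ - 1) * (1 / (σ^2 + l.re)) := by ring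
    _ ≤ _ := mul_le_mul_of_nonneg_left h3 (mul_nonneg (mm_nonneg l) hp.le)

lemma log_bracket (a σ : ℝ) (ha : 0 < a) (hσ : 0 < σ) :
    1/2 * Real.log (1 + a / σ^2) - 1/2 * Real.log (1 + a / (2 * σ)^2) ≤ Real.log 2 * (a / (σ^2 + a)) := by
  set r := a / (σ^2 + a) with hr
  have hr0 : 0 ≤ r := by positivity
  have hr1 : r ≤ 1 := by rw [hr, div_le_one (by positivity)]; nlinarith
  have hc := strictConcaveOn_log_Ioi.concaveOn.2 (show (4:ℝ) ∈ Ioi (0:ℝ) by norm_num) (show (1:ℝ) ∈ Ioi (0:ℝ) by norm_num)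
    (show 0 ≤ 1 - r by linarith) hr0 (by ring)
  simp only [smul_eq_mul, Real.log_one, mul_zero, add_zero] at hc
  have e4 : Real.log 4 = 2 * Real.log 2 := by
    rw [show (4:ℝ) = 2^2 by norm_num, Real.log_pow]; norm_num
  have e : (1 + a / σ^2) = (4 / ((1 - r) * 4 + r * 1)) * (1 + a / (2 * σ)^2) := by
    have : (1 - r) * 4 + r * 1 = (4 * σ^2 + a) / (σ^2 + a) := by rw [hr]; field_simp; ring
    rw [this]
    field_simp
    ring
  rw [e, Real.log_mul (by have : 0 < (1 - r) * 4 + r * 1 := by linarith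
                          positivity) (by positivity), 
    Real.log_div (by norm_num) (by linarith), e4]
  rw [e4] at hc
  linarith

lemma zsum_finite (F : Finset ℂ) (J : ℕ) :
    ∑ l ∈ F, zw l * (1/2 * Real.log (1 + l.re / 36)) - ∑ l ∈ F, zw l * (1/2 * Real.log (1 + l.re / (6 * 2^J)^2))
    ≤ Real.log 2 * ∑ j ∈ Finset.range J, sB (6 * 2^j) := by
  induction J with
  | zero => norm_num
  | succ J ih =>
    rw [Finset.sum_range_succ, mul_add]
    have hσ : (1:ℝ) < 6 * 2^J := by
      have : (1:ℝ) ≤ 2^J := one_le_pow₀ (by norm_num)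
      linarith
    have h1 := mul_le_mul_of_nonneg_left (zsum_finite_sigma _ hσ F) (Real.log_nonneg one_le_two)
    have h2 : ∑ l ∈ F, zw l * (1/2 * Real.log (1 + l.re / (6 * 2^J)^2)) -
        ∑ l ∈ F, zw l * (1/2 * Real.log (1 + l.re / (6 * 2^(J+1))^2)) ≤
        Real.log 2 * ∑ l ∈ F, mm l / ((6 * 2^J)^2 + l.re) := by
      rw [← Finset.sum_sub_distrib, Finset.mul_sum]
      refine Finset.sum_le_sum fun l _ => ?_
      by_cases hm : mm l = 0
      · simp [zw, hm]
      have ha : 0 < l.re := (zero_rect l (xiG_of_mm l hm)).1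
      have h3 := mul_le_mul_of_nonneg_left (log_bracket l.re (6 * 2^J) ha (by positivity)) (zw_nonneg l)
      have e : (2 * (6 * 2^J) : ℝ) = 6 * 2^(J+1) := by ring
      rw [e] at h3
      have e2 : zw l * (Real.log 2 * (l.re / ((6 * 2^J)^2 + l.re))) = Real.log 2 * (mm l / ((6 * 2^J)^2 + l.re)) := by
        rw [zw]; field_simp
      rw [e2] at h3
      linarith
    linarith

lemma sB_sum (J : ℕ) : ∑ j ∈ Finset.range (J+4), sB (6 * 2^j) ≤ 0.0961 - (0.34658 * ((J + 4:ℕ) + 1) + 0.0106) * 2 / (11.9 * 2^(J+4)) := by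
  have l1 := Real.log_two_lt_d9
  have l1' := Real.log_two_gt_d9
  have lp := logpi_bd.1
  have l3 := log3_bd.2
  induction J with
  | zero =>
    have l7 : Real.log 7 ≤ 1.9462 := by
      have h := log_lo (1/7) (by norm_num)
      have e : Real.log (1 + 1/7) = 3 * Real.log 2 - Real.log 7 := by
        rw [show (1 + 1/7 : ℝ) = 2^3/7 by norm_num, Real.log_div (by norm_num) (by norm_num), Real.log_pow]; norm_num
      rw [e] at h; norm_num at h l1 ⊢; linarith
    have l13 : Real.log 13 ≤ 2.5651 := by
      have h := log_up (1/12) (by norm_num)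
      have e : Real.log (1 + 1/12) = Real.log 13 - (2 * Real.log 2 + Real.log 3) := by
        rw [show (1 + 1/12 : ℝ) = 13/(2^2*3) by norm_num, Real.log_div (by norm_num) (by norm_num),
          Real.log_mul (by norm_num) (by norm_num), Real.log_pow]; norm_num
      rw [e] at h; norm_num at h l1 l3 ⊢; linarith
    have l25 : Real.log 25 ≤ 3.219 := by
      have h := log_up (1/24) (by norm_num)
      have e : Real.log (1 + 1/24) = Real.log 25 - (3 * Real.log 2 + Real.log 3) := by
        rw [show (1 + 1/24 : ℝ) = 25/(2^3*3) by norm_num, Real.log_div (by norm_num) (by norm_num),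
          Real.log_mul (by norm_num) (by norm_num), Real.log_pow]; norm_num
      rw [e] at h; norm_num at h l1 l3 ⊢; linarith
    have l4 : Real.log 4 = 2 * Real.log 2 := by
      rw [show (4:ℝ) = 2^2 by norm_num, Real.log_pow]; norm_num
    simp only [Finset.sum_range_succ, Finset.sum_range_zero, sB]
    norm_num [l4]
    norm_num at l1 l1' lp l3 l7 l13 l25
    linarith
  | succ J ih =>
    rw [show J + 1 + 4 = (J + 4) + 1 by ring, Finset.sum_range_succ]
    set j := J + 4 with hj
    have hj4 : 4 ≤ j := by omega
    have h16 : (16:ℝ) ≤ 2^j := by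
      calc (16:ℝ) = 2^4 := by norm_num
        _ ≤ 2^j := pow_le_pow_right₀ (by norm_num) hj4
    have h1 : sB (6 * 2^j) ≤ (0.34658 * j + 0.0106) / (11.9 * 2^j) := by
      rw [sB]
      have hlog : Real.log (6 * 2^j / 2 + 1) ≤ Real.log Real.pi + j * Real.log 2 := by
        rw [← Real.log_pow, ← Real.log_mul Real.pi_ne_zero (by positivity)]
        apply Real.log_le_log (by positivity)
        have := Real.pi_gt_d2
        norm_num at this
        nlinarith
      have hinv : 1 / (6 * 2^j - 1) ≤ (0.0106 : ℝ) := by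
        rw [div_le_iff₀ (by linarith)]; norm_num; linarith
      apply div_le_div₀
      · positivity
      · have : (j:ℝ) * Real.log 2 ≤ j * 0.6931471808 := mul_le_mul_of_nonneg_left l1.le (by positivity)
        have hjn : (0:ℝ) ≤ j := by positivity
        norm_num at this hinv ⊢; linarith
      · positivity
      · norm_num; linarith
    have e : (0.34658 * ((j:ℕ) + 1) + 0.0106) * 2 / (11.9 * 2^j) - (0.34658 * (((j + 1 : ℕ):ℝ) + 1) + 0.0106) * 2 / (11.9 * 2^(j+1))
      = (0.34658 * j + 0.0106) / (11.9 * (2:ℝ)^j) := by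
      push_cast; field_simp; ring
    linarith

lemma S1_finite (F : Finset ℂ) : ∑ l ∈ F, zw l * (1/2 * Real.log (1 + l.re / 36)) ≤ 0.0667 := by
  have ht : Tendsto (fun J : ℕ => ∑ l ∈ F, zw l * (1/2 * Real.log (1 + l.re / 36)) -
      ∑ l ∈ F, zw l * (1/2 * Real.log (1 + l.re / (6 * 2^J)^2))) atTop
      (𝓝 (∑ l ∈ F, zw l * (1/2 * Real.log (1 + l.re / 36)) - ∑ l ∈ F, zw l * (1/2 * Real.log (1 + 0)))) := by
    refine tendsto_const_nhds.sub (tendsto_finsetSum _ fun l _ => ?_)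
    refine Tendsto.const_mul _ (Tendsto.const_mul _ ?_)
    have : Tendsto (fun J : ℕ => l.re / (6 * 2^J)^2) atTop (𝓝 0) := by
      apply Tendsto.const_div_atTop
      have h := (tendsto_pow_atTop_atTop_of_one_lt (r := (2:ℝ)) (by norm_num)).const_mul_atTop (show (0:ℝ) < 6 by norm_num)
      exact (tendsto_pow_atTop (two_ne_zero)).comp h
    exact (Real.continuousAt_log (by norm_num)).tendsto.comp (this.const_add 1)
  simp only [add_zero, Real.log_one, mul_zero, Finset.sum_const_zero, sub_zero] at ht
  refine le_of_tendsto ht ?_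
  filter_upwards [eventually_ge_atTop 4] with J hJ
  obtain ⟨K, rfl⟩ := Nat.exists_eq_add_of_le' hJ
  have h1 := zsum_finite F (K + 4)
  have h2 := sB_sum K
  have h3 : (0:ℝ) ≤ (0.34658 * ((K + 4:ℕ) + 1) + 0.0106) * 2 / (11.9 * 2^(K+4)) := by positivity
  have h4 : ∑ j ∈ Finset.range (K+4), sB (6 * 2^j) ≤ 0.0961 := by linarith
  have h5 := mul_le_mul_of_nonneg_left h4 (Real.log_nonneg one_le_two)
  have l1 := Real.log_two_lt_d9
  norm_num at h5 l1 ⊢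
  linarith

lemma S1_nonneg (l : ℂ) : 0 ≤ zw l * (1/2 * Real.log (1 + l.re / 36)) := by
  by_cases hm : mm l = 0
  · simp [zw, hm]
  have ha := zero_a l (xiG_of_mm l hm)
  have := zw_nonneg l
  have h2 : 0 ≤ Real.log (1 + l.re / 36) := Real.log_nonneg (by linarith)
  positivity

lemma S1_summable : Summable (fun l : ℂ => zw l * (1/2 * Real.log (1 + l.re / 36))) :=
  summable_of_sum_le S1_nonneg S1_finite

lemma S1_tsum : ∑' l : ℂ, zw l * (1/2 * Real.log (1 + l.re / 36)) ≤ 0.0667 :=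
  S1_summable.tsum_le_of_sum_le S1_finite

end PartNoJ

section PartNoK

open Complex Filter Topology Metric Set MeasureTheory

noncomputable def zt (l : ℂ) (u : ℝ) : ℂ :=
  (mm l : ℂ) / l * (cexp ((zrho l - 1) * u) + cexp (-(zrho l) * u))

noncomputable def ZZ (u : ℝ) : ℂ := ∑' l, zt l u

lemma zcoef_norm (l : ℂ) : ‖(mm l : ℂ) / l‖ ≤ zw l := by
  by_cases hm : mm l = 0
  · simp [zw, hm]
  have ha := zero_a l (xiG_of_mm l hm)
  rw [norm_div, norm_real, Real.norm_of_nonneg (mm_nonneg l), zw]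
  apply div_le_div_of_nonneg_left (mm_nonneg l) (by linarith) (Complex.re_le_norm l)

lemma zt_norm (l : ℂ) (u : ℝ) : ‖zt l u‖ ≤ zw l *
    (Real.exp (-(1 - (zrho l).re) * u) + Real.exp (-(zrho l).re * u)) := by
  rw [zt, norm_mul]
  apply mul_le_mul (zcoef_norm l) _ (norm_nonneg _) (zw_nonneg l)
  refine (norm_add_le _ _).trans (le_of_eq ?_)
  rw [norm_exp, norm_exp]
  congr 2 <;> simp

lemma zt_norm1 (l : ℂ) (u : ℝ) (hu : 0 ≤ u) : ‖zt l u‖ ≤ zw l * (1 + Real.exp (-u)) := by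
  refine (zt_norm l u).trans (mul_le_mul_of_nonneg_left ?_ (zw_nonneg l))
  obtain ⟨h1, h2⟩ := zrho_re l
  set b := (zrho l).re
  have e1 : Real.exp (-(1 - b) * u) ≤ 1 := Real.exp_le_one_iff.mpr (by nlinarith)
  have e2 : Real.exp (-b * u) ≤ 1 := Real.exp_le_one_iff.mpr (by nlinarith)
  have e3 : Real.exp (-u) = Real.exp (-(1 - b) * u) * Real.exp (-b * u) := by
    rw [← Real.exp_add]; congr 1; ring
  rw [e3]; nlinarith

lemma zt_norm_two (l : ℂ) (u : ℝ) (hu : 0 ≤ u) : ‖zt l u‖ ≤ zw l * 2 := by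
  refine (zt_norm1 l u hu).trans (mul_le_mul_of_nonneg_left ?_ (zw_nonneg l))
  have : Real.exp (-u) ≤ 1 := Real.exp_le_one_iff.mpr (by linarith)
  linarith

lemma zt_summable (u : ℝ) (hu : 0 ≤ u) : Summable (fun l => zt l u) :=
  Summable.of_norm_bounded (zw_summable.mul_right 2) fun l => zt_norm_two l u hu

lemma ZZ_bound1 (u : ℝ) (hu : 0 ≤ u) : ‖ZZ u‖ ≤ 0.0239 * (1 + Real.exp (-u)) := by
  have h := tsum_of_norm_bounded (zw_summable.hasSum.mul_right (1 + Real.exp (-u))) fun l => zt_norm1 l u hu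
  exact h.trans (mul_le_mul_of_nonneg_right zw_tsum (by positivity))

lemma x_exp_le (d u : ℝ) (hd : 0 < d) : u * Real.exp (-d * u) ≤ 1 / (d * Real.exp 1) := by
  rw [le_div_iff₀ (by positivity)]
  have h := Real.add_one_le_exp (d * u - 1)
  have e : Real.exp (d * u - 1) * (Real.exp (-d * u) * Real.exp 1) = 1 := by
    rw [← Real.exp_add, ← Real.exp_add]; simp
  have h2 := mul_le_mul_of_nonneg_right h (show 0 ≤ Real.exp (-d * u) * Real.exp 1 by positivity)
  rw [e] at h2
  linarith

lemma zt_norm2 (l : ℂ) (u : ℝ) (hu : 0 ≤ u) : ‖(u:ℂ) * zt l u‖ ≤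
    (35 * (zw l * (1/2 * Real.log (1 + l.re / 36))) + 2 * zw l) / Real.exp 1 := by
  by_cases hm : mm l = 0
  · simp [zw, zt, hm]
  have hz := zero_free l (xiG_of_mm l hm)
  obtain ⟨h1, h2⟩ := zrho_re l
  have h3 := mul_le_mul_of_nonneg_left (zt_norm l u) hu
  rw [norm_mul, norm_real, Real.norm_of_nonneg hu]
  refine h3.trans ?_
  set b := (zrho l).re
  have a1 := x_exp_le (1 - b) u (by linarith)
  have a2 := x_exp_le b u (by linarith)
  have he := Real.exp_pos 1
  rw [← div_div] at a1 a2
  have a3 : 1 / b ≤ 2 := by rw [div_le_iff₀ (by linarith)]; linarith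
  have a4 : u * (Real.exp (-(1 - b) * u) + Real.exp (-b * u)) ≤
     (35 * (1/2 * Real.log (1 + l.re / 36)) + 2) / Real.exp 1 := by
    rw [mul_add, add_div]
    exact add_le_add (a1.trans (div_le_div_of_nonneg_right hz he.le)) (a2.trans (div_le_div_of_nonneg_right a3 he.le))
  have a5 := mul_le_mul_of_nonneg_left a4 (zw_nonneg l)
  calc _ = zw l * (u * (Real.exp (-(1 - b) * u) + Real.exp (-b * u))) := by ring
    _ ≤ _ := a5
    _ = _ := by ring

lemma ZZ_bound2 (u : ℝ) (hu : 0 ≤ u) : u * ‖ZZ u‖ ≤ 0.877 := by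
  have hs := ((S1_summable.hasSum.mul_left 35).add (zw_summable.hasSum.mul_left 2)).div_const (Real.exp 1)
  have h := tsum_of_norm_bounded hs fun l => zt_norm2 l u hu
  rw [tsum_mul_left] at h
  change ‖(u:ℂ) * ZZ u‖ ≤ _ at h
  rw [norm_mul, norm_real, Real.norm_of_nonneg hu] at h
  refine h.trans ?_
  have h1 := S1_tsum
  have h2 := zw_tsum
  have he := Real.exp_one_gt_d9
  rw [div_le_iff₀ (by positivity)]
  norm_num at h1 h2 he ⊢
  linarith

lemma ZZ_cont : ContinuousOn ZZ (Ici 0) := by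
  apply continuousOn_tsum (u := fun l => zw l * 2)
  · intro l
    unfold zt
    fun_prop
  · exact zw_summable.mul_right 2
  · intro l u hu
    exact zt_norm_two l u hu

end PartNoK

section PartNoL

open Complex Filter Topology Metric Set MeasureTheory

lemma lap_int (g : ℝ → ℂ) (hc : ContinuousOn g (Ici 0)) (K : ℝ) (hb : ∀ u, 0 ≤ u → ‖g u‖ ≤ K * Real.exp (u/2))
    (s : ℂ) (hs : 1/2 < s.re) : IntegrableOn (fun u : ℝ => g u * cexp (-s * u)) (Ioi 0) ∧
    ∫ u in Ioi (0:ℝ), ‖g u * cexp (-s * u)‖ ≤ K * (1 / (s.re - 1/2)) := by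
  have hi := (integrableOn_exp_mul_Ioi (a := 1/2 - s.re) (by linarith) 0)
  have hbd : ∀ u ∈ Ioi (0:ℝ), ‖g u * cexp (-s * u)‖ ≤ K * Real.exp ((1/2 - s.re) * u) := by
    intro u hu
    rw [norm_mul, norm_exp]
    have e : (-s * u).re = - s.re * u := by simp
    rw [e]
    calc _ ≤ K * Real.exp (u/2) * Real.exp (-s.re * u) :=
          mul_le_mul_of_nonneg_right (hb u (le_of_lt hu)) (Real.exp_pos _).le
      _ = _ := by rw [mul_assoc, ← Real.exp_add]; congr 2; ring
  have h1 : IntegrableOn (fun u : ℝ => g u * cexp (-s * u)) (Ioi 0) := by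
    refine Integrable.mono' (hi.const_mul K) ?_ ?_
    · apply ContinuousOn.aestronglyMeasurable _ measurableSet_Ioi
      exact (hc.mono Ioi_subset_Ici_self).mul (by fun_prop)
    · exact (ae_restrict_iff' measurableSet_Ioi).mpr (Eventually.of_forall hbd)
  refine ⟨h1, ?_⟩
  have h2 := setIntegral_mono_on h1.norm (hi.const_mul K) measurableSet_Ioi hbd
  refine h2.trans (le_of_eq ?_)
  rw [integral_const_mul, integral_exp_mul_Ioi (by linarith)]
  congr 1
  have : s.re - 1/2 ≠ 0 := by linarith
  have h3 : 1/2 - s.re ≠ 0 := by linarith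
  rw [mul_zero, Real.exp_zero, ← neg_sub s.re (1/2 : ℝ), neg_div_neg_eq]

lemma lap_tsum_cont {ι : Type*} (F : ι → ℝ → ℂ) (hc : ∀ i, ContinuousOn (F i) (Ici 0))
    (b : ι → ℝ) (hb : ∀ i u, 0 ≤ u → ‖F i u‖ ≤ b i * Real.exp (u/2)) (hs : Summable b) :
    ContinuousOn (fun u => ∑' i, F i u) (Ici 0) := by
  have key : ∀ U : ℝ, ContinuousOn (fun u => ∑' i, F i u) (Ico 0 U) := by
    intro U
    apply continuousOn_tsum (u := fun i => b i * Real.exp (U/2))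
    · intro i; exact (hc i).mono Ico_subset_Ici_self
    · exact hs.mul_right _
    · intro i u hu
      have hb0 : 0 ≤ b i := by
        have := (norm_nonneg _).trans (hb i 0 le_rfl)
        simpa using this
      exact (hb i u hu.1).trans (mul_le_mul_of_nonneg_left (Real.exp_le_exp.mpr (by linarith [hu.2])) hb0)
  intro u hu
  have h := key (u + 1) u ⟨hu, by linarith⟩
  refine h.mono_of_mem_nhdsWithin ?_
  rw [mem_nhdsWithin]
  exact ⟨Iio (u+1), isOpen_Iio, by simp, fun x hx => ⟨hx.2, hx.1⟩⟩

lemma lap_tsum {ι : Type*} [Countable ι] (F : ι → ℝ → ℂ) (hc : ∀ i, ContinuousOn (F i) (Ici 0))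
    (b : ι → ℝ) (hb : ∀ i u, 0 ≤ u → ‖F i u‖ ≤ b i * Real.exp (u/2)) (hsum : Summable b)
    (s : ℂ) (hs : 1/2 < s.re) :
    HasSum (fun i => ∫ u in Ioi (0:ℝ), F i u * cexp (-s * u))
      (∫ u in Ioi (0:ℝ), (∑' i, F i u) * cexp (-s * u)) := by
  have h := hasSum_integral_of_summable_integral_norm (μ := volume.restrict (Ioi (0:ℝ)))
    (F := fun i (u:ℝ) => F i u * cexp (-s * u)) (fun i => (lap_int (F i) (hc i) (b i) (hb i) s hs).1)
    (Summable.of_nonneg_of_le (fun i => integral_nonneg fun u => norm_nonneg _)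
      (fun i => (lap_int (F i) (hc i) (b i) (hb i) s hs).2) (hsum.mul_right _))
  simpa only [tsum_mul_right] using h

lemma lap_exp (a s : ℂ) (h : a.re < s.re) :
    IntegrableOn (fun u : ℝ => cexp (a * u) * cexp (-s * u)) (Ioi 0) ∧
    ∫ u in Ioi (0:ℝ), cexp (a * u) * cexp (-s * u) = 1 / (s - a) := by
  have e : (fun u : ℝ => cexp (a * u) * cexp (-s * u)) = fun u : ℝ => cexp ((a - s) * u) := by
    ext u; rw [← Complex.exp_add]; congr 1; ring
  rw [e]
  refine ⟨integrableOn_exp_mul_complex_Ioi (by simpa using h) 0, ?_⟩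
  rw [integral_exp_mul_complex_Ioi (by simpa using h)]
  rw [ofReal_zero, mul_zero, Complex.exp_zero, ← neg_sub s a, neg_div_neg_eq]

lemma lap_id (s : ℂ) (h : 0 < s.re) :
    IntegrableOn (fun u : ℝ => (u:ℂ) * cexp (-s * u)) (Ioi 0) ∧
    ∫ u in Ioi (0:ℝ), (u:ℂ) * cexp (-s * u) = 1 / s^2 := by
  have hs0 : s ≠ 0 := by rintro rfl; simp at h
  have hIntg : IntegrableOn (fun u : ℝ => (u:ℂ) * cexp (-s * u)) (Ioi 0) := by
    have h1 := (integrableOn_exp_mul_Ioi (a := - s.re / 2) (by linarith) 0).const_mul (2 / s.re)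
    refine Integrable.mono' h1 (by fun_prop) ?_
    refine (ae_restrict_iff' measurableSet_Ioi).mpr (Eventually.of_forall fun u hu => ?_)
    have hu' : (0:ℝ) < u := hu
    rw [norm_mul, norm_exp, norm_real, Real.norm_of_nonneg hu'.le]
    have e : (-s * u).re = (- s.re / 2 * u) + (- s.re / 2 * u) := by simp; ring
    rw [e, Real.exp_add, ← mul_assoc]
    apply mul_le_mul_of_nonneg_right _ (Real.exp_pos _).le
    have h2 := Real.add_one_le_exp (s.re / 2 * u)
    have e2 : Real.exp (s.re / 2 * u) * Real.exp (-s.re / 2 * u) = 1 := by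
      rw [← Real.exp_add]; ring_nf; simp
    rw [le_div_iff₀ h]
    have h3 := mul_le_mul_of_nonneg_right h2 (Real.exp_pos (-s.re / 2 * u)).le
    rw [e2] at h3
    have := Real.exp_pos (-s.re / 2 * u)
    nlinarith
  refine ⟨hIntg, ?_⟩
  have hd : ∀ x ∈ Ici (0:ℝ), HasDerivAt (fun u : ℝ => -((u:ℂ) / s + 1 / s^2) * cexp (-s * u))
      ((x:ℂ) * cexp (-s * x)) x := by
    intro x _
    have h1 : HasDerivAt (fun u : ℝ => (u:ℂ)) 1 x := by simpa using (hasDerivAt_id' x).ofReal_comp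
    have h2 : HasDerivAt (fun u : ℝ => cexp (-s * u)) (cexp (-s * x) * (-s * 1)) x := (h1.const_mul (-s)).cexp
    have h3 := (((h1.div_const s).add_const (1/s^2)).neg).fun_mul h2
    refine h3.congr_deriv ?_
    simp only [Pi.neg_apply]
    field_simp
    ring
  have ht : Tendsto (fun u : ℝ => -((u:ℂ) / s + 1 / s^2) * cexp (-s * u)) atTop (𝓝 0) := by
    have h1 : Tendsto (fun u : ℝ => Real.exp (-s.re * u)) atTop (𝓝 0) := by
      have : Tendsto (fun u : ℝ => s.re * u) atTop atTop := tendsto_id.const_mul_atTop h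
      refine (Real.tendsto_exp_neg_atTop_nhds_zero.comp this).congr fun u => ?_
      simp
    have h2 : Tendsto (fun u : ℝ => u * Real.exp (-s.re * u)) atTop (𝓝 0) := by
      have := tendsto_rpow_mul_exp_neg_mul_atTop_nhds_zero 1 s.re h
      simpa using this
    have h3 := (h2.mul_const (1/‖s‖)).add (h1.mul_const (1/‖s‖^2))
    simp only [zero_mul, add_zero] at h3
    refine squeeze_zero_norm' ?_ h3
    filter_upwards [eventually_ge_atTop 0] with u hu
    rw [norm_mul, norm_neg, norm_exp]
    have e : (-s * u).re = - s.re * u := by simp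
    rw [e]
    have : ‖(u:ℂ) / s + 1 / s^2‖ ≤ u / ‖s‖ + 1 / ‖s‖^2 := by
      refine (norm_add_le _ _).trans (le_of_eq ?_)
      rw [norm_div, norm_div, norm_pow, norm_real, Real.norm_of_nonneg hu, norm_one]
    calc _ ≤ (u / ‖s‖ + 1 / ‖s‖^2) * Real.exp (-s.re * u) := mul_le_mul_of_nonneg_right this (Real.exp_pos _).le
      _ = _ := by ring
  have := integral_Ioi_of_hasDerivAt_of_tendsto' hd hIntg ht
  rw [this]; simp

lemma lap_unique (h : ℝ → ℂ) (hc : ContinuousOn h (Ici 0))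
    (hi : IntegrableOn (fun u : ℝ => h u * cexp (-1 * u)) (Ioi 0))
    (h0 : ∀ s : ℂ, s.re = 1 → ∫ u in Ioi (0:ℝ), h u * cexp (-s * u) = 0) (u : ℝ) (hu : 0 < u) : h u = 0 := by
  set f : ℝ → ℂ := (Ioi (0:ℝ)).indicator (fun u : ℝ => h u * cexp (-1 * u)) with hf
  have hfi : Integrable f := (integrable_indicator_iff measurableSet_Ioi).mpr hi
  have hF : FourierTransform.fourier f = 0 := by
    ext w
    rw [Real.fourier_real_eq_integral_exp_smul]
    have := h0 (1 + (2 * Real.pi * w : ℝ) * I) (by simp)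
    rw [Pi.zero_apply, ← this, ← integral_indicator measurableSet_Ioi]
    congr 1
    ext v
    by_cases hv : v ∈ Ioi (0:ℝ)
    · simp only [hf, indicator_of_mem hv, smul_eq_mul]
      rw [mul_left_comm, ← Complex.exp_add]
      congr 2
      push_cast; ring
    · simp only [hf, indicator_of_notMem hv, smul_zero]
  have hca : ContinuousAt f u := by
    have h1 : ContinuousAt (fun u : ℝ => h u * cexp (-1 * u)) u :=
      (hc.continuousAt (Ici_mem_nhds hu)).mul (by fun_prop)
    refine h1.congr ?_
    filter_upwards [Ioi_mem_nhds hu] with v hv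
    rw [hf, indicator_of_mem (show v ∈ Ioi 0 from hv)]
  have := hfi.fourierInv_fourier_eq (by rw [hF]; exact integrable_zero _ _ _) hca
  rw [hF, hf, indicator_of_mem (show u ∈ Ioi 0 from hu)] at this
  rw [Real.fourierInv_eq] at this
  simp at this
  exact this

end PartNoL

section PartNoM

open Complex Filter Topology Metric Set MeasureTheory

/-- term of the smoothed sum -/
noncomputable def at_ (n : ℕ) (u : ℝ) : ℝ := ArithmeticFunction.vonMangoldt n * max (1 / n - Real.exp (-u)) 0

noncomputable def AA (u : ℝ) : ℝ := ∑' n : ℕ, at_ n u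

lemma at_nonneg (n : ℕ) (u : ℝ) : 0 ≤ at_ n u :=
  mul_nonneg ArithmeticFunction.vonMangoldt_nonneg (le_max_right _ _)

lemma lam_summable : Summable (fun n : ℕ => ArithmeticFunction.vonMangoldt n * (n:ℝ) ^ (-(3/2) : ℝ)) := by
  have h := (vM_hasSum (3/2) (by norm_num)).summable.norm
  refine h.congr fun n => ?_
  rcases eq_or_ne n 0 with rfl | hn
  · simp
  rw [norm_mul, norm_real, Real.norm_of_nonneg ArithmeticFunction.vonMangoldt_nonneg,
    norm_natCast_cpow_of_pos (Nat.pos_of_ne_zero hn)]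
  norm_num

lemma at_le (n : ℕ) (u : ℝ) (hu : 0 ≤ u) : at_ n u ≤ ArithmeticFunction.vonMangoldt n * (n:ℝ) ^ (-(3/2) : ℝ) * Real.exp (u/2) := by
  rcases eq_or_ne n 0 with rfl | hn
  · simp [at_]
  have hn0 : (0:ℝ) < n := by exact_mod_cast Nat.pos_of_ne_zero hn
  rw [at_, mul_assoc]
  apply mul_le_mul_of_nonneg_left _ ArithmeticFunction.vonMangoldt_nonneg
  apply max_le _ (by positivity)
  by_cases hc : 1 / (n:ℝ) ≤ Real.exp (-u)
  · have : 0 ≤ (n:ℝ) ^ (-(3/2) : ℝ) * Real.exp (u/2) := by positivity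
    linarith
  · push Not at hc
    have h1 : (n:ℝ) ^ (1/2 : ℝ) ≤ Real.exp (u/2) := by
      have h2 : (n:ℝ) ≤ Real.exp u := by
        rw [Real.exp_neg, ← one_div] at hc
        exact (one_div_lt_one_div (Real.exp_pos u) hn0).mp hc |>.le
      have h3 := Real.rpow_le_rpow hn0.le h2 (show (0:ℝ) ≤ 1/2 by norm_num)
      rwa [← Real.exp_mul, mul_one_div] at h3
    have h4 : (n:ℝ) ^ (-(3/2) : ℝ) * (n:ℝ) ^ (1/2 : ℝ) = 1 / n := by
      rw [← Real.rpow_add hn0]; norm_num; rw [Real.rpow_neg_one]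
    have h5 := mul_le_mul_of_nonneg_left h1 (show 0 ≤ (n:ℝ) ^ (-(3/2) : ℝ) by positivity)
    rw [h4] at h5
    have := Real.exp_pos (-u)
    linarith

lemma at_cont (n : ℕ) : Continuous (at_ n) := by unfold at_; fun_prop

lemma at_norm (n : ℕ) (u : ℝ) (hu : 0 ≤ u) : ‖(at_ n u : ℂ)‖ ≤ ArithmeticFunction.vonMangoldt n * (n:ℝ) ^ (-(3/2) : ℝ) * Real.exp (u/2) := by
  rw [norm_real, Real.norm_of_nonneg (at_nonneg n u)]; exact at_le n u hu

lemma at_lap (n : ℕ) (s : ℂ) (hs : 1/2 < s.re) :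
    ∫ u in Ioi (0:ℝ), (at_ n u : ℂ) * cexp (-s * u) = (ArithmeticFunction.vonMangoldt n : ℂ) * (n:ℂ) ^ (-(s+1)) * (1 / (s * (s+1))) := by
  rcases eq_or_ne n 0 with rfl | hn
  · simp [at_]
  have hn0 : (0:ℝ) < n := by exact_mod_cast Nat.pos_of_ne_zero hn
  set c := Real.log n with hc
  have hc0 : 0 ≤ c := Real.log_natCast_nonneg n
  have hnc : Real.exp c = n := Real.exp_log hn0
  have hs0 : s ≠ 0 := by rintro rfl; simp at hs; linarith
  have hs1 : s + 1 ≠ 0 := by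
    intro h; have := congrArg Complex.re h; simp at this; linarith
  have e : ∀ u : ℝ, u ∈ Ioi (0:ℝ) → (at_ n u : ℂ) * cexp (-s * u) = (Ioi c).indicator (fun u : ℝ =>
      (ArithmeticFunction.vonMangoldt n : ℂ) * (((1 / n : ℝ) : ℂ) * cexp (-s * u) - cexp (-(s+1) * u))) u := by
    intro u hu
    by_cases h : u ∈ Ioi c
    · rw [indicator_of_mem h, at_, max_eq_left]
      · push_cast
        rw [mul_assoc]
        congr 1
        rw [sub_mul, ← Complex.exp_add]
        congr 2; ring
      · have h1 : Real.exp (-u) ≤ Real.exp (-c) := Real.exp_le_exp.mpr (by have : c < u := h; linarith)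
        rw [Real.exp_neg c, hnc] at h1
        rw [one_div]; linarith
    · rw [indicator_of_notMem h, at_, max_eq_right]
      · simp
      · have h1 : Real.exp (-c) ≤ Real.exp (-u) := Real.exp_le_exp.mpr (by simp at h; linarith)
        rw [Real.exp_neg c, hnc] at h1
        rw [one_div]; linarith
  rw [setIntegral_congr_fun measurableSet_Ioi e, setIntegral_indicator measurableSet_Ioi,
    inter_eq_self_of_subset_right (Ioi_subset_Ioi hc0), integral_const_mul, integral_sub, integral_const_mul,
    integral_exp_mul_complex_Ioi (by simp; linarith), integral_exp_mul_complex_Ioi (by simp; linarith)]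
  · have hncc : (n:ℂ) ≠ 0 := by exact_mod_cast hn
    have e1 : cexp (-s * c) = (n:ℂ) * (n:ℂ) ^ (-(s+1)) := by
      rw [neg_add, cpow_add _ _ hncc, cpow_neg_one, mul_left_comm, mul_inv_cancel₀ hncc, mul_one,
        cpow_def_of_ne_zero hncc, hc, Complex.natCast_log]
      congr 1; ring
    have e2 : cexp (-(s+1) * c) = (n:ℂ) ^ (-(s+1)) := by
      rw [cpow_def_of_ne_zero hncc, hc, Complex.natCast_log]
      congr 1; ring
    rw [e1, e2]
    push_cast
    field_simp
    ring
  · exact (integrableOn_exp_mul_complex_Ioi (by simp; linarith) c).const_mul _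
  · exact integrableOn_exp_mul_complex_Ioi (by simp; linarith) c

lemma AA_coe (u : ℝ) : (AA u : ℂ) = ∑' n : ℕ, (at_ n u : ℂ) := by
  rw [AA, Complex.ofReal_tsum]

lemma AA_cont : ContinuousOn (fun u => (AA u : ℂ)) (Ici 0) := by
  simp only [AA_coe]
  exact lap_tsum_cont (fun n u => (at_ n u : ℂ)) (fun n => (continuous_ofReal.comp (at_cont n)).continuousOn)
    _ at_norm lam_summable

lemma at_summable (u : ℝ) (hu : 0 ≤ u) : Summable (fun n => at_ n u) :=
  Summable.of_nonneg_of_le (fun n => at_nonneg n u) (fun n => at_le n u hu) (lam_summable.mul_right _)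

lemma AA_norm (u : ℝ) (hu : 0 ≤ u) : ‖(AA u : ℂ)‖ ≤ (∑' n : ℕ, ArithmeticFunction.vonMangoldt n * (n:ℝ) ^ (-(3/2) : ℝ)) * Real.exp (u/2) := by
  rw [AA_coe]
  exact tsum_of_norm_bounded (lam_summable.hasSum.mul_right _) fun n => at_norm n u hu

lemma AA_lap (s : ℂ) (hs : 1/2 < s.re) :
    ∫ u in Ioi (0:ℝ), (AA u : ℂ) * cexp (-s * u) = vM (s+1) * (1 / (s * (s+1))) := by
  have h := lap_tsum (fun n u => (at_ n u : ℂ)) (fun n => (continuous_ofReal.comp (at_cont n)).continuousOn)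
    _ at_norm lam_summable s hs
  simp only [at_lap _ s hs, ← AA_coe] at h
  exact h.unique ((vM_hasSum (s+1) (by simp; linarith)).mul_right _)

/-- zero sum -/
lemma zt_cont (l : ℂ) : Continuous (zt l) := by unfold zt; fun_prop

lemma zt_norm_exp (l : ℂ) (u : ℝ) (hu : 0 ≤ u) : ‖zt l u‖ ≤ zw l * 2 * Real.exp (u/2) := by
  refine (zt_norm_two l u hu).trans ?_
  have h1 : 1 ≤ Real.exp (u/2) := Real.one_le_exp (by linarith)
  have := zw_nonneg l
  nlinarith

lemma zt_lap (l s : ℂ) (hs : 1/2 < s.re) :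
    ∫ u in Ioi (0:ℝ), zt l u * cexp (-s * u) = (mm l : ℂ) / l * ((2 * (s+1) - 1) / ((s+1) * ((s+1) - 1) + l)) := by
  by_cases hm : mm l = 0
  · simp [zt, hm]
  obtain ⟨h1, h2, h3, h4⟩ := zrho_spec l (xiG_of_mm l hm)
  set ρ := zrho l with hρ
  have k1 := lap_exp (ρ - 1) s (by simp; linarith)
  have k2 := lap_exp (-ρ) s (by simp; linarith)
  have e : ∀ u : ℝ, zt l u * cexp (-s * u) = (mm l : ℂ) / l *
     (cexp ((ρ - 1) * u) * cexp (-s * u) + cexp (-ρ * u) * cexp (-s * u)) := by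
    intro u; rw [zt, ← hρ]; ring
  simp only [e]
  rw [integral_const_mul, integral_add k1.1 k2.1, k1.2, k2.2]
  congr 1
  rw [h4, xi_term (s+1) ρ (by simp; linarith) (by linarith) h2.le]
  congr 2 <;> ring

lemma ZZ_lap (s : ℂ) (hs : 1/2 < s.re) :
    ∫ u in Ioi (0:ℝ), ZZ u * cexp (-s * u) =
      (2 * s + 1) / (s * (s+1)) * (completedRiemannZeta₀ 1) - logDeriv xiX (s+1) * (1 / (s * (s+1))) := by
  have hs0 : s ≠ 0 := by rintro rfl; simp at hs; linarith
  have hs1 : s + 1 ≠ 0 := by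
    intro h; have := congrArg Complex.re h; simp at this; linarith
  let S := Function.support zw
  have hS : Countable S := zw_summable.countable_support
  have hsub : ∀ u, Function.support (fun l => zt l u) ⊆ S := by
    intro u l hl
    simp only [Function.mem_support, S] at hl ⊢
    intro h
    have hm : mm l = 0 := by
      by_contra hm
      have ha := zero_a l (xiG_of_mm l hm)
      rw [zw, div_eq_zero_iff] at h
      rcases h with h | h
      · exact hm h
      · linarith
    exact hl (by simp [zt, hm])
  have e : ∀ u, ZZ u = ∑' l : S, zt l u := by
    intro u
    rw [ZZ]; exact (tsum_subtype_eq_of_support_subset (hsub u)).symm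
  have h := lap_tsum (fun (l : S) u => zt l u) (fun l => (zt_cont l).continuousOn)
    (fun l : S => zw l * 2) (fun l u hu => zt_norm_exp l u hu) ((zw_summable.mul_right 2).subtype S) s hs
  simp only [zt_lap _ s hs, ← e] at h
  have hsub2 : Function.support (fun l : ℂ => (mm l : ℂ) / l * ((2 * (s+1) - 1) / ((s+1) * ((s+1) - 1) + l))) ⊆ S := by
    intro l hl
    simp only [Function.mem_support, S] at hl ⊢
    intro h
    have hm : mm l = 0 := by
      by_contra hm
      have ha := zero_a l (xiG_of_mm l hm)
      rw [zw, div_eq_zero_iff] at h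
      rcases h with h | h
      · exact hm h
      · linarith
    exact hl (by simp [hm])
  have h' := (hasSum_subtype_iff_of_support_subset hsub2).mp h
  have g1 := zeros_hasSum 0 (by rw [xiG_zero]; exact one_ne_zero)
  have hX := xiX_ne_zero (s+1) (by simp; linarith)
  have g2 := xi_hasSum (s+1) (by simp; linarith)
  have g3 := (g1.mul_left ((2 * s + 1) / (s * (s+1)))).sub (g2.mul_right (1 / (s * (s+1))))
  rw [logDeriv_xiG_zero] at g3
  refine h'.unique (g3.congr_fun fun l => ?_)
  by_cases hm : mm l = 0
  · simp [hm]
  have hl0 : l ≠ 0 := by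
    rintro rfl; have := zero_a 0 (xiG_of_mm 0 hm); simp at this; linarith
  have hP : (s+1) * ((s+1) - 1) + l ≠ 0 := by
    obtain ⟨h1, h2, h3, h4⟩ := zrho_spec l (xiG_of_mm l hm)
    have : (s+1) * ((s+1) - 1) + l = (s + 1 - zrho l) * (s + zrho l) := by
      conv_lhs => rw [h4]
      ring
    rw [this]
    apply mul_ne_zero
    · intro h; have := congrArg Complex.re h; simp at this; linarith
    · intro h; have := congrArg Complex.re h; simp at this; linarith
  rw [zero_add]
  field_simp
  ring

end PartNoM

section PartNoN

open Complex Filter Topology Metric Set MeasureTheory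

/-- weights of trivial zeros -/
noncomputable def tw (k : ℕ) : ℝ := 1 / ((2 * k + 2) * (2 * k + 3))

lemma tw_nonneg (k : ℕ) : 0 ≤ tw k := by unfold tw; positivity

lemma tw_le (k : ℕ) : tw k ≤ 1 / 4 * (1 / ((k + 1 : ℕ) : ℝ) ^ 2) := by
  unfold tw
  rw [← one_div_mul_one_div_rev, one_div_mul_one_div, one_div_mul_one_div]
  apply one_div_le_one_div_of_le (by positivity)
  push_cast
  have : (0:ℝ) ≤ k := k.cast_nonneg
  nlinarith

lemma tw_maj : HasSum (fun k : ℕ => 1 / 4 * (1 / ((k + 1 : ℕ) : ℝ) ^ 2)) (1 / 4 * (Real.pi ^ 2 / 6)) := by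
  have h := (hasSum_nat_add_iff' 1).mpr hasSum_zeta_two
  simp only [Finset.sum_range_one, Nat.cast_zero] at h
  norm_num at h
  have := h.mul_left (1/4)
  norm_num at this ⊢
  exact this

lemma tw_summable : Summable tw := Summable.of_nonneg_of_le tw_nonneg tw_le tw_maj.summable

lemma tw_tsum : ∑' k, tw k ≤ 1 := by
  have h := hasSum_le tw_le tw_summable.hasSum tw_maj
  have h3 := Real.pi_lt_d2
  have h4 := Real.pi_pos
  nlinarith

noncomputable def tny (u : ℝ) : ℝ := ∑' k : ℕ, tw k * Real.exp (-(2 * k + 3) * u)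

lemma tny_term_le (k : ℕ) (u : ℝ) (hu : 0 ≤ u) : tw k * Real.exp (-(2 * k + 3) * u) ≤ tw k * Real.exp (-u) := by
  apply mul_le_mul_of_nonneg_left _ (tw_nonneg k)
  apply Real.exp_le_exp.mpr
  have : (0:ℝ) ≤ k * u := by positivity
  nlinarith

lemma tny_nonneg (u : ℝ) : 0 ≤ tny u := tsum_nonneg fun k => mul_nonneg (tw_nonneg k) (Real.exp_pos _).le

lemma tny_le (u : ℝ) (hu : 0 ≤ u) : tny u ≤ Real.exp (-u) := by
  have hm := tw_summable.hasSum.mul_right (Real.exp (-u))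
  have hs : Summable fun k : ℕ => tw k * Real.exp (-(2 * k + 3) * u) :=
    Summable.of_nonneg_of_le (fun k => mul_nonneg (tw_nonneg k) (Real.exp_pos _).le)
      (fun k => tny_term_le k u hu) hm.summable
  have h := hasSum_le (fun k => tny_term_le k u hu) hs.hasSum hm
  have := tw_tsum
  have := Real.exp_pos (-u)
  unfold tny
  nlinarith

lemma tny_coe (u : ℝ) : (tny u : ℂ) = ∑' k : ℕ, ((tw k * Real.exp (-(2 * k + 3) * u) : ℝ) : ℂ) := by
  rw [tny, Complex.ofReal_tsum]

lemma tny_norm (k : ℕ) (u : ℝ) (hu : 0 ≤ u) :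
    ‖((tw k * Real.exp (-(2 * k + 3) * u) : ℝ) : ℂ)‖ ≤ tw k * Real.exp (u/2) := by
  rw [norm_real, Real.norm_of_nonneg (mul_nonneg (tw_nonneg k) (Real.exp_pos _).le)]
  refine (tny_term_le k u hu).trans (mul_le_mul_of_nonneg_left ?_ (tw_nonneg k))
  exact Real.exp_le_exp.mpr (by linarith)

lemma tny_cont : ContinuousOn (fun u => (tny u : ℂ)) (Ici 0) := by
  simp only [tny_coe]
  refine lap_tsum_cont _ (fun k => ?_) _ tny_norm tw_summable
  fun_prop

lemma tny_lap (s : ℂ) (hs : 1/2 < s.re) :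
    HasSum (fun k : ℕ => (tw k : ℂ) * (1 / (s + (2 * k + 3))))
      (∫ u in Ioi (0:ℝ), (tny u : ℂ) * cexp (-s * u)) := by
  have h := lap_tsum (fun (k:ℕ) u => ((tw k * Real.exp (-(2 * k + 3) * u) : ℝ) : ℂ))
    (fun k => by fun_prop) _ tny_norm tw_summable s hs
  simp only [← tny_coe] at h
  refine h.congr_fun fun k => ?_
  have := (lap_exp (-(2 * k + 3)) s (by
    have : (0:ℝ) ≤ k := k.cast_nonneg
    simp; linarith)).2
  rw [sub_neg_eq_add] at this
  rw [← this, ← integral_const_mul]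
  congr 1; ext u; push_cast; ring

noncomputable def lam0 : ℝ := (Real.eulerMascheroniConstant - Real.log (4 * Real.pi)) / 2 + 1
noncomputable def Ttw : ℝ := ∑' k, tw k
noncomputable def cC : ℝ := -1 - (Real.eulerMascheroniConstant + Real.log Real.pi) / 2 + Ttw - lam0
noncomputable def cE : ℝ := 1 + (Real.eulerMascheroniConstant + Real.log Real.pi) / 2 - lam0

lemma cE_bd : 1 ≤ cE ∧ cE ≤ 1.838 := by
  have h : cE = Real.log 2 + Real.log Real.pi := by
    rw [cE, lam0, Real.log_mul (by norm_num) Real.pi_ne_zero,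
      show (4:ℝ) = 2 ^ 2 by norm_num, Real.log_pow]
    push_cast; ring
  have h1 := logpi_bd
  have h2 := Real.log_two_lt_d9
  have h3 := Real.log_two_gt_d9
  rw [h]
  constructor
  · linarith [h1.1]
  · linarith [h1.2]

lemma dig_lap (s : ℂ) (hs : 1/2 < s.re) :
    1 / 2 * digamma ((s+1)/2+1) * (1 / (s * (s+1))) =
      - (Real.eulerMascheroniConstant : ℂ) / 2 * (1 / (s * (s+1))) + (Ttw : ℂ) / s
       - ∫ u in Ioi (0:ℝ), (tny u : ℂ) * cexp (-s * u) := by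
  have hs0 : s ≠ 0 := by rintro rfl; simp at hs; linarith
  have hs1 : s + 1 ≠ 0 := by
    intro h; have := congrArg Complex.re h; simp at this; linarith
  have h1 := (dig_hasSum ((s+1)/2+1) (by simp; linarith)).mul_left (1 / 2 * (1 / (s * (s+1))))
  have h2 : HasSum (fun k => (tw k : ℂ) * (1 / s)) ((Ttw : ℂ) * (1 / s)) :=
    (Complex.hasSum_ofReal.mpr tw_summable.hasSum).mul_right _
  have h3 := (h2.sub (tny_lap s hs)).unique (h1.congr_fun fun k => ?_)
  · linear_combination -h3
  · have hk : (0:ℝ) ≤ k := k.cast_nonneg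
    have e1 : (k:ℂ) + 1 ≠ 0 := by exact_mod_cast Nat.succ_ne_zero k
    have e2 : s + (2 * k + 3) ≠ 0 := by
      intro h; have := congrArg Complex.re h; simp at this; linarith
    have e3 : 2 * (k:ℂ) + 3 ≠ 0 := by
      intro h; have := congrArg Complex.re h; simp at this; linarith
    have e4 : (k:ℂ) + ((s+1)/2+1) = (s + (2 * k + 3)) / 2 := by ring
    rw [e4, tw]
    push_cast
    rw [show 2 * (k:ℂ) + 2 = 2 * (k + 1) by ring]
    field_simp
    ring

lemma io_add {f g : ℝ → ℂ} (hf : IntegrableOn f (Ioi 0)) (hg : IntegrableOn g (Ioi 0)) :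
    IntegrableOn (fun u => f u + g u) (Ioi 0) := hf.add hg

lemma io_sub {f g : ℝ → ℂ} (hf : IntegrableOn f (Ioi 0)) (hg : IntegrableOn g (Ioi 0)) :
    IntegrableOn (fun u => f u - g u) (Ioi 0) := hf.sub hg

lemma AA_formula (u : ℝ) (hu : 0 < u) :
    (AA u : ℂ) = u + cC + cE * Real.exp (-u) + ZZ u - tny u := by
  have key := lap_unique (fun u : ℝ => (AA u : ℂ) - (u + cC * cexp (0 * u) + cE * cexp (-1 * u) + ZZ u - tny u)) ?_ ?_ ?_ u hu
  · rw [sub_eq_zero] at key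
    rw [key]; push_cast; simp
  · apply AA_cont.sub
    refine ContinuousOn.sub (ContinuousOn.add ?_ ZZ_cont) tny_cont
    fun_prop
  all_goals
    have I1 := fun (s : ℂ) (hs : s.re = 1) => (lap_int _ AA_cont _ AA_norm s (by rw [hs]; norm_num)).1
    have I2 := fun (s : ℂ) (hs : s.re = 1) => lap_id s (by rw [hs]; norm_num)
    have I3 := fun (s : ℂ) (hs : s.re = 1) => lap_exp 0 s (by rw [hs]; norm_num)
    have I4 := fun (s : ℂ) (hs : s.re = 1) => lap_exp (-1) s (by rw [hs]; norm_num)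
    have I5 := fun (s : ℂ) (hs : s.re = 1) => (lap_int _ ZZ_cont 1 (fun u hu => by
      have h1 := ZZ_bound1 u hu
      have h2 : Real.exp (-u) ≤ 1 := Real.exp_le_one_iff.mpr (by linarith)
      have h3 : 1 ≤ Real.exp (u/2) := Real.one_le_exp (by linarith)
      linarith) s (by rw [hs]; norm_num)).1
    have I6 := fun (s : ℂ) (hs : s.re = 1) => (lap_int _ tny_cont 1 (fun u hu => by
      have h1 := tny_le u hu
      have h2 : Real.exp (-u) ≤ 1 := Real.exp_le_one_iff.mpr (by linarith)
      have h3 : 1 ≤ Real.exp (u/2) := Real.one_le_exp (by linarith)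
      rw [norm_real, Real.norm_of_nonneg (tny_nonneg u)]
      linarith) s (by rw [hs]; norm_num)).1
    have e : ∀ s : ℂ, (fun u : ℝ => ((AA u : ℂ) - (u + cC * cexp (0 * u) + cE * cexp (-1 * u) + ZZ u - tny u)) * cexp (-s * u))
      = fun u : ℝ => (AA u : ℂ) * cexp (-s * u) - ((u : ℂ) * cexp (-s * u) + cC * (cexp (0 * u) * cexp (-s * u))
        + cE * (cexp (-1 * u) * cexp (-s * u)) + ZZ u * cexp (-s * u) - tny u * cexp (-s * u)) := by
      intro s; ext u; ring
  · have := e 1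
    rw [this]
    exact (I1 1 rfl).sub (((((I2 1 rfl).1.add ((I3 1 rfl).1.const_mul _)).add ((I4 1 rfl).1.const_mul _)).add (I5 1 rfl)).sub (I6 1 rfl))
  · intro s hs
    have hs2 : 1/2 < s.re := by rw [hs]; norm_num
    have hs0 : s ≠ 0 := by rintro rfl; simp at hs
    have hs1 : s + 1 ≠ 0 := by
      intro h; have := congrArg Complex.re h; simp [hs] at this
    have J2 := (I2 s hs).1
    have J3 := (I3 s hs).1.const_mul (cC : ℂ)
    have J4 := (I4 s hs).1.const_mul (cE : ℂ)
    have J23 := io_add J2 J3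
    have J24 := io_add J23 J4
    have J25 := io_add J24 (I5 s hs)
    have J26 := io_sub J25 (I6 s hs)
    rw [e s, integral_sub (I1 s hs) J26, integral_sub J25 (I6 s hs), integral_add J24 (I5 s hs),
      integral_add J23 J4, integral_add J2 J3, integral_const_mul, integral_const_mul, AA_lap s hs2,
      (I2 s hs).2, (I3 s hs).2, (I4 s hs).2, ZZ_lap s hs2, vM_formula (s+1) (by simp [hs])]
    have hd := dig_lap s hs2
    have hz : completedRiemannZeta₀ 1 = (lam0 : ℂ) := zeta0_val
    rw [hz]
    have hC : (cC : ℂ) = -1 - (Real.eulerMascheroniConstant + Real.log Real.pi) / 2 + Ttw - lam0 := by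
      rw [cC]; push_cast; ring
    have hE : (cE : ℂ) = 1 + (Real.eulerMascheroniConstant + Real.log Real.pi) / 2 - lam0 := by
      rw [cE]; push_cast; ring
    rw [hC, hE]
    push_cast
    generalize (∫ u in Ioi (0:ℝ), (tny u : ℂ) * cexp (-s * u)) = I at hd ⊢
    generalize digamma ((s+1)/2+1) = d at hd ⊢
    generalize logDeriv xiX (s+1) = x
    have hs2 : s - -1 = s + 1 := by ring
    have hI : I = - (Real.eulerMascheroniConstant : ℂ) / 2 * (1 / (s * (s+1))) + (Ttw : ℂ) / s -
       1 / 2 * d * (1 / (s * (s+1))) := by linear_combination hd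
    rw [hs2, hI, sub_zero]
    rw [add_sub_cancel_right]
    field_simp
    ring

/-- remainder -/
noncomputable def rr (u : ℝ) : ℝ := AA u - u - cC

lemma rr_abs (u : ℝ) (hu : 0 < u) : |rr u| ≤ ‖ZZ u‖ + 1.838 * Real.exp (-u) := by
  have h := AA_formula u hu
  have e : ((rr u : ℝ) : ℂ) = ZZ u + ((cE * Real.exp (-u) - tny u : ℝ) : ℂ) := by
    rw [rr]; push_cast; rw [h]; push_cast; ring
  rw [← Real.norm_eq_abs, ← Complex.norm_real, e]
  refine (norm_add_le _ _).trans ?_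
  gcongr
  rw [Complex.norm_real, Real.norm_eq_abs, abs_le]
  have h1 := tny_nonneg u
  have h2 := tny_le u hu.le
  have h3 := cE_bd
  have h4 := Real.exp_pos (-u)
  constructor
  · nlinarith
  · nlinarith

lemma rr_cont : ContinuousOn rr (Ici 0) := by
  have h : ContinuousOn (fun u => (AA u : ℂ).re) (Ici 0) := continuous_re.comp_continuousOn AA_cont
  simp only [ofReal_re] at h
  unfold rr
  exact (h.sub continuousOn_id).sub continuousOn_const

end PartNoN

section PartNoO

open Complex Filter Topology Metric Set MeasureTheory

noncomputable def qs (s v : ℝ) : ℝ := Real.exp (-s * v) * ((1 + s) / v + 1 / v ^ 2)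
noncomputable def ks (s v : ℝ) : ℝ :=
  Real.exp (-s * v) * ((1 + s) / v ^ 2 + 2 / v ^ 3 + s * (1 + s) / v + s / v ^ 2)
noncomputable def Fs (s v : ℝ) : ℝ := Real.exp (-(1 + s) * v) / v

lemma qs_deriv (s v : ℝ) (hv : 0 < v) : HasDerivAt (qs s) (- ks s v) v := by
  have h1 : HasDerivAt (fun v : ℝ => Real.exp (-s * v)) (Real.exp (-s * v) * (-s)) v := by
    simpa using ((hasDerivAt_id v).const_mul (-s)).exp
  have h2 : HasDerivAt (fun v : ℝ => (1 + s) / v + 1 / v ^ 2) ((0 * v - (1 + s) * 1) / v ^ 2 + (0 * v ^ 2 - 1 * (2 * v)) / (v ^ 2) ^ 2) v := by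
    have ha := (hasDerivAt_const v (1 + s)).fun_div (hasDerivAt_id' v) hv.ne'
    have hb := (hasDerivAt_const v (1 : ℝ)).fun_div ((hasDerivAt_pow 2 v)) (pow_pos hv 2).ne'
    simpa using ha.fun_add hb
  refine (h1.fun_mul h2).congr_deriv ?_
  unfold ks
  field_simp
  ring

lemma Fs_deriv (s v : ℝ) (hv : 0 < v) : HasDerivAt (Fs s) (- (Real.exp (-v) * qs s v)) v := by
  have h1 : HasDerivAt (fun v : ℝ => Real.exp (-(1 + s) * v)) (Real.exp (-(1 + s) * v) * (-(1 + s))) v := by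
    simpa using ((hasDerivAt_id v).const_mul (-(1 + s))).exp
  refine (h1.fun_div (hasDerivAt_id' v) hv.ne').congr_deriv ?_
  unfold qs
  rw [show -(1 + s) * v = -v + -s * v by ring, Real.exp_add]
  field_simp
  ring

lemma ks_nonneg (s v : ℝ) (hs : 0 ≤ s) (hv : 0 < v) : 0 ≤ ks s v := by unfold ks; positivity

lemma qs_tendsto (s : ℝ) (hs : 0 ≤ s) : Tendsto (qs s) atTop (𝓝 0) := by
  have h1 : Tendsto (fun v : ℝ => (1 + s) / v + 1 / v ^ 2) atTop (𝓝 (0 + 0)) := by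
    apply Tendsto.add
    · exact tendsto_const_nhds.div_atTop tendsto_id
    · exact tendsto_const_nhds.div_atTop (tendsto_pow_atTop two_ne_zero)
  rw [add_zero] at h1
  refine squeeze_zero' ?_ ?_ h1
  · filter_upwards [eventually_gt_atTop 0] with v hv
    unfold qs; positivity
  · filter_upwards [eventually_gt_atTop 0] with v hv
    unfold qs
    have : Real.exp (-s * v) ≤ 1 := Real.exp_le_one_iff.mpr (by nlinarith)
    apply mul_le_of_le_one_left _ this
    positivity

lemma Fs_tendsto (s : ℝ) (hs : 0 ≤ s) : Tendsto (Fs s) atTop (𝓝 0) := by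
  have h1 : Tendsto (fun v : ℝ => 1 / v) atTop (𝓝 0) := tendsto_const_nhds.div_atTop tendsto_id
  refine squeeze_zero' ?_ ?_ h1
  · filter_upwards [eventually_gt_atTop 0] with v hv
    unfold Fs; positivity
  · filter_upwards [eventually_gt_atTop 0] with v hv
    unfold Fs
    gcongr
    exact Real.exp_le_one_iff.mpr (by nlinarith)

noncomputable def Gn (c s v : ℝ) : ℝ := -((c - Real.exp (-v)) * qs s v) - Fs s v

lemma Gn_deriv (c s v : ℝ) (hv : 0 < v) : HasDerivAt (Gn c s) ((c - Real.exp (-v)) * ks s v) v := by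
  have h1 : HasDerivAt (fun v : ℝ => c - Real.exp (-v)) (Real.exp (-v)) v := by
    have := ((hasDerivAt_id v).fun_neg.exp).const_sub c
    simpa using this
  refine (((h1.fun_mul (qs_deriv s v hv)).fun_neg).fun_sub (Fs_deriv s v hv)).congr_deriv ?_
  ring

lemma Gn_tendsto (c s : ℝ) (hs : 0 ≤ s) : Tendsto (Gn c s) atTop (𝓝 0) := by
  have h1 : Tendsto (fun v : ℝ => c - Real.exp (-v)) atTop (𝓝 (c - 0)) :=
    tendsto_const_nhds.sub (Real.tendsto_exp_neg_atTop_nhds_zero)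
  have := ((h1.mul (qs_tendsto s hs)).neg).sub (Fs_tendsto s hs)
  have e : Gn c s = fun v => -((c - Real.exp (-v)) * qs s v) - Fs s v := rfl
  rw [e]
  simpa using this

lemma log2_half : (1/2 : ℝ) < Real.log 2 := by have := Real.log_two_gt_d9; linarith

lemma log_n_ge (n : ℕ) (hn : 2 ≤ n) : Real.log 2 ≤ Real.log n :=
  Real.log_le_log (by norm_num) (by exact_mod_cast hn)

lemma mx_eq (n : ℕ) (hn : 2 ≤ n) (v : ℝ) (hv : Real.log n ≤ v) :
    max (1 / (n:ℝ) - Real.exp (-v)) 0 = 1 / (n:ℝ) - Real.exp (-v) := by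
  apply max_eq_left
  have hn0 : (0:ℝ) < n := by positivity
  have : Real.exp (-v) ≤ Real.exp (-Real.log n) := Real.exp_le_exp.mpr (by linarith)
  rw [Real.exp_neg (Real.log n), Real.exp_log hn0] at this
  rw [one_div]; linarith

lemma mx_zero (n : ℕ) (hn : 2 ≤ n) (v : ℝ) (hv : v ≤ Real.log n) :
    max (1 / (n:ℝ) - Real.exp (-v)) 0 = 0 := by
  apply max_eq_right
  have hn0 : (0:ℝ) < n := by positivity
  have : Real.exp (-Real.log n) ≤ Real.exp (-v) := Real.exp_le_exp.mpr (by linarith)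
  rw [Real.exp_neg (Real.log n), Real.exp_log hn0] at this
  rw [one_div]; linarith

lemma Gn_log (n : ℕ) (hn : 2 ≤ n) (s : ℝ) : Gn (1 / n) s (Real.log n) = - Fs s (Real.log n) := by
  have hn0 : (0:ℝ) < n := by positivity
  rw [Gn, Real.exp_neg, Real.exp_log hn0]; simp

/-- infinite-range integral of one term -/
lemma at_ks (n : ℕ) (s : ℝ) (hs : 0 ≤ s) :
    IntegrableOn (fun v => at_ n v * ks s v) (Ioi (1/2)) ∧
    ∫ v in Ioi (1/2 : ℝ), at_ n v * ks s v = ArithmeticFunction.vonMangoldt n * Fs s (Real.log n) := by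
  rcases lt_or_ge n 2 with hn | hn
  · interval_cases n <;> simp [at_]
  set l := Real.log n with hl
  have hl1 : 1/2 < l := log2_half.trans_le (log_n_ge n hn)
  have hd : ∀ v ∈ Ici l, HasDerivAt (Gn (1 / n) s) ((1 / n - Real.exp (-v)) * ks s v) v := fun v hv =>
    Gn_deriv _ _ _ (by have : l ≤ v := hv; linarith)
  have hnn : ∀ v ∈ Ioi l, 0 ≤ (1 / n - Real.exp (-v)) * ks s v := fun v hv => by
    have hv' : l < v := hv
    apply mul_nonneg _ (ks_nonneg s v hs (by linarith))
    rw [← mx_eq n hn v hv'.le]; exact le_max_right _ _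
  have hI := integrableOn_Ioi_deriv_of_nonneg' hd hnn (Gn_tendsto _ s hs)
  have hV := integral_Ioi_of_hasDerivAt_of_nonneg' hd hnn (Gn_tendsto _ s hs)
  have e : ∀ v : ℝ, v ∈ Ioi (1/2:ℝ) → at_ n v * ks s v = (Ioi l).indicator (fun v =>
      ArithmeticFunction.vonMangoldt n * ((1 / n - Real.exp (-v)) * ks s v)) v := by
    intro v hv
    by_cases h : v ∈ Ioi l
    · rw [indicator_of_mem h, at_, mx_eq n hn v (le_of_lt h)]; ring
    · rw [indicator_of_notMem h, at_, mx_zero n hn v (not_lt.mp h)]; ring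
  have hsub : Ioi (1/2) ∩ Ioi l = Ioi l := inter_eq_self_of_subset_right (Ioi_subset_Ioi hl1.le)
  constructor
  · rw [integrableOn_congr_fun e measurableSet_Ioi, IntegrableOn, integrable_indicator_iff measurableSet_Ioi,
      IntegrableOn, Measure.restrict_restrict measurableSet_Ioi, inter_comm, hsub]
    exact hI.const_mul _
  · rw [setIntegral_congr_fun measurableSet_Ioi e, setIntegral_indicator measurableSet_Ioi, hsub,
      integral_const_mul, hV, hl, Gn_log n hn]
    ring

/-- finite-range integral of one term -/
lemma at_fin (n : ℕ) (u : ℝ) (hu : 1/2 < u) :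
    IntervalIntegrable (fun v => at_ n v * ks 0 v) volume (1/2) u ∧
    at_ n u * qs 0 u + ∫ v in (1/2 : ℝ)..u, at_ n v * ks 0 v =
      ArithmeticFunction.vonMangoldt n * (if Real.log n ≤ u then Fs 0 (Real.log n) - Fs 0 u else 0) := by
  have hii : IntervalIntegrable (fun v => at_ n v * ks 0 v) volume (1/2) u := by
    rw [intervalIntegrable_iff, uIoc_of_le hu.le]
    exact (at_ks n 0 le_rfl).1.mono_set Ioc_subset_Ioi_self
  refine ⟨hii, ?_⟩
  rcases lt_or_ge n 2 with hn | hn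
  · interval_cases n <;> simp [at_]
  set l := Real.log n with hl
  have hl1 : 1/2 < l := log2_half.trans_le (log_n_ge n hn)
  split_ifs with h
  · have hsplit := intervalIntegral.integral_add_adjacent_intervals
      (hii.mono_set (by rw [uIcc_of_le hl1.le, uIcc_of_le hu.le]; exact Icc_subset_Icc_right h))
      (hii.mono_set (show uIcc l u ⊆ _ by rw [uIcc_of_le h, uIcc_of_le hu.le]; exact Icc_subset_Icc_left hl1.le))
    rw [← hsplit]
    have z : ∫ v in (1/2 : ℝ)..l, at_ n v * ks 0 v = 0 := by
      rw [intervalIntegral.integral_congr (g := fun _ => 0)]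
      · simp
      · intro v hv
        rw [uIcc_of_le hl1.le] at hv
        simp only [at_]
        rw [mx_zero n hn v hv.2]; simp
    have hc : ∀ v ∈ uIcc l u, at_ n v * ks 0 v = ArithmeticFunction.vonMangoldt n * ((1 / n - Real.exp (-v)) * ks 0 v) := by
      intro v hv
      rw [uIcc_of_le h] at hv
      rw [at_, mx_eq n hn v hv.1]; ring
    rw [z, zero_add, intervalIntegral.integral_congr hc, intervalIntegral.integral_const_mul]
    rw [intervalIntegral.integral_eq_sub_of_hasDerivAt (f := Gn (1 / n) 0)]
    · rw [hl, Gn_log n hn, at_, mx_eq n hn u h, Gn]; ring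
    · intro v hv
      rw [uIcc_of_le h] at hv
      exact Gn_deriv _ _ _ (by linarith [hv.1])
    · apply ContinuousOn.intervalIntegrable
      rw [uIcc_of_le h]
      intro v hv
      have hv0 : v ≠ 0 := by have := hv.1; intro h; linarith
      unfold ks
      apply ContinuousAt.continuousWithinAt
      fun_prop (disch := first | assumption | positivity)
  · push Not at h
    have z : ∫ v in (1/2 : ℝ)..u, at_ n v * ks 0 v = 0 := by
      rw [intervalIntegral.integral_congr (g := fun _ => 0)]
      · simp
      · intro v hv
        rw [uIcc_of_le hu.le] at hv
        simp only [at_]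
        rw [mx_zero n hn v (by linarith [hv.2])]; simp
    rw [z, at_, mx_zero n hn u h.le]; simp

end PartNoO

section PartNoP

open Complex Filter Topology Metric Set MeasureTheory

lemma Fs_log (n : ℕ) (hn : 2 ≤ n) (s : ℝ) : Fs s (Real.log n) = 1 / ((n:ℝ) ^ (1 + s) * Real.log n) := by
  have hn0 : (0:ℝ) < n := by positivity
  rw [Fs, Real.rpow_def_of_pos hn0, ← one_div_mul_one_div, one_div (Real.exp _), ← Real.exp_neg]
  rw [show -(1 + s) * Real.log n = -(Real.log n * (1 + s)) by ring]
  ring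

lemma logzeta_int (s : ℝ) (hs : 0 < s) :
    ∫ v in Ioi (1/2 : ℝ), AA v * ks s v = Real.log (riemannZeta ((1 + s : ℝ) : ℂ)).re := by
  have hterm : ∀ n : ℕ, ArithmeticFunction.vonMangoldt n * Fs s (Real.log n) =
      ArithmeticFunction.vonMangoldt n / ((n:ℝ) ^ (1 + s) * Real.log n) := by
    intro n
    rcases lt_or_ge n 2 with hn | hn
    · interval_cases n <;> simp
    · rw [Fs_log n hn]; ring
  have hsum : Summable (fun n : ℕ => ArithmeticFunction.vonMangoldt n * Fs s (Real.log n)) := by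
    have h1 : Summable (fun n : ℕ => (n:ℝ) ^ (-(1+s))) := Real.summable_nat_rpow.mpr (by linarith)
    refine Summable.of_nonneg_of_le (fun n => ?_) (fun n => ?_) h1
    · rw [hterm]
      have := Real.log_natCast_nonneg n
      have : 0 ≤ ArithmeticFunction.vonMangoldt n := ArithmeticFunction.vonMangoldt_nonneg
      positivity
    · rcases lt_or_ge n 2 with hn | hn
      · interval_cases n
        · simp [Real.zero_rpow (show -s + -1 ≠ 0 by linarith)]
        · simp
      · rw [hterm]
        have h2 : 0 < Real.log n := lt_of_lt_of_le (by linarith [log2_half]) (log_n_ge n hn)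
        have h3 : ArithmeticFunction.vonMangoldt n ≤ Real.log n := ArithmeticFunction.vonMangoldt_le_log
        have hn0 : (0:ℝ) < n := by positivity
        rw [Real.rpow_neg hn0.le, div_le_iff₀ (by positivity)]
        have : ((n:ℝ) ^ (1 + s))⁻¹ * ((n:ℝ) ^ (1 + s) * Real.log n) = Real.log n := by
          rw [← mul_assoc, inv_mul_cancel₀ (by positivity), one_mul]
        rw [this]; exact h3
  have hnn : ∀ n : ℕ, ∀ v ∈ Ioi (1/2:ℝ), 0 ≤ at_ n v * ks s v := fun n v hv =>
    mul_nonneg (at_nonneg n v) (ks_nonneg s v hs.le (by have : 1/2 < v := hv; linarith))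
  have hnorm : ∀ n : ℕ, ∫ v in Ioi (1/2 : ℝ), ‖at_ n v * ks s v‖ = ArithmeticFunction.vonMangoldt n * Fs s (Real.log n) := by
    intro n
    rw [← (at_ks n s hs.le).2]
    exact setIntegral_congr_fun measurableSet_Ioi fun v hv => Real.norm_of_nonneg (hnn n v hv)
  have hS : Summable (fun n : ℕ => ∫ v in Ioi (1/2 : ℝ), ‖at_ n v * ks s v‖) := by
    simp only [hnorm]; exact hsum
  have h := hasSum_integral_of_summable_integral_norm (μ := volume.restrict (Ioi (1/2:ℝ)))
    (fun n => (at_ks n s hs.le).1) hS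
  have hA : ∀ v, ∑' n, at_ n v = AA v := fun _ => rfl
  simp only [tsum_mul_right, hA] at h
  have h2 := h.tsum_eq
  rw [← h2, log_riemannZeta_eq (show 1 < 1 + s by linarith)]
  apply tsum_congr
  intro n
  rw [(at_ks n s hs.le).2, hterm]

/-- main weighted sum -/
noncomputable def gg (u : ℝ) : ℝ := ∑ n ∈ Finset.Icc 2 ⌊Real.exp u⌋₊,
  ArithmeticFunction.vonMangoldt n * (1 / (n * Real.log n) - Real.exp (-u) / u)

lemma gg_eq (u : ℝ) (hu : 1/2 < u) : gg u = AA u * qs 0 u + ∫ v in (1/2 : ℝ)..u, AA v * ks 0 v := by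
  set S := Finset.Icc 2 ⌊Real.exp u⌋₊ with hS
  have hAA : ∀ v ≤ u, AA v = ∑ n ∈ S, at_ n v := by
    intro v hv
    rw [AA, tsum_eq_sum]
    intro n hn
    rcases lt_or_ge n 2 with h2 | h2
    · interval_cases n <;> simp [at_]
    · rw [at_, mx_zero n h2, mul_zero]
      have : ¬ n ≤ ⌊Real.exp u⌋₊ := fun h => hn (Finset.mem_Icc.mpr ⟨h2, h⟩)
      rw [Nat.le_floor_iff (Real.exp_pos u).le] at this
      push Not at this
      have := Real.log_lt_log (Real.exp_pos u) this
      rw [Real.log_exp] at this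
      linarith
  have e : ∫ v in (1/2 : ℝ)..u, AA v * ks 0 v = ∫ v in (1/2 : ℝ)..u, ∑ n ∈ S, at_ n v * ks 0 v := by
    apply intervalIntegral.integral_congr
    intro v hv
    rw [uIcc_of_le hu.le] at hv
    simp only
    rw [hAA v hv.2, Finset.sum_mul]
  rw [e, intervalIntegral.integral_finsetSum (fun n _ => (at_fin n u hu).1), hAA u le_rfl, Finset.sum_mul,
    ← Finset.sum_add_distrib, gg]
  apply Finset.sum_congr rfl
  intro n hn
  rw [(at_fin n u hu).2]
  rw [Finset.mem_Icc, Nat.le_floor_iff (Real.exp_pos u).le] at hn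
  have h1 : Real.log n ≤ u := by
    rw [← Real.log_exp u]; exact Real.log_le_log (by have := hn.1; positivity) hn.2
  rw [if_pos h1, Fs_log n hn.1]
  simp [Fs]

end PartNoP

section PartNoQ

open Complex Filter Topology Metric Set MeasureTheory

lemma gamma_log : IntegrableOn (fun t : ℝ => Real.exp (-t) * Real.log t) (Ioi 0) ∧
    ∫ t in Ioi (0:ℝ), Real.exp (-t) * Real.log t = - Real.eulerMascheroniConstant := by
  have h1 := Complex.hasDerivAt_GammaIntegral (s := 1) (by simp)
  have h2 : deriv Complex.GammaIntegral 1 = deriv Complex.Gamma 1 := by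
    apply Filter.EventuallyEq.deriv_eq
    have : ∀ᶠ z : ℂ in 𝓝 1, 0 < z.re :=
      (isOpen_lt continuous_const continuous_re).mem_nhds (by simp)
    filter_upwards [this] with z hz
    exact (Complex.Gamma_eq_integral hz).symm
  have h3 := Complex.digamma_one
  have h4 : ((∫ t in Ioi (0:ℝ), Real.exp (-t) * Real.log t : ℝ) : ℂ) = - Real.eulerMascheroniConstant := by
    rw [← h3, digamma_def, logDeriv_apply, Complex.Gamma_one, div_one, ← h2, h1.deriv, ← integral_complex_ofReal]
    apply integral_congr_ae
    filter_upwards with t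
    simp
    ring
  have h5 : ∫ t in Ioi (0:ℝ), Real.exp (-t) * Real.log t = - Real.eulerMascheroniConstant := by
    exact_mod_cast h4
  refine ⟨?_, h5⟩
  by_contra hcon
  rw [integral_undef hcon] at h5
  have := gamma_bd.1
  norm_num at this
  linarith

lemma gamma_log_lim : Tendsto (fun a : ℝ => ∫ t in Ioi a, Real.exp (-t) * Real.log t) (𝓝[>] 0)
    (𝓝 (- Real.eulerMascheroniConstant)) := by
  have h := (aecover_Ioi_of_Ioi (μ := (volume : Measure ℝ)) (A := (0:ℝ)) (l := 𝓝[>] 0) (a := fun a => a)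
    nhdsWithin_le_nhds).integral_tendsto_of_countably_generated gamma_log.1
  rw [gamma_log.2] at h
  refine h.congr' ?_
  filter_upwards [self_mem_nhdsWithin] with a ha
  rw [Measure.restrict_restrict measurableSet_Ioi, inter_eq_self_of_subset_left (Ioi_subset_Ioi (le_of_lt ha))]

lemma dom_exp (f : ℝ → ℝ) (a b K : ℝ) (hb : 0 < b) (hc : ContinuousOn f (Ioi a))
    (hf : ∀ v, a < v → |f v| ≤ K * Real.exp (-b * v)) : IntegrableOn f (Ioi a) := by
  have hi := (integrableOn_exp_mul_Ioi (a := -b) (by linarith) a).const_mul K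
  refine Integrable.mono' hi (hc.aestronglyMeasurable measurableSet_Ioi) ?_
  filter_upwards [ae_restrict_mem measurableSet_Ioi] with v hv
  exact hf v hv

noncomputable def Ws (s v : ℝ) : ℝ := -((v + cC) * qs s v) - Real.exp (-s * v) / v + Real.exp (-s * v) * Real.log v

lemma Ws_deriv (s v : ℝ) (hv : 0 < v) :
    HasDerivAt (Ws s) ((v + cC) * ks s v - s * (Real.exp (-s * v) * Real.log v)) v := by
  have h1 : HasDerivAt (fun v : ℝ => Real.exp (-s * v)) (Real.exp (-s * v) * (-s)) v := by
    simpa using ((hasDerivAt_id v).const_mul (-s)).exp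
  have h2 : HasDerivAt (fun v : ℝ => v + cC) 1 v := (hasDerivAt_id' v).add_const cC
  refine ((((h2.fun_mul (qs_deriv s v hv)).fun_neg).fun_sub (h1.fun_div (hasDerivAt_id' v) hv.ne')).fun_add
    (h1.fun_mul (Real.hasDerivAt_log hv.ne'))).congr_deriv ?_
  unfold qs
  field_simp
  ring

lemma vexp_tendsto (s : ℝ) (hs : 0 < s) : Tendsto (fun v : ℝ => (v + 1) * Real.exp (-s * v)) atTop (𝓝 0) := by
  have h1 := tendsto_rpow_mul_exp_neg_mul_atTop_nhds_zero 1 s hs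
  have h2 := tendsto_rpow_mul_exp_neg_mul_atTop_nhds_zero 0 s hs
  simp only [Real.rpow_one, Real.rpow_zero] at h1 h2
  have := h1.add h2
  rw [add_zero] at this
  refine this.congr fun v => by ring

lemma vexp_le (s v : ℝ) (hs : 0 < s) (hv : 0 ≤ v) : (v + 1) * Real.exp (-s * v) ≤ (1 + 2 / s) * Real.exp (-(s/2) * v) := by
  rw [show -s * v = -(s/2) * v + -(s/2*v) by ring, Real.exp_add, Real.exp_neg (s/2*v)]
  have h1 := Real.add_one_le_exp (s/2*v)
  have h2 : (v + 1) ≤ (1 + 2/s) * Real.exp (s/2*v) := by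
    have : (1 + 2/s) * (s/2*v+1) = s/2*v + 1 + v + 2/s := by field_simp; ring
    have h3 : (1 + 2/s) * (s/2*v+1) ≤ (1 + 2/s) * Real.exp (s/2*v) := by gcongr
    have : 0 ≤ s/2*v + 2/s := by positivity
    linarith
  have h4 := Real.exp_pos (-(s/2) * v)
  have h5 := Real.exp_pos (s/2*v)
  rw [show (v+1) * (Real.exp (-(s/2) * v) * (Real.exp (s/2*v))⁻¹) = ((v+1) / Real.exp (s/2*v)) * Real.exp (-(s/2) * v) by ring]
  apply mul_le_mul_of_nonneg_right _ h4.le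
  rwa [div_le_iff₀ h5]

lemma abs_log_le (v : ℝ) (hv : 1/2 ≤ v) : |Real.log v| ≤ v + 1 := by
  rw [abs_le]
  constructor
  · have h1 := Real.log_le_log (by norm_num) hv
    rw [one_div, Real.log_inv] at h1
    have := Real.log_two_lt_d9
    linarith
  · have := Real.log_le_sub_one_of_pos (show 0 < v by linarith)
    linarith

lemma inv_half (v : ℝ) (hv : 1/2 ≤ v) : 1 / v ≤ 2 := by
  rw [div_le_iff₀ (by linarith)]; linarith

lemma ks_le (s v : ℝ) (hs : 0 ≤ s) (hv : 1/2 ≤ v) :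
    ks s v ≤ ((1 + s) * 4 + 16 + s * (1 + s) * 2 + s * 4) * Real.exp (-s * v) := by
  have h1 := inv_half v hv
  have h0 : 0 < 1 / v := one_div_pos.mpr (by linarith)
  have h2 : (1/v)^2 ≤ 4 := by nlinarith
  have h3 : (1/v)^3 ≤ 8 := by nlinarith [mul_pos h0 h0]
  unfold ks
  rw [mul_comm]
  apply mul_le_mul_of_nonneg_right _ (Real.exp_pos _).le
  have e : (1 + s) / v ^ 2 + 2 / v ^ 3 + s * (1 + s) / v + s / v ^ 2 =
    (1 + s) * (1/v)^2 + 2 * (1/v)^3 + s * (1+s) * (1/v) + s * (1/v)^2 := by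
    simp only [div_pow, one_pow]; ring
  rw [e]
  gcongr
  linarith

lemma ks_cont (s : ℝ) : ContinuousOn (ks s) (Ioi (1/2)) := by
  intro v hv
  have hv1 : 1/2 < v := hv
  have hv0 : v ≠ 0 := by intro h; linarith
  unfold ks
  apply ContinuousAt.continuousWithinAt
  fun_prop (disch := first | assumption | positivity)

lemma log_cont : ContinuousOn Real.log (Ioi (1/2)) := by
  intro v hv
  have hv1 : 1/2 < v := hv
  exact (Real.continuousAt_log (by linarith)).continuousWithinAt

lemma int_log (s : ℝ) (hs : 0 < s) : IntegrableOn (fun v => Real.exp (-s * v) * Real.log v) (Ioi (1/2)) := by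
  apply dom_exp _ _ (s/2) (1 + 2/s) (by linarith)
  · exact ContinuousOn.mul (by fun_prop) log_cont
  · intro v hv
    refine le_trans ?_ (vexp_le s v hs (by linarith))
    rw [abs_mul, abs_of_pos (Real.exp_pos _), mul_comm]
    exact mul_le_mul_of_nonneg_right (abs_log_le v hv.le) (Real.exp_pos _).le

lemma int_vC (s : ℝ) (hs : 0 < s) : IntegrableOn (fun v => (v + cC) * ks s v) (Ioi (1/2)) := by
  set K := ((1 + s) * 4 + 16 + s * (1 + s) * 2 + s * 4) with hK
  have hK0 : 0 ≤ K := by positivity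
  apply dom_exp _ _ (s/2) ((1 + |cC|) * K * (1 + 2/s)) (by linarith)
  · exact ContinuousOn.mul (by fun_prop) (ks_cont s)
  · intro v hv
    have h1 := vexp_le s v hs (by linarith)
    have h2 := ks_le s v hs.le hv.le
    rw [← hK] at h2
    have h3 := ks_nonneg s v hs.le (by linarith)
    rw [abs_mul, abs_of_nonneg h3]
    have h4 : |v + cC| ≤ (1 + |cC|) * (v + 1) := by
      have := abs_add_le v cC
      rw [abs_of_pos (show 0 < v by linarith)] at this
      have : 0 ≤ |cC| * v := mul_nonneg (abs_nonneg _) (by linarith)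
      linarith
    calc |v + cC| * ks s v ≤ ((1 + |cC|) * (v + 1)) * (K * Real.exp (-s * v)) := by
          apply mul_le_mul h4 h2 h3
          have := abs_nonneg cC
          have : 0 < v := by linarith
          positivity
      _ = (1 + |cC|) * K * ((v + 1) * Real.exp (-s * v)) := by ring
      _ ≤ (1 + |cC|) * K * ((1 + 2 / s) * Real.exp (-(s/2) * v)) := by
          apply mul_le_mul_of_nonneg_left h1
          have := abs_nonneg cC
          positivity
      _ = _ := by ring

lemma Ws_tendsto (s : ℝ) (hs : 0 < s) : Tendsto (Ws s) atTop (𝓝 0) := by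
  have h1 := (vexp_tendsto s hs).const_mul ((1 + |cC|) * ((1 + s) * 2 + 4) + 3)
  rw [mul_zero] at h1
  apply squeeze_zero_norm' _ h1
  filter_upwards [eventually_ge_atTop 1] with v hv
  have hE := Real.exp_pos (-s * v)
  have h4 : |v + cC| ≤ (1 + |cC|) * (v + 1) := by
    have := abs_add_le v cC
    rw [abs_of_pos (show 0 < v by linarith)] at this
    have : 0 ≤ |cC| * v := mul_nonneg (abs_nonneg _) (by linarith)
    linarith
  have hi := inv_half v (by linarith)
  have hi0 : 0 < 1 / v := one_div_pos.mpr (by linarith)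
  have hq : qs s v ≤ ((1 + s) * 2 + 4) * Real.exp (-s * v) := by
    unfold qs
    rw [mul_comm]
    apply mul_le_mul_of_nonneg_right _ hE.le
    have : (1 + s) / v + 1 / v ^ 2 = (1 + s) * (1 / v) + (1/v)^2 := by simp only [div_pow, one_pow]; ring
    rw [this]
    have : (1/v)^2 ≤ 4 := by nlinarith
    have : (1 + s) * (1 / v) ≤ (1 + s) * 2 := by gcongr
    linarith
  have hq0 : 0 ≤ qs s v := by unfold qs; positivity
  have a1 : |(v + cC) * qs s v| ≤ ((1 + |cC|) * (v + 1)) * (((1 + s) * 2 + 4) * Real.exp (-s * v)) := by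
    rw [abs_mul, abs_of_nonneg hq0]
    apply mul_le_mul h4 hq hq0
    have := abs_nonneg cC
    positivity
  have a2 : |Real.exp (-s * v) / v| ≤ 2 * ((v + 1) * Real.exp (-s * v)) := by
    rw [abs_of_pos (by positivity)]
    rw [div_eq_mul_one_div]
    nlinarith
  have a3 : |Real.exp (-s * v) * Real.log v| ≤ (v + 1) * Real.exp (-s * v) := by
    rw [abs_mul, abs_of_pos hE, mul_comm]
    exact mul_le_mul_of_nonneg_right (abs_log_le v (by linarith)) hE.le
  rw [Real.norm_eq_abs, Ws]
  have b1 := abs_add_le (-((v + cC) * qs s v) - Real.exp (-s * v) / v) (Real.exp (-s * v) * Real.log v)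
  have b2 := abs_sub (-((v + cC) * qs s v)) (Real.exp (-s * v) / v)
  rw [abs_neg] at b2
  nlinarith

lemma int_vC_val (s : ℝ) (hs : 0 < s) : ∫ v in Ioi (1/2 : ℝ), (v + cC) * ks s v =
    - Ws s (1/2) + (∫ t in Ioi (s/2), Real.exp (-t) * Real.log t) - Real.log s * Real.exp (-(s/2)) := by
  have hI := (int_vC s hs)
  have hL := (int_log s hs).const_mul s
  have h := integral_Ioi_of_hasDerivAt_of_tendsto' (f := Ws s) (a := 1/2)
    (fun v hv => Ws_deriv s v (by have : 1/2 ≤ v := hv; linarith)) (hI.sub hL) (Ws_tendsto s hs)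
  rw [integral_sub hI hL, integral_const_mul] at h
  have h2 := integral_comp_mul_left_Ioi (fun t => Real.exp (-t) * (Real.log t - Real.log s)) (1/2) hs
  have h3 : ∫ v in Ioi (1/2 : ℝ), Real.exp (-(s * v)) * (Real.log (s * v) - Real.log s) =
      ∫ v in Ioi (1/2 : ℝ), Real.exp (-s * v) * Real.log v := by
    apply setIntegral_congr_fun measurableSet_Ioi
    intro v hv
    have hv1 : 1/2 < v := hv
    simp only
    rw [Real.log_mul hs.ne' (by linarith)]
    rw [neg_mul]; ring
  rw [h3] at h2
  rw [h2, smul_eq_mul] at h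
  have i1 : IntegrableOn (fun t => Real.exp (-t) * Real.log t) (Ioi (s * (1/2))) :=
    gamma_log.1.mono_set (Ioi_subset_Ioi (by positivity))
  have i2 : IntegrableOn (fun t => Real.exp (-t) * Real.log s) (Ioi (s * (1/2))) :=
    (integrableOn_exp_neg_Ioi _).mul_const _
  have h4 : ∫ t in Ioi (s * (1/2)), Real.exp (-t) * (Real.log t - Real.log s) =
     (∫ t in Ioi (s/2), Real.exp (-t) * Real.log t) - Real.log s * Real.exp (-(s/2)) := by
    simp only [mul_sub]
    rw [integral_sub i1 i2, integral_mul_const, integral_exp_neg_Ioi]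
    rw [mul_one_div]; ring
  rw [h4] at h
  field_simp at h
  field_simp
  linarith

end PartNoQ

section PartNoR

open Complex Filter Topology Metric Set MeasureTheory

lemma rr_le2 (v : ℝ) (hv : 0 < v) : |rr v| ≤ 2 := by
  have h1 := rr_abs v hv
  have h2 := ZZ_bound1 v hv.le
  have h3 : Real.exp (-v) ≤ 1 := Real.exp_le_one_iff.mpr (by linarith)
  norm_num at h1 h2 ⊢
  linarith

lemma rr_le3 (v : ℝ) (hv : 0 < v) : v * |rr v| ≤ 3 := by
  have h1 := mul_le_mul_of_nonneg_left (rr_abs v hv) hv.le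
  have h2 := ZZ_bound2 v hv.le
  have h3 : v * Real.exp (-v) ≤ 1 := by
    have := Real.add_one_le_exp v
    rw [Real.exp_neg, ← div_eq_mul_inv, div_le_one (Real.exp_pos v)]; linarith
  norm_num at h1 h2 ⊢
  linarith

lemma rk_bd (s v : ℝ) (hs : 0 ≤ s) (hs1 : s ≤ 1) (hv : 1/2 < v) : |rr v * ks s v| ≤ 20 / v ^ 2 := by
  have h2 := rr_le2 v (by linarith)
  have h3 := rr_le3 v (by linarith)
  have hr := abs_nonneg (rr v)
  have hi := inv_half v hv.le
  have hi0 : 0 < 1 / v := one_div_pos.mpr (by linarith)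
  rw [abs_mul, abs_of_nonneg (ks_nonneg s v hs (by linarith))]
  have hE : Real.exp (-s * v) ≤ 1 := Real.exp_le_one_iff.mpr (by nlinarith)
  have hE0 := Real.exp_pos (-s * v)
  have e : |rr v| * ks s v = Real.exp (-s*v) * ((1/v)^2 * (|rr v| * ((1+s) + 2 * (1/v) + s) + s * (1+s) * (v * |rr v|))) := by
    unfold ks
    have hv0 : v ≠ 0 := by intro h; linarith
    field_simp
    ring
  rw [e]
  have b1 : |rr v| * ((1+s) + 2 * (1/v) + s) + s * (1+s) * (v * |rr v|) ≤ 20 := by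
    have : |rr v| * ((1+s) + 2 * (1/v) + s) ≤ 2 * 7 := by
      apply mul_le_mul h2 (by linarith) (by linarith) (by norm_num)
    have h4 : s * (1 + s) ≤ 2 := by nlinarith
    have : s * (1+s) * (v * |rr v|) ≤ 2 * 3 := by
      apply mul_le_mul h4 h3 (by positivity) (by norm_num)
    linarith
  have b0 : 0 ≤ |rr v| * ((1+s) + 2 * (1/v) + s) + s * (1+s) * (v * |rr v|) := by
    have : 0 < v := by linarith
    positivity
  have b2 : (20:ℝ) / v^2 = 1 * ((1/v)^2 * 20) := by simp only [div_pow, one_pow]; ring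
  rw [b2]
  apply mul_le_mul hE _ (by positivity) (by norm_num)
  exact mul_le_mul_of_nonneg_left b1 (by positivity)

lemma int_sq (a : ℝ) (ha : 0 < a) : IntegrableOn (fun v : ℝ => 20 / v ^ 2) (Ioi a) := by
  have := (integrableOn_Ioi_rpow_of_lt (a := -2) (by norm_num) ha).const_mul 20
  refine this.congr ?_
  filter_upwards [ae_restrict_mem measurableSet_Ioi] with v hv
  have hv0 : 0 < v := ha.trans hv
  rw [Real.rpow_neg hv0.le]
  norm_num
  ring

lemma rk_meas (s : ℝ) : AEStronglyMeasurable (fun v => rr v * ks s v) (volume.restrict (Ioi (1/2))) := by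
  apply ContinuousOn.aestronglyMeasurable _ measurableSet_Ioi
  exact (rr_cont.mono (fun v hv => by have : 1/2 < v := hv; simp; linarith)).mul (ks_cont s)

lemma rk_int (s : ℝ) (hs : 0 ≤ s) (hs1 : s ≤ 1) : IntegrableOn (fun v => rr v * ks s v) (Ioi (1/2)) := by
  refine Integrable.mono' (int_sq (1/2) (by norm_num)) (rk_meas s) ?_
  filter_upwards [ae_restrict_mem measurableSet_Ioi] with v hv
  exact rk_bd s v hs hs1 hv

lemma rk_lim : Tendsto (fun s => ∫ v in Ioi (1/2 : ℝ), rr v * ks s v) (𝓝[>] 0)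
    (𝓝 (∫ v in Ioi (1/2 : ℝ), rr v * ks 0 v)) := by
  apply tendsto_integral_filter_of_dominated_convergence (fun v => 20 / v ^ 2)
  · filter_upwards with s
    exact rk_meas s
  · have : ∀ᶠ s : ℝ in 𝓝[>] 0, s < 1 := nhdsWithin_le_nhds (gt_mem_nhds zero_lt_one)
    filter_upwards [self_mem_nhdsWithin, this] with s hs hs1
    filter_upwards [ae_restrict_mem measurableSet_Ioi] with v hv
    exact rk_bd s v (le_of_lt hs) hs1.le hv
  · exact int_sq (1/2) (by norm_num)
  · filter_upwards with v
    have : Continuous (fun s => rr v * ks s v) := by unfold ks; fun_prop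
    exact (this.tendsto 0).mono_left nhdsWithin_le_nhds

lemma slogs : Tendsto (fun s : ℝ => (1 - Real.exp (-(s/2))) * Real.log s) (𝓝[>] 0) (𝓝 0) := by
  have h := _root_.tendsto_log_mul_rpow_nhdsGT_zero (r := 1) one_pos
  simp only [Real.rpow_one] at h
  have h' := h.abs
  rw [abs_zero] at h'
  apply squeeze_zero_norm' _ h'
  filter_upwards [self_mem_nhdsWithin] with s hs
  have hs0 : 0 < s := hs
  rw [Real.norm_eq_abs, abs_mul, abs_mul, mul_comm]
  apply mul_le_mul_of_nonneg_left _ (abs_nonneg _)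
  rw [abs_of_pos hs0]
  have := Real.add_one_le_exp (-(s/2))
  have h2 : Real.exp (-(s/2)) ≤ 1 := Real.exp_le_one_iff.mpr (by linarith)
  rw [abs_of_nonneg (by linarith)]
  linarith

lemma r_const : ∫ v in Ioi (1/2 : ℝ), rr v * ks 0 v = Real.eulerMascheroniConstant + Ws 0 (1/2) := by
  have h1 : Tendsto (fun s : ℝ => Real.log (riemannZeta ((1 + s : ℝ) : ℂ)).re + Real.log s) (𝓝[>] 0) (𝓝 0) := by
    have h := (Asymptotics.isLittleO_one_iff ℝ).mp log_riemannZeta_add_log_sub_isLittleO_ofReal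
    have ht : Tendsto (fun s : ℝ => 1 + s) (𝓝[>] 0) (𝓝[>] 1) := by
      apply tendsto_nhdsWithin_of_tendsto_nhds_of_eventually_within
      · have : Continuous fun s : ℝ => 1 + s := by fun_prop
        have := (this.tendsto 0).mono_left (nhdsWithin_le_nhds (s := Ioi 0))
        simpa using this
      · filter_upwards [self_mem_nhdsWithin] with s hs
        have : 0 < s := hs
        simp [this]
    have := h.comp ht
    refine this.congr fun s => ?_
    simp
  have h2 : Tendsto (fun s : ℝ => Ws s (1/2)) (𝓝[>] 0) (𝓝 (Ws 0 (1/2))) := by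
    have : Continuous (fun s : ℝ => Ws s (1/2)) := by unfold Ws qs; fun_prop
    exact (this.tendsto 0).mono_left nhdsWithin_le_nhds
  have h3 : Tendsto (fun s : ℝ => ∫ t in Ioi (s/2), Real.exp (-t) * Real.log t) (𝓝[>] 0)
      (𝓝 (- Real.eulerMascheroniConstant)) := by
    refine gamma_log_lim.comp ?_
    apply tendsto_nhdsWithin_of_tendsto_nhds_of_eventually_within
    · have : Continuous fun s : ℝ => s / 2 := by fun_prop
      have := (this.tendsto 0).mono_left (nhdsWithin_le_nhds (s := Ioi 0))
      simpa using this
    · filter_upwards [self_mem_nhdsWithin] with s hs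
      have : 0 < s := hs
      simp [this]
  have h4 := (((rk_lim.sub h2).add h3).add slogs)
  have h5 := tendsto_nhds_unique h1 (h4.congr' ?_)
  · linarith
  · have : ∀ᶠ s : ℝ in 𝓝[>] 0, s < 1 := nhdsWithin_le_nhds (gt_mem_nhds zero_lt_one)
    filter_upwards [self_mem_nhdsWithin, this] with s hs hs1
    have hs0 : 0 < s := hs
    have e : ∫ v in Ioi (1/2 : ℝ), AA v * ks s v = ∫ v in Ioi (1/2 : ℝ), (rr v * ks s v + (v + cC) * ks s v) := by
      congr 1; ext v; rw [rr]; ring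
    rw [← logzeta_int s hs, e, integral_add (rk_int s hs0.le hs1.le) (int_vC s hs0), int_vC_val s hs0]
    ring

lemma gg_formula (u : ℝ) (hu : 1/2 < u) : gg u = Real.log u + Real.eulerMascheroniConstant - 1 / u +
    (rr u * qs 0 u - ∫ v in Ioi u, rr v * ks 0 v) := by
  have hi := rk_int 0 le_rfl zero_le_one
  have hii : IntervalIntegrable (fun v => rr v * ks 0 v) volume (1/2) u := by
    rw [intervalIntegrable_iff, uIoc_of_le hu.le]
    exact hi.mono_set Ioc_subset_Ioi_self
  have hd : ∀ v ∈ uIcc (1/2) u, HasDerivAt (Ws 0) ((v + cC) * ks 0 v) v := by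
    intro v hv
    rw [uIcc_of_le hu.le] at hv
    have := Ws_deriv 0 v (by linarith [hv.1])
    simpa using this
  have hii2 : IntervalIntegrable (fun v => (v + cC) * ks 0 v) volume (1/2) u := by
    apply ContinuousOn.intervalIntegrable
    rw [uIcc_of_le hu.le]
    intro v hv
    have hv0 : v ≠ 0 := by have := hv.1; intro h; linarith
    unfold ks
    apply ContinuousAt.continuousWithinAt
    fun_prop (disch := first | assumption | positivity)
  have h2 := intervalIntegral.integral_eq_sub_of_hasDerivAt hd hii2
  have e : ∫ v in (1/2 : ℝ)..u, AA v * ks 0 v = ∫ v in (1/2 : ℝ)..u, (rr v * ks 0 v + (v + cC) * ks 0 v) := by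
    congr 1; ext v; rw [rr]; ring
  have h3 := intervalIntegral.integral_Ioi_sub_Ioi hi hu.le
  rw [gg_eq u hu, e, intervalIntegral.integral_add hii hii2, h2, ← h3, r_const]
  have h4 : Ws 0 u = -((u + cC) * qs 0 u) - 1 / u + Real.log u := by simp [Ws]
  rw [h4]
  have h5 : AA u = rr u + u + cC := by rw [rr]; ring
  rw [h5]
  ring

lemma ks0 (v : ℝ) : ks 0 v = 1 / v ^ 2 + 2 / v ^ 3 := by simp [ks]
lemma qs0 (v : ℝ) : qs 0 v = 1 / v + 1 / v ^ 2 := by simp [qs]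

noncomputable def JJ (u : ℝ) : ℝ := rr u * qs 0 u - ∫ v in Ioi u, rr v * ks 0 v

/-- generic tail bound: if `|r| ks` is below the derivative of `-H` -/
lemma tail_bd (u : ℝ) (hu : 1/2 < u) (h H : ℝ → ℝ) (hd : ∀ v, u ≤ v → HasDerivAt H (-(h v)) v)
    (hr : ∀ v, u ≤ v → |rr v| * ks 0 v ≤ h v) (hlim : Tendsto H atTop (𝓝 0)) :
    - ∫ v in Ioi u, rr v * ks 0 v ≤ H u := by
  have hk : ∀ v, u ≤ v → 0 ≤ ks 0 v := fun v hv => ks_nonneg 0 v le_rfl (by linarith)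
  have hn : ∀ v ∈ Ioi u, 0 ≤ h v := fun v hv =>
    le_trans (mul_nonneg (abs_nonneg _) (hk v (le_of_lt hv))) (hr v (le_of_lt hv))
  have hd' : ∀ v ∈ Ici u, HasDerivAt (fun v => - H v) (h v) v := fun v hv => by
    simpa using (hd v hv).fun_neg
  have hl' : Tendsto (fun v => - H v) atTop (𝓝 0) := by simpa using hlim.neg
  have hI := integrableOn_Ioi_deriv_of_nonneg' hd' hn hl'
  have hV := integral_Ioi_of_hasDerivAt_of_nonneg' hd' hn hl'
  rw [← integral_neg]
  have hm : ∫ v in Ioi u, -(rr v * ks 0 v) ≤ ∫ v in Ioi u, h v := by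
    apply setIntegral_mono_on
    · exact ((rk_int 0 le_rfl zero_le_one).mono_set (Ioi_subset_Ioi hu.le)).neg
    · exact hI
    · exact measurableSet_Ioi
    · intro v hv
      refine le_trans ?_ (hr v (le_of_lt hv))
      rw [← neg_mul]
      exact mul_le_mul_of_nonneg_right (neg_le_abs _) (hk v (le_of_lt hv))
  rw [hV] at hm
  linarith

lemma JJ_eps (u : ℝ) (hu : 1/2 < u) : JJ u ≤ 2 * (0.0239 + 1.8619 * Real.exp (-u)) * (1 / u + 1 / u ^ 2) := by
  set E : ℝ := 0.0239 + 1.8619 * Real.exp (-u) with hE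
  have hr : ∀ v, u ≤ v → |rr v| ≤ E := by
    intro v hv
    have h1 := rr_abs v (by linarith)
    have h2 := ZZ_bound1 v (by linarith)
    have h3 : Real.exp (-v) ≤ Real.exp (-u) := Real.exp_le_exp.mpr (by linarith)
    norm_num at h1 h2 hE ⊢
    linarith
  have hE0 : 0 ≤ E := (abs_nonneg _).trans (hr u le_rfl)
  have ht := tail_bd u hu (fun v => E * ks 0 v) (fun v => E * qs 0 v)
    (fun v hv => ((qs_deriv 0 v (by linarith)).const_mul E).congr_deriv (by ring))
    (fun v hv => mul_le_mul_of_nonneg_right (hr v hv) (ks_nonneg 0 v le_rfl (by linarith)))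
    (by simpa using (qs_tendsto 0 le_rfl).const_mul E)
  have hq : 0 ≤ qs 0 u := by rw [qs0]; positivity
  have h1 : rr u * qs 0 u ≤ E * qs 0 u := mul_le_mul_of_nonneg_right ((le_abs_self _).trans (hr u le_rfl)) hq
  rw [JJ, ← qs0]
  linarith

lemma JJ_kap (u : ℝ) (hu : 20 ≤ u) : JJ u ≤ 0.878 * (3/2 / u ^ 2 + 5/3 / u ^ 3) := by
  have hr : ∀ v, u ≤ v → |rr v| ≤ 0.878 / v := by
    intro v hv
    have hv0 : 0 < v := by linarith
    have h1 := mul_le_mul_of_nonneg_left (rr_abs v (by linarith)) hv0.le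
    have h2 := ZZ_bound2 v (by linarith)
    have h3 : v * Real.exp (-v) ≤ 0.0005 := by
      have hx := Real.add_one_le_exp (v/20)
      have hx4 : (v/20+1)^20 ≤ Real.exp v := by
        calc (v/20+1)^20 ≤ (Real.exp (v/20))^20 := by gcongr
          _ = Real.exp v := by rw [← Real.exp_nat_mul]; congr 1; push_cast; ring
      rw [Real.exp_neg, ← div_eq_mul_inv, div_le_iff₀ (Real.exp_pos v)]
      have : v ≤ 0.0005 * (v/20+1)^20 := by
        have h4 : (2:ℝ)^19 ≤ (v/20+1)^19 := by gcongr; linarith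
        have : (v/20+1)^20 = (v/20+1)^19 * (v/20+1) := by ring
        rw [this]
        have hp : 0 < v/20+1 := by linarith
        nlinarith
      nlinarith
    rw [le_div_iff₀ hv0, mul_comm]
    norm_num at h1 h2 h3 ⊢
    linarith
  have ht := tail_bd u (by linarith) (fun v => 0.878 * (1 / v ^ 3 + 2 / v ^ 4)) (fun v => 0.878 * (1/2 / v ^ 2 + 2/3 / v ^ 3))
    (fun v hv => ?_) (fun v hv => ?_) ?_
  · have hq : 0 ≤ qs 0 u := by rw [qs0]; positivity
    have h1 : rr u * qs 0 u ≤ 0.878 / u * qs 0 u := mul_le_mul_of_nonneg_right ((le_abs_self _).trans (hr u le_rfl)) hq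
    rw [JJ]
    have hu0 : u ≠ 0 := by intro h; linarith
    have : (0.878 / u * qs 0 u) + 0.878 * (1/2 / u ^ 2 + 2/3 / u ^ 3) = 0.878 * (3/2 / u ^ 2 + 5/3 / u ^ 3) := by
      rw [qs0]; field_simp; ring
    linarith
  · have hv0 : 0 < v := by linarith
    have ha := (hasDerivAt_const v (1/2 : ℝ)).fun_div ((hasDerivAt_pow 2 v)) (pow_pos hv0 2).ne'
    have hb := (hasDerivAt_const v (2/3 : ℝ)).fun_div ((hasDerivAt_pow 3 v)) (pow_pos hv0 3).ne'
    refine ((ha.fun_add hb).const_mul 0.878).congr_deriv ?_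
    field_simp
    ring
  · have hv0 : 0 < v := by linarith
    have h1 := mul_le_mul_of_nonneg_right (hr v hv) (ks_nonneg 0 v le_rfl hv0)
    refine h1.trans (le_of_eq ?_)
    rw [ks0]; field_simp
  · have : Tendsto (fun v : ℝ => 0.878 * (1/2 / v ^ 2 + 2/3 / v ^ 3)) atTop (𝓝 (0.878 * (0 + 0))) := by
      apply Tendsto.const_mul
      apply Tendsto.add
      · exact tendsto_const_nhds.div_atTop (tendsto_pow_atTop two_ne_zero)
      · exact tendsto_const_nhds.div_atTop (tendsto_pow_atTop three_ne_zero)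
    simpa using this

end PartNoR

section PartNoS

open Complex Filter Topology Metric Set MeasureTheory

/-- Logarithmic weight of a prime. -/
noncomputable def ww (p : ℕ) : ℝ := -Real.log (1 - 1 / (p:ℝ))

lemma log_totient (D : ℕ) (hD : 0 < D) :
    Real.log ((D:ℝ) / Nat.totient D) = ∑ p ∈ D.primeFactors, ww p := by
  have h1 : ((Nat.totient D : ℚ) : ℝ) = ((D * ∏ p ∈ D.primeFactors, (1 - (p:ℚ)⁻¹) : ℚ) : ℝ) := by
    rw [Nat.totient_eq_mul_prod_factors]
  push_cast at h1
  have hpos : ∀ p ∈ D.primeFactors, (0:ℝ) < 1 - (p:ℝ)⁻¹ := by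
    intro p hp
    have hp2 : (2:ℝ) ≤ p := by exact_mod_cast (Nat.prime_of_mem_primeFactors hp).two_le
    have : (p:ℝ)⁻¹ ≤ 2⁻¹ := by gcongr
    linarith
  have hP : 0 < ∏ p ∈ D.primeFactors, (1 - (p:ℝ)⁻¹) := Finset.prod_pos hpos
  have hD' : (0:ℝ) < D := by exact_mod_cast hD
  rw [h1, ← div_div, div_self hD'.ne', one_div, Real.log_inv, Real.log_prod (fun p hp => (hpos p hp).ne'),
    ← Finset.sum_neg_distrib]
  refine Finset.sum_congr rfl fun p _ => ?_
  rw [ww, one_div]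

lemma log_sqfree (D : ℕ) (hD : Squarefree D) : ∑ p ∈ D.primeFactors, Real.log (p:ℝ) = Real.log D := by
  conv_rhs => rw [← Nat.prod_primeFactors_of_squarefree hD]
  push_cast
  rw [Real.log_prod]
  intro p hp
  exact_mod_cast (Nat.prime_of_mem_primeFactors hp).ne_zero

lemma rearr (D : ℕ) (hD : Squarefree D) (S : Finset ℕ) (c : ℝ)
    (h1 : ∀ p, p.Prime → p ∉ S → ww p ≤ c * Real.log p)
    (h2 : ∀ p ∈ S, c * Real.log p ≤ ww p) :
    Real.log ((D:ℝ) / Nat.totient D) ≤ ∑ p ∈ S, (ww p - c * Real.log p) + c * Real.log D := by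
  have hD0 : 0 < D := Nat.pos_of_ne_zero hD.ne_zero
  rw [log_totient D hD0, ← log_sqfree D hD, Finset.mul_sum]
  have h3 : ∑ p ∈ D.primeFactors, (ww p - c * Real.log p) ≤ ∑ p ∈ S, (ww p - c * Real.log p) := by
    rw [← Finset.sum_filter_add_sum_filter_not D.primeFactors (fun p => p ∈ S)]
    have ha : ∑ p ∈ D.primeFactors with p ∉ S, (ww p - c * Real.log p) ≤ 0 := by
      apply Finset.sum_nonpos
      intro p hp
      rw [Finset.mem_filter] at hp
      have := h1 p (Nat.prime_of_mem_primeFactors hp.1) hp.2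
      linarith
    have hb : ∑ p ∈ D.primeFactors with p ∈ S, (ww p - c * Real.log p) ≤ ∑ p ∈ S, (ww p - c * Real.log p) := by
      apply Finset.sum_le_sum_of_subset_of_nonneg
      · intro p hp
        rw [Finset.mem_filter] at hp
        exact hp.2
      · intro p hp _
        have := h2 p hp
        linarith
    linarith
  rw [Finset.sum_sub_distrib] at h3
  linarith

lemma ww_anti (y : ℝ) (p : ℕ) (hy : 1 < y) (h : y ≤ p) : ww p ≤ -Real.log (1 - 1 / y) := by
  rw [ww]
  have h1 : 1 / y < 1 := by rw [div_lt_one (by linarith)]; exact hy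
  have h2 : 1 / (p:ℝ) ≤ 1 / y := by gcongr
  have := Real.log_le_log (by linarith : 0 < 1 - 1 / y) (by linarith : 1 - 1 / y ≤ 1 - 1 / (p:ℝ))
  linarith

lemma ww_anti' (y : ℝ) (p : ℕ) (hp : 2 ≤ p) (h : (p:ℝ) ≤ y) : -Real.log (1 - 1 / y) ≤ ww p := by
  rw [ww]
  have hp' : (2:ℝ) ≤ p := by exact_mod_cast hp
  have h1 : 1 / (p:ℝ) < 1 := by rw [div_lt_one (by linarith)]; linarith
  have h2 : 1 / y ≤ 1 / (p:ℝ) := by gcongr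
  have := Real.log_le_log (by linarith : 0 < 1 - 1 / (p:ℝ)) (by linarith : 1 - 1 / (p:ℝ) ≤ 1 - 1 / y)
  linarith

/-- Primes up to `x`. -/
noncomputable def SS (x : ℝ) : Finset ℕ := (Finset.Icc 2 ⌊x⌋₊).filter Nat.Prime

lemma mem_SS (x : ℝ) (hx : 0 ≤ x) (p : ℕ) : p ∈ SS x ↔ p.Prime ∧ (p:ℝ) ≤ x := by
  rw [SS, Finset.mem_filter, Finset.mem_Icc, Nat.le_floor_iff hx]
  constructor
  · rintro ⟨⟨_, h⟩, h'⟩; exact ⟨h', h⟩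
  · rintro ⟨h, h'⟩; exact ⟨⟨h.two_le, h'⟩, h⟩

lemma rearr_x (D : ℕ) (hD : Squarefree D) (x : ℝ) (hx : 1 < x) :
    Real.log ((D:ℝ) / Nat.totient D) ≤ ∑ p ∈ SS x, (ww p - (-Real.log (1 - 1 / x) / Real.log x) * Real.log p)
      + (-Real.log (1 - 1 / x) / Real.log x) * Real.log D := by
  have hL : 0 < Real.log x := Real.log_pos hx
  have h1 : 1 / x < 1 := by rw [div_lt_one (by linarith)]; exact hx
  have hx0 : 0 < 1 / x := by positivity
  have hw : 0 ≤ -Real.log (1 - 1 / x) := by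
    have := Real.log_nonpos (by linarith : 0 ≤ 1 - 1 / x) (by linarith); linarith
  apply rearr D hD
  · intro p hp hpS
    rw [mem_SS x (by linarith)] at hpS
    have hpx : x ≤ p := by
      by_contra h; push Not at h; exact hpS ⟨hp, h.le⟩
    have h2 := ww_anti x p hx hpx
    have h3 : 1 ≤ Real.log p / Real.log x := by
      rw [le_div_iff₀ hL, one_mul]; exact Real.log_le_log (by linarith) hpx
    calc ww p ≤ -Real.log (1 - 1 / x) * 1 := by linarith
      _ ≤ -Real.log (1 - 1 / x) * (Real.log p / Real.log x) := by gcongr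
      _ = _ := by ring
  · intro p hp
    rw [mem_SS x (by linarith)] at hp
    have h2 := ww_anti' x p hp.1.two_le hp.2
    have h3 : Real.log p / Real.log x ≤ 1 := by
      rw [div_le_iff₀ hL, one_mul]
      exact Real.log_le_log (by exact_mod_cast hp.1.pos) hp.2
    calc _ = -Real.log (1 - 1 / x) * (Real.log p / Real.log x) := by ring
      _ ≤ -Real.log (1 - 1 / x) * 1 := by gcongr
      _ ≤ ww p := by linarith

lemma ww_tail (p K : ℕ) (hp : 2 ≤ p) :
    ww p ≤ ∑ k ∈ Finset.range K, 1 / (((k:ℝ) + 1) * (p:ℝ) ^ (k+1)) + 1 / ((K + 1) * (p:ℝ) ^ (K+1)) * (p / (p - 1)) := by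
  have hp' : (2:ℝ) ≤ p := by exact_mod_cast hp
  have hp0 : (0:ℝ) < p := by linarith
  have hy : |1 / (p:ℝ)| < 1 := by
    rw [abs_of_pos (by positivity), div_lt_one hp0]; linarith
  have hs := Real.hasSum_pow_div_log_of_abs_lt_one hy
  have e := hs.summable.sum_add_tsum_nat_add K
  rw [hs.tsum_eq] at e
  rw [ww, ← e]
  apply add_le_add
  · apply Finset.sum_le_sum
    intro k _
    apply le_of_eq
    rw [div_pow, one_pow, div_div, mul_comm]
  · have hg := (hasSum_geometric_of_abs_lt_one hy).mul_left (1 / ((K + 1) * (p:ℝ) ^ (K+1)))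
    have h2 : (1 - 1 / (p:ℝ))⁻¹ = p / (p - 1) := by
      have : (p:ℝ) - 1 ≠ 0 := by linarith
      field_simp
    rw [h2] at hg
    rw [← hg.tsum_eq]
    apply Summable.tsum_le_tsum _ ((summable_nat_add_iff K).mpr hs.summable) hg.summable
    intro n
    push_cast
    rw [div_pow, one_pow, div_pow, one_pow, div_div, div_mul_div_comm, one_mul]
    apply one_div_le_one_div_of_le (by positivity)
    have : (p:ℝ) ^ (n + K + 1) = p ^ (K+1) * p ^ n := by rw [← pow_add]; congr 1; ring
    rw [this]
    have hk : (K:ℝ) + 1 ≤ n + K + 1 := by linarith [(Nat.cast_nonneg n : (0:ℝ) ≤ n)]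
    calc _ = (p:ℝ) ^ (K+1) * p ^ n * (K + 1) := by ring
      _ ≤ _ := by gcongr

end PartNoS

section PartNoT

open Complex Filter Topology Metric Set MeasureTheory

lemma gg_lower (x : ℝ) (hx : 2 ≤ x) :
    ∑ p ∈ SS x, (∑ k ∈ Finset.range (Nat.log p ⌊x⌋₊), 1 / (((k:ℝ) + 1) * (p:ℝ) ^ (k+1))
      - (Nat.log p ⌊x⌋₊) * Real.log p / (x * Real.log x)) ≤ gg (Real.log x) := by
  have hx0 : 0 < x := by linarith
  have hL : 0 < Real.log x := Real.log_pos (by linarith)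
  have hM : ⌊x⌋₊ ≠ 0 := by
    have := (Nat.le_floor_iff hx0.le (n := 2)).mpr (by exact_mod_cast hx)
    omega
  rw [gg, Real.exp_log hx0, Real.exp_neg, Real.exp_log hx0]
  set f : ℕ → ℝ := fun n => ArithmeticFunction.vonMangoldt n * (1 / (n * Real.log n) - x⁻¹ / Real.log x) with hf
  have hfn : ∀ n ∈ Finset.Icc 2 ⌊x⌋₊, 0 ≤ f n := by
    intro n hn
    rw [Finset.mem_Icc, Nat.le_floor_iff hx0.le] at hn
    have hn2 : (2:ℝ) ≤ n := by exact_mod_cast hn.1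
    have hl : 0 < Real.log n := Real.log_pos (by linarith)
    have hl2 : Real.log n ≤ Real.log x := Real.log_le_log (by linarith) hn.2
    apply mul_nonneg ArithmeticFunction.vonMangoldt_nonneg
    have : x⁻¹ / Real.log x = 1 / (x * Real.log x) := by field_simp
    rw [this, sub_nonneg]
    apply one_div_le_one_div_of_le (by positivity)
    apply mul_le_mul hn.2 hl2 hl.le hx0.le
  have hfp : ∀ p ∈ SS x, ∑ k ∈ Finset.range (Nat.log p ⌊x⌋₊), 1 / (((k:ℝ) + 1) * (p:ℝ) ^ (k+1))
      - (Nat.log p ⌊x⌋₊) * Real.log p / (x * Real.log x) = ∑ k ∈ Finset.range (Nat.log p ⌊x⌋₊), f (p ^ (k+1)) := by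
    intro p hp
    rw [mem_SS x hx0.le] at hp
    have hl : 0 < Real.log p := Real.log_pos (by exact_mod_cast hp.1.one_lt)
    have hp0 : (0:ℝ) < p := by exact_mod_cast hp.1.pos
    have : ((Nat.log p ⌊x⌋₊ : ℕ) : ℝ) * Real.log p / (x * Real.log x) =
        ∑ k ∈ Finset.range (Nat.log p ⌊x⌋₊), Real.log p / (x * Real.log x) := by
      rw [Finset.sum_const, Finset.card_range, nsmul_eq_mul, mul_div_assoc]
    rw [this, ← Finset.sum_sub_distrib]
    refine Finset.sum_congr rfl fun k _ => ?_
    simp only [hf]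
    rw [ArithmeticFunction.vonMangoldt_apply_pow (Nat.succ_ne_zero k), ArithmeticFunction.vonMangoldt_apply_prime hp.1]
    push_cast
    rw [Real.log_pow]
    push_cast
    field_simp
  rw [Finset.sum_congr rfl hfp, Finset.sum_sigma' (SS x) (fun p => Finset.range (Nat.log p ⌊x⌋₊)) (fun p k => f (p ^ (k+1)))]
  have hinj : Set.InjOn (fun q : (_ : ℕ) × ℕ => q.1 ^ (q.2 + 1)) ((SS x).sigma (fun p => Finset.range (Nat.log p ⌊x⌋₊)) : Finset ((_ : ℕ) × ℕ)) := by
    rintro ⟨p, k⟩ h1 ⟨q, l⟩ h2 h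
    simp only [Finset.coe_sigma, Set.mem_sigma_iff, Finset.mem_coe, mem_SS x hx0.le] at h1 h2
    simp only at h
    have hpq : p = q := by
      have := Nat.Prime.eq_one_or_self_of_dvd h2.1.1 p (h1.1.1.dvd_of_dvd_pow (h ▸ dvd_pow_self p (Nat.succ_ne_zero k)))
      rcases this with h3 | h3
      · exact absurd h3 h1.1.1.ne_one
      · exact h3
    subst hpq
    have := Nat.pow_right_injective h1.1.1.two_le h
    have : k = l := by omega
    subst this
    rfl
  rw [← Finset.sum_image (f := f) hinj]
  apply Finset.sum_le_sum_of_subset_of_nonneg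
  · intro n hn
    rw [Finset.mem_image] at hn
    obtain ⟨⟨p, k⟩, h, rfl⟩ := hn
    simp only [Finset.mem_sigma, mem_SS x hx0.le, Finset.mem_range] at h
    rw [Finset.mem_Icc]
    refine ⟨?_, ?_⟩
    · calc 2 ≤ p := h.1.1.two_le
        _ ≤ p ^ (k+1) := Nat.le_self_pow (Nat.succ_ne_zero k) p
    · exact Nat.pow_le_of_le_log hM (by simp only; omega)
  · intro n hn _
    exact hfn n hn

/-- Error term for one prime. -/
noncomputable def EE (x : ℝ) (p : ℕ) : ℝ := ww p - Real.log p / (x * Real.log x) -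
  (∑ k ∈ Finset.range (Nat.log p ⌊x⌋₊), 1 / (((k:ℝ) + 1) * (p:ℝ) ^ (k+1))
      - (Nat.log p ⌊x⌋₊) * Real.log p / (x * Real.log x))

lemma EE_le (x : ℝ) (hx : 2 ≤ x) (p : ℕ) (hp : 2 ≤ p) :
    EE x p ≤ 1 / ((Nat.log p ⌊x⌋₊ + 1) * (p:ℝ) ^ (Nat.log p ⌊x⌋₊ + 1)) * (p / (p - 1)) +
      ((Nat.log p ⌊x⌋₊ : ℝ) - 1) * Real.log p / (x * Real.log x) := by
  have h := ww_tail p (Nat.log p ⌊x⌋₊) hp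
  rw [EE]
  have e : ((Nat.log p ⌊x⌋₊ : ℝ) - 1) * Real.log p / (x * Real.log x) =
    (Nat.log p ⌊x⌋₊ : ℝ) * Real.log p / (x * Real.log x) - Real.log p / (x * Real.log x) := by ring
  rw [e]
  linarith

lemma EE_small (x : ℝ) (hx : 9 ≤ x) (p : ℕ) (hp : 2 ≤ p) (hpx : (p:ℝ)^2 ≤ x) : EE x p ≤ 3/2 / x := by
  have hx0 : 0 < x := by linarith
  have hL : 0 < Real.log x := Real.log_pos (by linarith)
  have hp' : (2:ℝ) ≤ p := by exact_mod_cast hp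
  have hlp : 0 < Real.log p := Real.log_pos (by linarith)
  refine (EE_le x (by linarith) p hp).trans ?_
  have h9 : 9 ≤ ⌊x⌋₊ := (Nat.le_floor_iff hx0.le).mpr (by exact_mod_cast hx)
  have hlow : (p:ℝ) ^ (Nat.log p ⌊x⌋₊) ≤ x := by
    have := Nat.pow_log_le_self p (show ⌊x⌋₊ ≠ 0 by omega)
    rw [Nat.le_floor_iff hx0.le] at this
    exact_mod_cast this
  have hup : x ≤ (p:ℝ) ^ (Nat.log p ⌊x⌋₊ + 1) := by
    have h1 := Nat.lt_pow_succ_log_self (show 1 < p by omega) ⌊x⌋₊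
    rw [Nat.floor_lt hx0.le] at h1
    have h2 : x < ((p ^ (Nat.log p ⌊x⌋₊ + 1) : ℕ) : ℝ) := h1
    push_cast at h2
    exact h2.le
  have hKK : 2 ≤ Nat.log p ⌊x⌋₊ ∧ (p = 2 → 3 ≤ Nat.log p ⌊x⌋₊) := by
    constructor
    · apply (Nat.le_log_iff_pow_le (by omega) (by omega)).mpr
      rw [Nat.le_floor_iff hx0.le]; push_cast; exact hpx
    · rintro rfl
      apply (Nat.le_log_iff_pow_le (by omega) (by omega)).mpr
      omega
  generalize Nat.log p ⌊x⌋₊ = K at *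
  have hK2 : (2:ℝ) ≤ K := by exact_mod_cast hKK.1
  have hs : ((K:ℝ) - 1) * Real.log p / (x * Real.log x) ≤ 1 / x := by
    have h1 := Real.log_le_log (by positivity) hlow
    rw [Real.log_pow] at h1
    rw [div_le_div_iff₀ (by positivity) hx0]
    have : ((K:ℝ) - 1) * Real.log p ≤ Real.log x := by nlinarith
    nlinarith
  have hf : 1 / (((K:ℝ) + 1) * (p:ℝ) ^ (K + 1)) * (p / (p - 1)) ≤ 1 / 2 / x := by
    have h1 : (p:ℝ) / (p - 1) ≤ (K + 1) / 2 := by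
      rw [div_le_div_iff₀ (by linarith) (by norm_num)]
      by_cases h2 : p = 2
      · have : (3:ℝ) ≤ K := by exact_mod_cast hKK.2 h2
        rw [h2]; push_cast; linarith
      · have : (3:ℝ) ≤ p := by exact_mod_cast (by omega : 3 ≤ p)
        nlinarith
    calc _ ≤ 1 / (((K:ℝ) + 1) * x) * ((K + 1) / 2) := by
          have : 0 ≤ (p:ℝ) / (p - 1) := div_nonneg (by linarith) (by linarith)
          gcongr
      _ = _ := by field_simp
  have : 3 / 2 / x = 1 / 2 / x + 1 / x := by ring
  linarith

lemma EE_big (x : ℝ) (hx : 9 ≤ x) (p : ℕ) (hp : 3 ≤ p) (hpx : x < (p:ℝ)^2) (hpx' : (p:ℝ) ≤ x) :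
    EE x p ≤ 1 / 4 * (1 / ((p:ℝ) - 2) - 1 / p) := by
  have hx0 : 0 < x := by linarith
  have hp' : (3:ℝ) ≤ p := by exact_mod_cast hp
  refine (EE_le x (by linarith) p (by omega)).trans ?_
  have hK : Nat.log p ⌊x⌋₊ = 1 := by
    rw [Nat.log_eq_iff (by left; norm_num)]
    constructor
    · rw [Nat.le_floor_iff hx0.le]; push_cast; simpa using hpx'
    · rw [Nat.floor_lt hx0.le]; push_cast; simpa using hpx
  rw [hK]
  norm_num
  have e : (1/4:ℝ) * (((p:ℝ) - 2)⁻¹ - (p:ℝ)⁻¹) = 1 / (2 * p * (p - 2)) := by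
    have : (p:ℝ) - 2 ≠ 0 := by linarith
    field_simp; norm_num
  have e2 : ((p:ℝ)^2)⁻¹ * (1/2) * ((p:ℝ) / (p - 1)) = 1 / (2 * p * (p - 1)) := by
    have : (p:ℝ) - 1 ≠ 0 := by linarith
    field_simp
  rw [e, e2]
  apply one_div_le_one_div_of_le
  · have : (0:ℝ) < p - 2 := by linarith
    positivity
  · gcongr; norm_num

end PartNoT

section PartNoU

open Complex Filter Topology Metric Set MeasureTheory

/-- Majorant of the error at the odd number `2m+1`. -/
noncomputable def FF (x : ℝ) (m : ℕ) : ℝ :=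
  if (2 * (m:ℝ) + 1)^2 ≤ x then 3/2 / x else 1 / 4 * (1 / (2 * (m:ℝ) - 1) - 1 / (2 * m + 1))

lemma FF_nonneg (x : ℝ) (hx : 9 ≤ x) (m : ℕ) (hm : 1 ≤ m) : 0 ≤ FF x m := by
  have hm' : (1:ℝ) ≤ m := by exact_mod_cast hm
  rw [FF]
  split_ifs
  · positivity
  · have : 1 / (2 * (m:ℝ) + 1) ≤ 1 / (2 * m - 1) := one_div_le_one_div_of_le (by linarith) (by linarith)
    linarith

lemma FF_sum (x : ℝ) (hx : 9 ≤ x) (m1 : ℕ) (h1 : 2 * (m1:ℝ) + 1 ≤ √x) (h2 : √x < 2 * (m1:ℝ) + 3) (M : ℕ) (hM : m1 ≤ M) :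
    ∑ m ∈ Finset.Icc 1 M, FF x m ≤ m1 * (3/2 / x) + 1 / 4 * (1 / (2 * (m1:ℝ) + 1) - 1 / (2 * M + 1)) := by
  have hx0 : 0 < x := by linarith
  induction M, hM using Nat.le_induction with
  | base =>
    rw [sub_self, mul_zero, add_zero]
    have := Finset.sum_le_card_nsmul (Finset.Icc 1 m1) (FF x) (3/2/x) ?_
    · simpa using this
    · intro m hm
      rw [Finset.mem_Icc] at hm
      have hmm : (m:ℝ) ≤ m1 := by exact_mod_cast hm.2
      rw [FF, if_pos]
      rw [← Real.sq_sqrt hx0.le]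
      gcongr
      linarith
  | succ M hM ih =>
    rw [Finset.sum_Icc_succ_top (by omega)]
    have hmm : (m1:ℝ) ≤ M := by exact_mod_cast hM
    have : FF x (M+1) = 1 / 4 * (1 / (2 * (M:ℝ) + 1) - 1 / (2 * ((M + 1 : ℕ) : ℝ) + 1)) := by
      rw [FF, if_neg]
      · push_cast
        congr 4
        ring
      · push_cast
        rw [not_le]
        apply Real.lt_sq_of_sqrt_lt
        linarith
    rw [this]
    linarith

lemma EE_sum (x : ℝ) (hx : 9 ≤ x) :
    ∑ p ∈ SS x, EE x p ≤ (√x + 1) / 2 * (3/2 / x) + 1 / 4 * (1 / (√x - 2)) := by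
  have hx0 : 0 < x := by linarith
  have hs3 : 3 ≤ √x := by rw [Real.le_sqrt (by norm_num) hx0.le]; linarith
  have h1 : ∑ p ∈ SS x, EE x p ≤ 3/2 / x + ∑ m ∈ Finset.Icc 1 ⌊x⌋₊, FF x m := by
    have hsub : SS x ⊆ insert 2 ((Finset.Icc 1 ⌊x⌋₊).image (fun m => 2 * m + 1)) := by
      intro p hp
      have hpp := hp
      rw [SS, Finset.mem_filter, Finset.mem_Icc] at hp
      rw [Finset.mem_insert, Finset.mem_image]
      rcases hp.2.eq_two_or_odd with h | h
      · left; exact h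
      · right
        refine ⟨p / 2, ?_, by omega⟩
        rw [Finset.mem_Icc]
        have := hp.2.two_le
        omega
    have hG : ∀ p ∈ SS x, EE x p ≤ (fun p : ℕ => if p = 2 then 3/2/x else FF x (p/2)) p := by
      intro p hp
      rw [mem_SS x hx0.le] at hp
      simp only
      split_ifs with h
      · apply EE_small x hx p hp.1.two_le
        rw [h]; push_cast; linarith
      · have hodd := hp.1.eq_two_or_odd.resolve_left h
        have h2p := hp.1.two_le
        have e : 2 * ((p / 2 : ℕ) : ℝ) + 1 = p := by
          exact_mod_cast (by omega : 2 * (p/2) + 1 = p)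
        have e' : 2 * ((p / 2 : ℕ) : ℝ) - 1 = p - 2 := by linarith
        rw [FF, e, e']
        split_ifs with h3
        · exact EE_small x hx p hp.1.two_le h3
        · exact EE_big x hx p (by omega) (not_le.mp h3) hp.2
    refine (Finset.sum_le_sum hG).trans ?_
    refine (Finset.sum_le_sum_of_subset_of_nonneg hsub ?_).trans ?_
    · intro p hp _
      rw [Finset.mem_insert, Finset.mem_image] at hp
      rcases hp with h | ⟨m, hm, rfl⟩
      · simp only [h, if_true]; positivity
      · rw [Finset.mem_Icc] at hm
        have : (2 * m + 1) / 2 = m := by omega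
        simp only [this]
        rw [if_neg (by omega)]
        exact FF_nonneg x hx m hm.1
    · rw [Finset.sum_insert, Finset.sum_image]
      · simp only [if_true]
        gcongr with m hm
        rw [if_neg (by omega)]
        have : (2 * m + 1) / 2 = m := by omega
        rw [this]
      · intro a _ b _ h
        simp only at h
        omega
      · rw [Finset.mem_image]
        rintro ⟨m, _, h⟩
        omega
  set m1 := ⌊(√x - 1) / 2⌋₊ with hm1
  have ha : (m1:ℝ) ≤ (√x - 1) / 2 := Nat.floor_le (by linarith)
  have hb : (√x - 1) / 2 < m1 + 1 := Nat.lt_floor_add_one _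
  have hsx : √x ≤ x := by
    nlinarith [Real.sq_sqrt hx0.le]
  have hm1M : m1 ≤ ⌊x⌋₊ := by
    apply Nat.floor_le_floor; linarith
  have h2 := FF_sum x hx m1 (by linarith) (by linarith) ⌊x⌋₊ hm1M
  have h3 : 0 ≤ 1 / (2 * ((⌊x⌋₊ : ℕ):ℝ) + 1) := by positivity
  have h4 : 1 / (2 * (m1:ℝ) + 1) ≤ 1 / (√x - 2) := one_div_le_one_div_of_le (by linarith) (by linarith)
  have h5 : (m1:ℝ) * (3/2/x) ≤ (√x - 1) / 2 * (3/2/x) := by gcongr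
  have h6 : (√x + 1) / 2 * (3/2 / x) = 3/2/x + (√x - 1) / 2 * (3/2/x) := by ring
  linarith

lemma total_bd (D : ℕ) (hD : Squarefree D) (x : ℝ) (hx : 9 ≤ x) (hxD : x = Real.log D) :
    Real.log ((D:ℝ) / Nat.totient D) ≤ Real.log (Real.log x) + Real.eulerMascheroniConstant + JJ (Real.log x) +
     ((√x + 1) / 2 * (3/2 / x) + 1 / 4 * (1 / (√x - 2))) + 1 / ((x - 1) * Real.log x) := by
  have hx0 : 0 < x := by linarith
  have hL1 : 1 ≤ Real.log x := by
    rw [Real.le_log_iff_exp_le hx0]; linarith [Real.exp_one_lt_d9]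
  have h1 := rearr_x D hD x (by linarith)
  rw [← hxD] at h1
  have h2 := gg_lower x (by linarith)
  rw [gg_formula _ (by linarith), ← JJ] at h2
  have h3 := EE_sum x hx
  have e : ∑ p ∈ SS x, EE x p = ∑ p ∈ SS x, (ww p - Real.log p / (x * Real.log x)) -
    ∑ p ∈ SS x, (∑ k ∈ Finset.range (Nat.log p ⌊x⌋₊), 1 / (((k:ℝ) + 1) * (p:ℝ) ^ (k+1))
      - (Nat.log p ⌊x⌋₊) * Real.log p / (x * Real.log x)) := by
    rw [← Finset.sum_sub_distrib]; rfl
  rw [e] at h3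
  have hx1 : 0 < 1 - 1 / x := by
    have : 1 / x ≤ 1 / 9 := by gcongr
    linarith
  have hwu : -Real.log (1 - 1 / x) ≤ 1 / (x - 1) := by
    have := Real.one_sub_inv_le_log_of_pos hx1
    have e2 : 1 - (1 - 1/x)⁻¹ = -(1 / (x - 1)) := by
      have : x - 1 ≠ 0 := by linarith
      field_simp; ring
    linarith
  have hwl : 1 / x ≤ -Real.log (1 - 1 / x) := by
    have := Real.log_le_sub_one_of_pos hx1
    linarith
  have h4 : ∑ p ∈ SS x, (ww p - (-Real.log (1 - 1 / x) / Real.log x) * Real.log p) ≤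
      ∑ p ∈ SS x, (ww p - Real.log p / (x * Real.log x)) := by
    apply Finset.sum_le_sum
    intro p hp
    rw [mem_SS x hx0.le] at hp
    have hlp : 0 ≤ Real.log p := Real.log_nonneg (by exact_mod_cast hp.1.one_lt.le)
    have : Real.log p / (x * Real.log x) = (1 / x / Real.log x) * Real.log p := by field_simp
    rw [this]
    gcongr
  have h5 : -Real.log (1 - 1 / x) / Real.log x * x ≤ 1 / Real.log x + 1 / ((x-1) * Real.log x) := by
    calc _ ≤ 1 / (x - 1) / Real.log x * x := by gcongr
      _ = _ := by
        have : x - 1 ≠ 0 := by linarith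
        field_simp; ring
  linarith

end PartNoU

section PartNoV

open Complex Filter Topology Metric Set MeasureTheory

lemma exp_half_ge (a c L : ℝ) (ha : 4 ≤ a) (hc : 0 ≤ c) (h : c * a^2 ≤ Real.exp (a/2)) (hL : a ≤ L) :
    c * L^2 ≤ Real.exp (L/2) := by
  have e : Real.exp (L/2) = Real.exp (a/2) * Real.exp ((L-a)/2) := by rw [← Real.exp_add]; congr 1; ring
  have h1 := Real.quadratic_le_exp_of_nonneg (by linarith : 0 ≤ (L-a)/2)
  rw [e]
  have hh : 0 ≤ L - a := by linarith
  calc c * L^2 ≤ c * a^2 * (1 + (L-a)/2 + ((L-a)/2)^2/2) := by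
        have : c * a^2 * (1 + (L-a)/2 + ((L-a)/2)^2/2) - c * L^2 =
          c * (a * (a - 4) * (L - a) / 2 + (a^2 - 8) * (L-a)^2 / 8) := by ring
        have h2 : 0 ≤ c * (a * (a - 4) * (L - a) / 2 + (a^2 - 8) * (L-a)^2 / 8) := by
          have h3 : 0 ≤ a - 4 := by linarith
          have h4 : 0 ≤ a^2 - 8 := by nlinarith
          have h5 : 0 ≤ a := by linarith
          positivity
        linarith
    _ ≤ Real.exp (a/2) * Real.exp ((L-a)/2) := by gcongr

lemma exp_4_2 : (66.6:ℝ) ≤ Real.exp 4.2 := by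
  have h := Real.exp_one_gt_d9
  have h1 := Real.quadratic_le_exp_of_nonneg (by norm_num : (0:ℝ) ≤ 0.2)
  have e : Real.exp 4.2 = Real.exp 1 ^ 4 * Real.exp 0.2 := by
    rw [← Real.exp_nat_mul, ← Real.exp_add]; congr 1; norm_num
  rw [e]
  calc (66.6:ℝ) ≤ 2.7182818283 ^ 4 * (1 + 0.2 + 0.2^2/2) := by norm_num
    _ ≤ _ := by gcongr

lemma exp_5_ : (148:ℝ) ≤ Real.exp 5 := by
  have h := Real.exp_one_gt_d9
  have e : Real.exp 5 = Real.exp 1 ^ 5 := by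
    rw [← Real.exp_nat_mul]; congr 1; norm_num
  rw [e]
  calc (148:ℝ) ≤ 2.7182818283 ^ 5 := by norm_num
    _ ≤ _ := by gcongr

lemma exp_7_ : (1090:ℝ) ≤ Real.exp 7 := by
  have h := Real.exp_one_gt_d9
  have e : Real.exp 7 = Real.exp 1 ^ 7 := by
    rw [← Real.exp_nat_mul]; congr 1; norm_num
  rw [e]
  calc (1090:ℝ) ≤ 2.7182818283 ^ 7 := by norm_num
    _ ≤ _ := by gcongr

lemma exp_gamma_bd : 1.7803 ≤ Real.exp Real.eulerMascheroniConstant ∧ Real.exp Real.eulerMascheroniConstant ≤ 1.789 := by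
  obtain ⟨h1, h2⟩ := gamma_bd
  constructor
  · refine le_trans ?_ (Real.exp_le_exp.mpr h1)
    have h := Real.sum_le_exp_of_nonneg (by norm_num : (0:ℝ) ≤ 0.5768) 8
    simp only [Finset.sum_range_succ, Finset.sum_range_zero, Nat.factorial] at h
    norm_num at h ⊢
    linarith
  · refine le_trans (Real.exp_le_exp.mpr h2) ?_
    have h := Real.exp_bound' (by norm_num : (0:ℝ) ≤ 0.5774) (by norm_num) (n := 6) (by norm_num)
    simp only [Finset.sum_range_succ, Finset.sum_range_zero, Nat.factorial] at h
    norm_num at h ⊢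
    linarith

lemma extra_bd (L x s : ℝ) (hL : 8.4 ≤ L) (hs : 66.6 ≤ s) (hx : x = s^2) :
    ((s + 1) / 2 * (3/2 / x) + 1 / 4 * (1 / (s - 2))) + 1 / ((x - 1) * L) ≤ 1.022 / s := by
  have hs0 : 0 < s := by linarith
  have h1 : (s + 1) / 2 * (3/2 / x) ≤ 0.7615 / s := by
    rw [hx]
    have : (s + 1) / 2 * (3/2 / s^2) = (3/4 * (s + 1) / s) / s := by field_simp; ring
    rw [this]
    gcongr
    rw [div_le_iff₀ hs0]
    linarith
  have h2 : 1 / 4 * (1 / (s - 2)) ≤ 0.2582 / s := by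
    rw [div_mul_div_comm, one_mul, div_le_div_iff₀ (by linarith) hs0]
    linarith
  have h3 : 1 / ((x - 1) * L) ≤ 0.002 / s := by
    rw [hx]
    have hq : 0 < s^2 - 1 := by nlinarith
    rw [div_le_div_iff₀ (by positivity) hs0]
    have : (s^2 - 1) * 8.4 ≤ (s^2 - 1) * L := by gcongr
    nlinarith
  have : 1.022 / s = 0.7615 / s + 0.2582 / s + 0.0023 / s := by ring
  have h4 : 0.002 / s ≤ 0.0023 / s := by gcongr; norm_num
  linarith

lemma JJ_num (L : ℝ) (hL : 8.4 ≤ L) (J : ℝ)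
    (hJ1 : J ≤ 2*(0.0239+1.8619*Real.exp (-L))*(1/L+1/L^2))
    (hJ2 : 20 ≤ L → J ≤ 0.878 * (3/2 / L ^ 2 + 5/3 / L ^ 3)) :
    J + 1.022 / Real.exp (L/2) ≤ 1.656 / L^2 := by
  have hL0 : 0 < L := by linarith
  rw [le_div_iff₀ (by positivity)]
  have hs0 := Real.exp_pos (L/2)
  have hE : ∀ c b : ℝ, 0 < c → c * L^2 ≤ Real.exp (L/2) → 1.022 ≤ b * c → 1.022 / Real.exp (L/2) * L^2 ≤ b := by
    intro c b hc h hb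
    rw [div_mul_eq_mul_div, div_le_iff₀ hs0]
    have hb0 : 0 < b := by by_contra h'; push Not at h'; nlinarith
    have := mul_le_mul_of_nonneg_left h hb0.le
    nlinarith [sq_nonneg L]
  have hex : Real.exp (-L) ≤ 0.00023 := by
    have h1 : Real.exp (L/2) ≥ 66.6 := exp_4_2.trans (Real.exp_le_exp.mpr (by linarith))
    have h2 : Real.exp (-L) = 1 / (Real.exp (L/2))^2 := by
      rw [Real.exp_neg, ← Real.exp_nat_mul, one_div]; congr 2; push_cast; ring
    rw [h2, div_le_iff₀ (by positivity)]
    nlinarith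
  have hJ3 : J * L^2 ≤ 0.04866 * (L + 1) := by
    calc J * L^2 ≤ 2*(0.0239+1.8619*Real.exp (-L))*(1/L+1/L^2) * L^2 := by gcongr
      _ = 2*(0.0239+1.8619*Real.exp (-L)) * (L + 1) := by field_simp
      _ ≤ _ := by
        gcongr
        norm_num at hex ⊢
        linarith
  rw [add_mul]
  rcases le_or_gt L 10 with h | h
  · have h1 := hE 0.9438 1.083 (by norm_num) (exp_half_ge 8.4 _ L (by norm_num) (by norm_num) (by
      refine le_trans ?_ (exp_4_2.trans (Real.exp_le_exp.mpr (by norm_num))); norm_num) hL) (by norm_num)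
    norm_num at h1 hJ3 ⊢
    linarith
  rcases le_or_gt L 14 with h' | h'
  · have h1 := hE 1.48 0.7 (by norm_num) (exp_half_ge 10 _ L (by norm_num) (by norm_num) (by
      refine le_trans ?_ (exp_5_.trans (Real.exp_le_exp.mpr (by norm_num))); norm_num) h.le) (by norm_num)
    norm_num at h1 hJ3 ⊢
    linarith
  have h1 := hE 5.5 0.2 (by norm_num) (exp_half_ge 14 _ L (by norm_num) (by norm_num) (by
      refine le_trans ?_ (exp_7_.trans (Real.exp_le_exp.mpr (by norm_num))); norm_num) h'.le) (by norm_num)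
  rcases le_or_gt L 26 with h2 | h2
  · norm_num at h1 hJ3 ⊢
    linarith
  · have h3 := hJ2 (by linarith)
    have h4 : J * L^2 ≤ 0.878 * (3/2 + 5/3 / L) := by
      calc J * L^2 ≤ 0.878 * (3/2 / L ^ 2 + 5/3 / L ^ 3) * L^2 := by gcongr
        _ = _ := by field_simp
    have h5 : 5/3/L ≤ 5/3/26 := by gcongr
    norm_num at h1 h4 h5 ⊢
    linarith

lemma main_big (D : ℕ) (hD : Squarefree D) (h : 8.4 ≤ Real.log (Real.log D)) (hpos : 0 < Real.log D):
    Real.log ((D:ℝ) / Nat.totient D) ≤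
      Real.log (Real.exp Real.eulerMascheroniConstant * Real.log (Real.log D) + 3 / Real.log (Real.log D)) := by
  set x := Real.log D with hx
  set L := Real.log x with hL
  have hL0 : 0 < L := by linarith
  have hs : √x = Real.exp (L/2) := by
    rw [Real.sqrt_eq_iff_mul_self_eq hpos.le (Real.exp_pos _).le, ← Real.exp_add, add_halves, hL, Real.exp_log hpos]
  have hs66 : 66.6 ≤ √x := by rw [hs]; exact exp_4_2.trans (Real.exp_le_exp.mpr (by linarith))
  have hsq : x = √x^2 := (Real.sq_sqrt hpos.le).symm
  have h9 : 9 ≤ x := by nlinarith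
  have h1 := total_bd D hD x h9 hx
  rw [← hL] at h1
  have h2 := extra_bd L x (√x) h hs66 hsq
  have h3 := JJ_num L h (JJ L) (JJ_eps L (by linarith)) (JJ_kap L)
  rw [← hs] at h3
  have e : Real.exp Real.eulerMascheroniConstant * L + 3 / L =
      Real.exp Real.eulerMascheroniConstant * L * (1 + 3 / (Real.exp Real.eulerMascheroniConstant * L^2)) := by
    have := Real.exp_pos Real.eulerMascheroniConstant
    field_simp
  have hE := Real.exp_pos Real.eulerMascheroniConstant
  rw [e, Real.log_mul (by positivity) (by positivity), Real.log_mul hE.ne' hL0.ne', Real.log_exp]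
  have h4 : 1.656 / L^2 ≤ Real.log (1 + 3 / (Real.exp Real.eulerMascheroniConstant * L^2)) := by
    have h5 : 1.676 / L^2 ≤ 3 / (Real.exp Real.eulerMascheroniConstant * L^2) := by
      rw [div_le_div_iff₀ (by positivity) (by positivity)]
      have := exp_gamma_bd.2
      have : 1.676 * Real.exp Real.eulerMascheroniConstant ≤ 3 := by norm_num at this ⊢; linarith
      nlinarith [sq_nonneg L]
    have h6 := log_lo (1.676 / L^2) (by positivity)
    have h7 := Real.log_le_log (by positivity) (add_le_add_right h5 1)
    have h8 : 1.656 / L^2 ≤ 2 * (1.676 / L^2) / (1.676 / L^2 + 2) := by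
      rw [le_div_iff₀ (by positivity)]
      have : 1.676 / L^2 ≤ 0.0238 := by
        rw [div_le_iff₀ (by positivity)]
        norm_num at h ⊢
        nlinarith
      have h9 : (1.656:ℝ) / L^2 = 1.656 * (1/L^2) := by ring
      have h10 : (1.676:ℝ) / L^2 = 1.676 * (1/L^2) := by ring
      rw [h9, h10]
      rw [h10] at this
      have h11 : 0 < 1/L^2 := by positivity
      rw [show 2 * (1.676 * (1/L^2)) = (1/L^2) * 3.352 by ring, show 1.656 * (1/L^2) * (1.676 * (1/L^2) + 2) = (1/L^2) * (1.656 * (1.676 * (1/L^2) + 2)) by ring]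
      apply mul_le_mul_of_nonneg_left _ h11.le
      norm_num at this ⊢
      linarith
    linarith
  linarith

end PartNoV

section PartNoW

open Complex Filter Topology Metric Set MeasureTheory

/-- Trial division by the primes up to 67. -/
def gdp (n : ℕ) : Bool := Nat.ble 2 n &&
  [2, 3, 5, 7, 11, 13, 17, 19, 23, 29, 31, 37, 41, 43, 47, 53, 59, 61, 67].all
    (fun d => !(Nat.beq (n % d) 0) || Nat.beq n d)

lemma gdp_prime (n : ℕ) (hn : n.Prime) : gdp n = true := by
  rw [gdp, Bool.and_eq_true, Nat.ble_eq]
  refine ⟨hn.two_le, ?_⟩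
  rw [List.all_eq_true]
  intro d hd
  rw [Bool.or_eq_true, Bool.not_eq_true', Nat.beq_eq]
  by_cases h : n % d = 0
  · right
    rcases (Nat.dvd_prime hn).mp (Nat.dvd_of_mod_eq_zero h) with h1 | h1
    · subst h1
      exact absurd hd (by decide)
    · exact h1.symm
  · left
    rw [← Bool.not_eq_true, Nat.beq_eq]
    exact h

/-- The first 615 primes. -/
def PL : List ℕ :=
  [2, 3, 5, 7, 11, 13, 17, 19, 23, 29, 31, 37, 41, 43, 47, 53, 59, 61, 67, 71, 73, 79, 83, 89, 97,
  101, 103, 107, 109, 113, 127, 131, 137, 139, 149, 151, 157, 163, 167, 173, 179, 181, 191, 193,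
  197, 199, 211, 223, 227, 229, 233, 239, 241, 251, 257, 263, 269, 271, 277, 281, 283, 293, 307,
  311, 313, 317, 331, 337, 347, 349, 353, 359, 367, 373, 379, 383, 389, 397, 401, 409, 419, 421,
  431, 433, 439, 443, 449, 457, 461, 463, 467, 479, 487, 491, 499, 503, 509, 521, 523, 541, 547,
  557, 563, 569, 571, 577, 587, 593, 599, 601, 607, 613, 617, 619, 631, 641, 643, 647, 653, 659,
  661, 673, 677, 683, 691, 701, 709, 719, 727, 733, 739, 743, 751, 757, 761, 769, 773, 787, 797,
  809, 811, 821, 823, 827, 829, 839, 853, 857, 859, 863, 877, 881, 883, 887, 907, 911, 919, 929,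
  937, 941, 947, 953, 967, 971, 977, 983, 991, 997, 1009, 1013, 1019, 1021, 1031, 1033, 1039, 1049,
  1051, 1061, 1063, 1069, 1087, 1091, 1093, 1097, 1103, 1109, 1117, 1123, 1129, 1151, 1153, 1163,
  1171, 1181, 1187, 1193, 1201, 1213, 1217, 1223, 1229, 1231, 1237, 1249, 1259, 1277, 1279, 1283,
  1289, 1291, 1297, 1301, 1303, 1307, 1319, 1321, 1327, 1361, 1367, 1373, 1381, 1399, 1409, 1423,
  1427, 1429, 1433, 1439, 1447, 1451, 1453, 1459, 1471, 1481, 1483, 1487, 1489, 1493, 1499, 1511,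
  1523, 1531, 1543, 1549, 1553, 1559, 1567, 1571, 1579, 1583, 1597, 1601, 1607, 1609, 1613, 1619,
  1621, 1627, 1637, 1657, 1663, 1667, 1669, 1693, 1697, 1699, 1709, 1721, 1723, 1733, 1741, 1747,
  1753, 1759, 1777, 1783, 1787, 1789, 1801, 1811, 1823, 1831, 1847, 1861, 1867, 1871, 1873, 1877,
  1879, 1889, 1901, 1907, 1913, 1931, 1933, 1949, 1951, 1973, 1979, 1987, 1993, 1997, 1999, 2003,
  2011, 2017, 2027, 2029, 2039, 2053, 2063, 2069, 2081, 2083, 2087, 2089, 2099, 2111, 2113, 2129,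
  2131, 2137, 2141, 2143, 2153, 2161, 2179, 2203, 2207, 2213, 2221, 2237, 2239, 2243, 2251, 2267,
  2269, 2273, 2281, 2287, 2293, 2297, 2309, 2311, 2333, 2339, 2341, 2347, 2351, 2357, 2371, 2377,
  2381, 2383, 2389, 2393, 2399, 2411, 2417, 2423, 2437, 2441, 2447, 2459, 2467, 2473, 2477, 2503,
  2521, 2531, 2539, 2543, 2549, 2551, 2557, 2579, 2591, 2593, 2609, 2617, 2621, 2633, 2647, 2657,
  2659, 2663, 2671, 2677, 2683, 2687, 2689, 2693, 2699, 2707, 2711, 2713, 2719, 2729, 2731, 2741,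
  2749, 2753, 2767, 2777, 2789, 2791, 2797, 2801, 2803, 2819, 2833, 2837, 2843, 2851, 2857, 2861,
  2879, 2887, 2897, 2903, 2909, 2917, 2927, 2939, 2953, 2957, 2963, 2969, 2971, 2999, 3001, 3011,
  3019, 3023, 3037, 3041, 3049, 3061, 3067, 3079, 3083, 3089, 3109, 3119, 3121, 3137, 3163, 3167,
  3169, 3181, 3187, 3191, 3203, 3209, 3217, 3221, 3229, 3251, 3253, 3257, 3259, 3271, 3299, 3301,
  3307, 3313, 3319, 3323, 3329, 3331, 3343, 3347, 3359, 3361, 3371, 3373, 3389, 3391, 3407, 3413,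
  3433, 3449, 3457, 3461, 3463, 3467, 3469, 3491, 3499, 3511, 3517, 3527, 3529, 3533, 3539, 3541,
  3547, 3557, 3559, 3571, 3581, 3583, 3593, 3607, 3613, 3617, 3623, 3631, 3637, 3643, 3659, 3671,
  3673, 3677, 3691, 3697, 3701, 3709, 3719, 3727, 3733, 3739, 3761, 3767, 3769, 3779, 3793, 3797,
  3803, 3821, 3823, 3833, 3847, 3851, 3853, 3863, 3877, 3881, 3889, 3907, 3911, 3917, 3919, 3923,
  3929, 3931, 3943, 3947, 3967, 3989, 4001, 4003, 4007, 4013, 4019, 4021, 4027, 4049, 4051, 4057,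
  4073, 4079, 4091, 4093, 4099, 4111, 4127, 4129, 4133, 4139, 4153, 4157, 4159, 4177, 4201, 4211,
  4217, 4219, 4229, 4231, 4241, 4243, 4253, 4259, 4261, 4271, 4273, 4283, 4289, 4297, 4327, 4337,
  4339, 4349, 4357, 4363, 4373, 4391, 4397, 4409, 4421, 4423, 4441, 4447, 4451, 4457, 4463, 4481,
  4483, 4493, 4507, 4513, 4517, 4519, 4523]

/-- Blocks of values of the number of prime factors, with certificates. -/
def BL : List (ℕ × ℕ × ℕ × ℕ) :=
  [(5, 5, 7, 97), (6, 6, 10, 115), (7, 7, 13, 128), (8, 8, 16, 138), (9, 9, 19, 147),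
  (10, 10, 22, 154), (11, 11, 26, 162), (12, 12, 29, 168), (13, 14, 33, 174), (15, 16, 40, 184),
  (17, 18, 49, 194), (19, 21, 57, 202), (22, 24, 70, 212), (25, 27, 83, 220), (28, 30, 97, 228),
  (31, 34, 111, 235), (35, 38, 131, 243), (39, 43, 151, 250), (44, 49, 177, 258),
  (50, 56, 210, 267), (57, 64, 248, 275), (65, 74, 294, 284), (75, 85, 352, 293),
  (86, 97, 419, 301), (98, 113, 493, 310), (114, 130, 595, 319), (131, 149, 705, 327),
  (150, 172, 833, 336), (173, 197, 990, 344), (198, 228, 1166, 353), (229, 261, 1389, 361),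
  (262, 298, 1631, 369), (299, 341, 1909, 377), (342, 391, 2239, 385), (392, 447, 2630, 393),
  (448, 512, 3076, 401), (513, 587, 3605, 409), (588, 615, 4227, 417)]

lemma PL_eq : PL = (List.range 4524).filter gdp := by decide +kernel

/-- Certificate check. -/
def chkb (b : ℕ × ℕ × ℕ × ℕ) : Bool :=
  Nat.ble (2718281829 ^ b.2.2.1) ((PL.take b.1).prod * 10 ^ (9 * b.2.2.1)) &&
  Nat.ble (2718281829 ^ b.2.2.2) (b.2.2.1 ^ 50 * 10 ^ (9 * b.2.2.2)) &&
  Nat.ble ((PL.take b.2.1).prod * 500000 * b.2.2.2)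
    (((PL.take b.2.1).map (fun p => p - 1)).prod * (17803 * b.2.2.2 ^ 2 + 75000000)) &&
  Nat.ble 66 b.2.2.2 && Nat.ble b.1 b.2.1 && Nat.ble b.2.1 615 && Nat.ble 5 b.1

lemma BL_chk : BL.all chkb = true := by decide +kernel

lemma BL_cover : (List.range 616).all (fun w => Nat.ble w 4 || BL.any (fun b => Nat.ble b.1 w && Nat.ble w b.2.1)) = true := by
  decide +kernel

lemma PL_big : 2718281829 ^ 4448 ≤ PL.prod * 10 ^ (9 * 4448) ∧ 2718281829 ^ 42 ≤ 4448 ^ 5 * 10 ^ (9 * 42) := by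
  decide +kernel

lemma PL_len : PL.length = 615 := by decide +kernel

end PartNoW

section PartNoX

open Complex Filter Topology Metric Set MeasureTheory

lemma card_sum (S T : Finset ℕ) (f : ℕ → ℝ) (c : ℝ) (hc : 0 ≤ c) (h1 : ∀ p ∈ S, c ≤ f p)
    (h2 : ∀ p ∈ T, p ∉ S → f p ≤ c) (hcard : T.card ≤ S.card) : ∑ p ∈ T, f p ≤ ∑ p ∈ S, f p := by
  have h3 : ∑ p ∈ T, (f p - c) ≤ ∑ p ∈ S, (f p - c) := by
    rw [← Finset.sum_filter_add_sum_filter_not T (fun p => p ∈ S)]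
    have ha : ∑ p ∈ T with p ∉ S, (f p - c) ≤ 0 := by
      apply Finset.sum_nonpos
      intro p hp
      rw [Finset.mem_filter] at hp
      have := h2 p hp.1 hp.2
      linarith
    have hb : ∑ p ∈ T with p ∈ S, (f p - c) ≤ ∑ p ∈ S, (f p - c) := by
      apply Finset.sum_le_sum_of_subset_of_nonneg
      · intro p hp
        rw [Finset.mem_filter] at hp
        exact hp.2
      · intro p hp _
        have := h1 p hp
        linarith
    linarith
  rw [Finset.sum_sub_distrib, Finset.sum_sub_distrib, Finset.sum_const, Finset.sum_const, nsmul_eq_mul, nsmul_eq_mul] at h3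
  have : (T.card:ℝ) * c ≤ S.card * c := by gcongr
  linarith

lemma card_sum' (S T : Finset ℕ) (f : ℕ → ℝ) (c : ℝ) (hc : 0 ≤ c) (h1 : ∀ p ∈ S, f p ≤ c)
    (h2 : ∀ p ∈ T, p ∉ S → c ≤ f p) (hcard : S.card ≤ T.card) : ∑ p ∈ S, f p ≤ ∑ p ∈ T, f p := by
  have h3 : ∑ p ∈ S, (f p - c) ≤ ∑ p ∈ T, (f p - c) := by
    rw [← Finset.sum_filter_add_sum_filter_not T (fun p => p ∈ S)]
    have ha : 0 ≤ ∑ p ∈ T with p ∉ S, (f p - c) := by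
      apply Finset.sum_nonneg
      intro p hp
      rw [Finset.mem_filter] at hp
      have := h2 p hp.1 hp.2
      linarith
    have hb : ∑ p ∈ S, (f p - c) ≤ ∑ p ∈ T with p ∈ S, (f p - c) := by
      have h5 : ∑ p ∈ T with p ∈ S, (f p - c) = ∑ p ∈ S with p ∈ T, (f p - c) := by
        apply Finset.sum_congr _ (fun _ _ => rfl)
        ext p; simp [and_comm]
      rw [h5, ← Finset.sum_filter_add_sum_filter_not S (fun p => p ∈ T)]
      have : ∑ p ∈ S with p ∉ T, (f p - c) ≤ 0 := by
        apply Finset.sum_nonpos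
        intro p hp
        rw [Finset.mem_filter] at hp
        have := h1 p hp.1
        linarith
      linarith
    linarith
  rw [Finset.sum_sub_distrib, Finset.sum_sub_distrib, Finset.sum_const, Finset.sum_const, nsmul_eq_mul, nsmul_eq_mul] at h3
  have : (S.card:ℝ) * c ≤ T.card * c := by gcongr
  linarith

lemma PL_pw : PL.Pairwise (· < ·) := by
  rw [PL_eq]
  exact List.Pairwise.filter _ List.pairwise_lt_range

lemma PL_two (p : ℕ) (hp : p ∈ PL) : 2 ≤ p ∧ p < 4524 := by
  rw [PL_eq, List.mem_filter, List.mem_range, gdp, Bool.and_eq_true, Nat.ble_eq] at hp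
  exact ⟨hp.2.1, hp.1⟩

lemma PL_complete (q : ℕ) (hq : q.Prime) (h : q < 4524) : q ∈ PL := by
  rw [PL_eq, List.mem_filter, List.mem_range]
  exact ⟨h, gdp_prime q hq⟩

/-- First `k` primes. -/
def SK (k : ℕ) : Finset ℕ := (PL.take k).toFinset

lemma SK_nodup (k : ℕ) : (PL.take k).Nodup :=
  ((PL_pw.sublist (List.take_sublist k PL)).imp (fun h => h.ne))

lemma SK_card (k : ℕ) (hk : k ≤ 615) : (SK k).card = k := by
  rw [SK, List.toFinset_card_of_nodup (SK_nodup k), List.length_take, PL_len]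
  omega

lemma SK_two (k p : ℕ) (hp : p ∈ SK k) : 2 ≤ p := by
  rw [SK, List.mem_toFinset] at hp
  exact (PL_two p (List.mem_of_mem_take hp)).1

lemma SK_initial (k p q : ℕ) (hp : p ∈ SK k) (hq : q.Prime) (hqs : q ∉ SK k) : p ≤ q := by
  rw [SK, List.mem_toFinset] at hp hqs
  have hpl := PL_two p (List.mem_of_mem_take hp)
  by_contra h
  push Not at h
  have hqP := PL_complete q hq (by omega)
  have hpw := PL_pw
  rw [← List.take_append_drop k PL] at hpw hqP
  rw [List.mem_append] at hqP
  rcases hqP with h1 | h1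
  · exact hqs h1
  · rw [List.pairwise_append] at hpw
    have := hpw.2.2 p hp q h1
    omega

lemma list_log (l : List ℕ) (h : ∀ p ∈ l, 2 ≤ p) : (l.map ww).sum = Real.log ((l.prod : ℕ) : ℝ) - Real.log (((l.map (fun p => p - 1)).prod : ℕ) : ℝ)
    ∧ (l.map (fun p : ℕ => Real.log (p:ℝ))).sum = Real.log ((l.prod : ℕ) : ℝ)
    ∧ 0 < l.prod ∧ 0 < (l.map (fun p => p - 1)).prod := by
  induction l with
  | nil => simp
  | cons a l ih =>
    obtain ⟨h1, h2, h3, h4⟩ := ih (fun p hp => h p (List.mem_cons_of_mem a hp))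
    have ha : 2 ≤ a := h a List.mem_cons_self
    have ha' : (2:ℝ) ≤ a := by exact_mod_cast ha
    have h3' : (0:ℝ) < (l.prod : ℕ) := by exact_mod_cast h3
    have h4' : (0:ℝ) < ((l.map (fun p => p - 1)).prod : ℕ) := by exact_mod_cast h4
    have e : ((a - 1 : ℕ) : ℝ) = a - 1 := by push_cast [show 1 ≤ a by omega]; ring
    simp only [List.map_cons, List.sum_cons, List.prod_cons, Nat.cast_mul]
    rw [h1, h2, Real.log_mul (by positivity) (by positivity), e, Real.log_mul (by linarith) (by positivity)]
    refine ⟨?_, rfl, by positivity, ?_⟩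
    · have : ww a = Real.log a - Real.log (a - 1) := by
        rw [ww, show 1 - 1 / (a:ℝ) = (a - 1) / a by field_simp, Real.log_div (by linarith) (by linarith)]
        ring
      rw [this]; ring
    · have : 0 < a - 1 := by omega
      positivity

lemma SK_ww (k : ℕ) : ∑ p ∈ SK k, ww p = Real.log (((PL.take k).prod : ℕ) : ℝ) - Real.log ((((PL.take k).map (fun p => p - 1)).prod : ℕ) : ℝ) := by
  rw [SK, List.sum_toFinset _ (SK_nodup k)]
  exact (list_log _ (fun p hp => (PL_two p (List.mem_of_mem_take hp)).1)).1

lemma SK_log (k : ℕ) : ∑ p ∈ SK k, Real.log (p:ℝ) = Real.log (((PL.take k).prod : ℕ) : ℝ) := by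
  rw [SK, List.sum_toFinset _ (SK_nodup k)]
  exact (list_log _ (fun p hp => (PL_two p (List.mem_of_mem_take hp)).1)).2.1

lemma SK_pos (k : ℕ) : 0 < (PL.take k).prod ∧ 0 < ((PL.take k).map (fun p => p - 1)).prod :=
  (list_log _ (fun p hp => (PL_two p (List.mem_of_mem_take hp)).1)).2.2

lemma up_bd (D : ℕ) (hD : 0 < D) (k : ℕ) (hk0 : 1 ≤ k) (hk : k ≤ 615) (h : D.primeFactors.card ≤ k) :
    Real.log ((D:ℝ) / Nat.totient D) ≤ Real.log (((PL.take k).prod : ℕ) : ℝ) - Real.log ((((PL.take k).map (fun p => p - 1)).prod : ℕ) : ℝ) := by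
  rw [log_totient D hD, ← SK_ww]
  set y : ℕ := (SK k).sup id with hy
  have hyp : ∀ p ∈ SK k, p ≤ y := fun p hp => Finset.le_sup (f := id) hp
  have hne : (SK k).Nonempty := by
    rw [← Finset.card_pos, SK_card k hk]; omega
  have hy2 : 2 ≤ y := by
    obtain ⟨p, hp⟩ := hne
    exact (SK_two k p hp).trans (hyp p hp)
  have hy2' : (2:ℝ) ≤ y := by exact_mod_cast hy2
  apply card_sum _ _ _ (-Real.log (1 - 1 / (y:ℝ)))
  · have h1 : 1 / (y:ℝ) ≤ 1/2 := by gcongr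
    have h2 : 0 ≤ 1 / (y:ℝ) := by positivity
    have := Real.log_nonpos (by linarith : 0 ≤ 1 - 1 / (y:ℝ)) (by linarith)
    linarith
  · intro p hp
    exact ww_anti' y p (SK_two k p hp) (by exact_mod_cast hyp p hp)
  · intro p hp hpS
    apply ww_anti y p (by linarith)
    have : y ≤ p := Finset.sup_le (fun q hq => SK_initial k q p hq (Nat.prime_of_mem_primeFactors hp) hpS)
    exact_mod_cast this
  · rw [SK_card k hk]; exact h

lemma low_bd (D : ℕ) (hD : Squarefree D) (k : ℕ) (hk : k ≤ 615) (h : k ≤ D.primeFactors.card) :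
    Real.log (((PL.take k).prod : ℕ) : ℝ) ≤ Real.log D := by
  rw [← SK_log, ← log_sqfree D hD]
  set y : ℕ := (SK k).sup id with hy
  have hyp : ∀ p ∈ SK k, p ≤ y := fun p hp => Finset.le_sup (f := id) hp
  apply card_sum' _ _ _ (Real.log y)
  · exact Real.log_natCast_nonneg y
  · intro p hp
    apply Real.log_le_log
    · exact_mod_cast (show 0 < p by have := SK_two k p hp; omega)
    · exact_mod_cast hyp p hp
  · intro p hp hpS
    have : y ≤ p := Finset.sup_le (fun q hq => SK_initial k q p hq (Nat.prime_of_mem_primeFactors hp) hpS)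
    rcases Nat.eq_zero_or_pos y with h0 | h0
    · rw [h0]; simpa using Real.log_natCast_nonneg p
    · apply Real.log_le_log (by exact_mod_cast h0); exact_mod_cast this
  · rw [SK_card k hk]; exact h

lemma exp_pow_le (m : ℕ) : Real.exp m * 10 ^ (9 * m) ≤ 2718281829 ^ m := by
  have h : Real.exp m = Real.exp 1 ^ m := by rw [← Real.exp_nat_mul, mul_one]
  rw [h, pow_mul, ← mul_pow]
  gcongr
  have := Real.exp_one_lt_d9
  norm_num at this ⊢
  linarith

lemma nat_le_log (m A : ℕ) (h : 2718281829 ^ m ≤ A * 10 ^ (9 * m)) (hA : 0 < A) : (m:ℝ) ≤ Real.log A := by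
  rw [Real.le_log_iff_exp_le (by exact_mod_cast hA)]
  have h1 := exp_pow_le m
  have h2 : (2718281829:ℝ) ^ m ≤ A * 10 ^ (9 * m) := by exact_mod_cast h
  have h3 := h1.trans h2
  exact le_of_mul_le_mul_right h3 (by positivity)

lemma G_mono (E t1 t : ℝ) (hE : 1.7803 ≤ E) (h1 : 1.32 ≤ t1) (h : t1 ≤ t) : 1.7803 * t1 + 3 / t1 ≤ E * t + 3 / t := by
  have h0 : 0 < t1 := by linarith
  have h0' : 0 < t := by linarith
  have : 1.7803 * t1 + 3 / t1 ≤ 1.7803 * t + 3 / t := by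
    have e : 1.7803 * t + 3 / t - (1.7803 * t1 + 3 / t1) = (t - t1) * (1.7803 - 3 / (t1 * t)) := by field_simp; ring
    have : 3 / (t1 * t) ≤ 1.7803 := by
      rw [div_le_iff₀ (by positivity)]
      norm_num at h1 ⊢
      nlinarith
    have := mul_nonneg (sub_nonneg.mpr h) (sub_nonneg.mpr this)
    linarith
  have h2 : 1.7803 * t ≤ E * t := by gcongr
  linarith

lemma block_ok (D : ℕ) (hD : Squarefree D) (k1 k2 m a : ℕ) (hb : chkb (k1, k2, m, a) = true)
    (h1 : k1 ≤ D.primeFactors.card) (h2 : D.primeFactors.card ≤ k2) :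
    Real.log ((D:ℝ) / Nat.totient D) ≤
      Real.log (Real.exp Real.eulerMascheroniConstant * Real.log (Real.log D) + 3 / Real.log (Real.log D)) := by
  simp only [chkb, Bool.and_eq_true, Nat.ble_eq] at hb
  obtain ⟨⟨⟨⟨⟨⟨c1, c2⟩, c3⟩, c4⟩, c5⟩, c6⟩, c7⟩ := hb
  have hlow := low_bd D hD k1 (by omega) h1
  have hup := up_bd D (Nat.pos_of_ne_zero hD.ne_zero) k2 (by omega) c6 h2
  have hm := nat_le_log m _ c1 (SK_pos k1).1
  have hm0 : 0 < m := by
    rcases Nat.eq_zero_or_pos m with h | h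
    · subst h
      exfalso
      have : 2718281829 ^ a ≤ 0 := by simpa using c2
      have : 0 < 2718281829 ^ a := by positivity
      omega
    · exact h
  have ha := nat_le_log a (m^50) c2 (by positivity)
  have hm0' : (0:ℝ) < m := by exact_mod_cast hm0
  push_cast at ha
  rw [Real.log_pow] at ha
  have ht : (a:ℝ) / 50 ≤ Real.log (Real.log D) := by
    have : Real.log m ≤ Real.log (Real.log D) := Real.log_le_log hm0' (hm.trans hlow)
    push_cast at ha
    linarith
  have h66 : (66:ℝ) ≤ a := by exact_mod_cast c4
  have hG := G_mono _ _ _ exp_gamma_bd.1 (by norm_num; linarith : (1.32:ℝ) ≤ (a:ℝ) / 50) ht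
  obtain ⟨hA, hB⟩ := SK_pos k2
  have hA' : (0:ℝ) < ((PL.take k2).prod : ℕ) := by exact_mod_cast hA
  have hB' : (0:ℝ) < (((PL.take k2).map (fun p => p - 1)).prod : ℕ) := by exact_mod_cast hB
  have c3' : (((PL.take k2).prod : ℕ) : ℝ) * 500000 * a ≤
    (((PL.take k2).map (fun p => p - 1)).prod : ℕ) * (17803 * (a:ℝ) ^ 2 + 75000000) := by exact_mod_cast c3
  refine hup.trans ?_
  rw [← Real.log_div hA'.ne' hB'.ne']
  apply Real.log_le_log (by positivity)
  refine le_trans ?_ hG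
  have e : 1.7803 * ((a:ℝ) / 50) + 3 / ((a:ℝ)/50) = (17803 * (a:ℝ) ^ 2 + 75000000) / (500000 * a) := by
    field_simp; norm_num; ring
  rw [e, div_le_div_iff₀ hB' (by positivity)]
  linarith

lemma main_small (D : ℕ) (hD : Squarefree D) (h0 : 0 < Real.log (Real.log D)) (h : D.primeFactors.card ≤ 4) :
    Real.log ((D:ℝ) / Nat.totient D) ≤
      Real.log (Real.exp Real.eulerMascheroniConstant * Real.log (Real.log D) + 3 / Real.log (Real.log D)) := by
  have hup := up_bd D (Nat.pos_of_ne_zero hD.ne_zero) 4 (by norm_num) (by norm_num) h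
  obtain ⟨hA, hB⟩ := SK_pos 4
  have e1 : (PL.take 4).prod = 210 := by decide +kernel
  have e2 : ((PL.take 4).map (fun p => p - 1)).prod = 48 := by decide +kernel
  rw [e1, e2, ← Real.log_div (by norm_num) (by norm_num)] at hup
  refine hup.trans (Real.log_le_log (by norm_num) ?_)
  generalize Real.log (Real.log D) = t at h0
  have hE := exp_gamma_bd.1
  have h2 : 1.7803 * t ≤ Real.exp Real.eulerMascheroniConstant * t := by gcongr
  have h3 : 4.375 ≤ 1.7803 * t + 3 / t := by
    have : 1.7803 * t + 3 / t = (1.7803 * t^2 + 3) / t := by field_simp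
    rw [this, le_div_iff₀ h0]
    norm_num
    nlinarith [sq_nonneg (t - 1.2287)]
  norm_num at h3 ⊢
  norm_num at h2
  linarith

lemma main_lemma (D : ℕ) (hD : Squarefree D) (h0 : 0 < Real.log (Real.log D)) :
    Real.log ((D:ℝ) / Nat.totient D) ≤
      Real.log (Real.exp Real.eulerMascheroniConstant * Real.log (Real.log D) + 3 / Real.log (Real.log D)) := by
  rcases le_or_gt D.primeFactors.card 4 with h4 | h4
  · exact main_small D hD h0 h4
  rcases le_or_gt D.primeFactors.card 615 with h5 | h5
  · have hc := BL_cover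
    rw [List.all_eq_true] at hc
    have hc1 := hc D.primeFactors.card (by rw [List.mem_range]; omega)
    rw [Bool.or_eq_true, Nat.ble_eq, List.any_eq_true] at hc1
    rcases hc1 with hc2 | ⟨⟨k1, k2, m, a⟩, hb, hc3⟩
    · omega
    rw [Bool.and_eq_true, Nat.ble_eq, Nat.ble_eq] at hc3
    have hk := BL_chk
    rw [List.all_eq_true] at hk
    exact block_ok D hD k1 k2 m a (hk _ hb) hc3.1 hc3.2
  · have hlow := low_bd D hD 615 le_rfl h5.le
    have e : PL.take 615 = PL := List.take_of_length_le (by rw [PL_len])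
    have hp := (SK_pos 615).1
    rw [e] at hlow hp
    have h1 := nat_le_log 4448 _ PL_big.1 hp
    have h2 := nat_le_log 42 (4448^5) PL_big.2 (by positivity)
    have h3 : (4448:ℝ) ≤ Real.log D := by exact_mod_cast h1.trans hlow
    have h4 : Real.log 4448 ≤ Real.log (Real.log D) := Real.log_le_log (by norm_num) h3
    apply main_big D hD _ (by linarith)
    rw [Nat.cast_pow, Real.log_pow] at h2
    norm_num at h2 ⊢
    linarith

end PartNoX

section PartNoY

open Complex Filter Topology Metric Set MeasureTheory

lemma leg_abs (p : ℕ) [Fact p.Prime] (a : ℤ) : |legendreSym p a| ≤ 1 := by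
  by_cases h : (a : ZMod p) = 0
  · rw [(legendreSym.eq_zero_iff p a).mpr h]; norm_num
  · rcases legendreSym.eq_one_or_neg_one p h with h1 | h1 <;> rw [h1] <;> norm_num

lemma chiFour_abs (p : ℕ) : |chiFour p| ≤ 1 := by
  unfold chiFour
  split_ifs with h h2
  · norm_num
  · have : Fact p.Prime := ⟨h⟩
    exact leg_abs p (-4)
  · norm_num

lemma chiThree_abs (p : ℕ) : |chiThree p| ≤ 1 := by
  unfold chiThree
  split_ifs with h h2
  · norm_num
  · have : Fact p.Prime := ⟨h⟩
    exact leg_abs p (-3)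
  · norm_num

lemma prod_abs (T : Finset ℕ) (f : ℕ → ℤ) (h : ∀ p, |f p| ≤ 2) : |∏ p ∈ T, f p| ≤ 2 ^ T.card := by
  rw [Finset.abs_prod]
  calc ∏ p ∈ T, |f p| ≤ ∏ p ∈ T, (2:ℤ) := Finset.prod_le_prod (fun _ _ => abs_nonneg _) (fun p _ => h p)
    _ = 2 ^ T.card := by rw [Finset.prod_const]

lemma e_le (chi : ℕ → ℤ) (h : ∀ p, |chi p| ≤ 1) (D N : ℕ) :
    (∏ p ∈ D.primeFactors, (1 - chi p)) * ∏ p ∈ N.primeFactors, (1 + chi p) ≤ 2 ^ D.primeFactors.card * 2 ^ N.primeFactors.card := by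
  have h1 := prod_abs D.primeFactors (fun p => 1 - chi p) (fun p => by
    have := abs_le.mp (h p); rw [abs_le]; constructor <;> linarith)
  have h2 := prod_abs N.primeFactors (fun p => 1 + chi p) (fun p => by
    have := abs_le.mp (h p); rw [abs_le]; constructor <;> linarith)
  refine (le_abs_self _).trans ?_
  rw [abs_mul]
  exact mul_le_mul h1 h2 (abs_nonneg _) (by positivity)

lemma four_pow (n : ℕ) (hn : 0 < n) : (4:ℝ) ^ n.primeFactors.card ≤ 8/3 * n := by
  set T := n.primeFactors with hT
  have hrad : (∏ p ∈ T, (p:ℝ)) ≤ n := by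
    rw [hT, ← Nat.cast_prod, Nat.cast_le]
    exact Nat.le_of_dvd hn (Nat.prod_primeFactors_dvd n)
  have h1 : (4:ℝ) ^ T.card ≤ ∏ p ∈ T, ((p:ℝ) * ((if p = 2 then 2 else 1) * (if p = 3 then 4/3 else 1))) := by
    rw [← Finset.prod_const]
    apply Finset.prod_le_prod (fun _ _ => by norm_num)
    intro p hp
    have hp2 := (Nat.prime_of_mem_primeFactors hp).two_le
    by_cases a : p = 2
    · subst a; norm_num
    by_cases b : p = 3
    · subst b; norm_num
    rw [if_neg a, if_neg b]
    have : (4:ℝ) ≤ p := by exact_mod_cast (by omega : 4 ≤ p)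
    linarith
  rw [Finset.prod_mul_distrib, Finset.prod_mul_distrib, Finset.prod_ite_eq', Finset.prod_ite_eq'] at h1
  have h2 : ((if 2 ∈ T then 2 else 1) * (if 3 ∈ T then 4/3 else 1) : ℝ) ≤ 8/3 := by
    split_ifs <;> norm_num
  have h3 : (0:ℝ) ≤ ∏ p ∈ T, (p:ℝ) := Finset.prod_nonneg (fun _ _ => Nat.cast_nonneg _)
  calc _ ≤ _ := h1
    _ ≤ (∏ p ∈ T, (p:ℝ)) * (8/3) := by gcongr
    _ ≤ n * (8/3) := by gcongr
    _ = _ := by ring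

lemma two_pow_lt (D N : ℕ) (hD : 0 < D) (hN : 0 < N) :
    (2:ℝ) ^ D.primeFactors.card * 2 ^ N.primeFactors.card < 4 * Real.sqrt ((D:ℝ) * N) := by
  have h1 := four_pow D hD
  have h2 := four_pow N hN
  have hD' : (0:ℝ) < D := by exact_mod_cast hD
  have hN' : (0:ℝ) < N := by exact_mod_cast hN
  have e : (4:ℝ) * Real.sqrt ((D:ℝ) * N) = Real.sqrt (16 * ((D:ℝ) * N)) := by
    rw [Real.sqrt_mul (by norm_num : (0:ℝ) ≤ 16), show (16:ℝ) = 4^2 by norm_num, Real.sqrt_sq (by norm_num)]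
  rw [e]
  apply Real.lt_sqrt_of_sq_lt
  have e2 : ((2:ℝ) ^ D.primeFactors.card * 2 ^ N.primeFactors.card)^2 = 4 ^ D.primeFactors.card * 4 ^ N.primeFactors.card := by
    rw [mul_pow, ← pow_mul, ← pow_mul, mul_comm _ 2, mul_comm _ 2, pow_mul, pow_mul]; norm_num
  rw [e2]
  calc _ ≤ (8/3 * (D:ℝ)) * (8/3 * N) := by gcongr
    _ < _ := by nlinarith [mul_pos hD' hN']

lemma psi_ge (N : ℕ) : (N:ℝ) ≤ dedekindPsi N := by
  rw [dedekindPsi]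
  have h : (1:ℝ) ≤ ∏ p ∈ N.primeFactors, (1 + 1 / (p:ℝ)) := by
    refine le_trans (Finset.prod_const_one (s := N.primeFactors)).ge ?_
    apply Finset.prod_le_prod (fun _ _ => zero_le_one)
    intro p _
    have : (0:ℝ) ≤ 1 / (p:ℝ) := by positivity
    linarith
  nlinarith [(Nat.cast_nonneg N : (0:ℝ) ≤ N)]

lemma loglog_pos (D : ℕ) (hD1 : 1 < D) (hDsf : Squarefree D) (hDeven : Even D.primeFactors.card) :
    0 < Real.log (Real.log D) := by
  have hc : 2 ≤ D.primeFactors.card := by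
    have h1 : 0 < D.primeFactors.card := Finset.card_pos.mpr (Nat.nonempty_primeFactors.mpr hD1)
    obtain ⟨r, hr⟩ := hDeven
    omega
  have h := low_bd D hDsf 2 (by norm_num) hc
  have e : (PL.take 2).prod = 6 := by decide +kernel
  rw [e] at h
  apply Real.log_pos
  refine lt_of_lt_of_le ?_ h
  rw [Real.lt_log_iff_exp_lt (by norm_num)]
  have := Real.exp_one_lt_d9
  push_cast
  linarith

end PartNoY

end Helpers

/-- For `D > 1` a squarefree integer with an even number of distinct prime
factors (so `D ≥ 6`) and `N` a positive integer coprime to `D`, one has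
`φ(D)ψ(N)/12 - e₁(D,N)/4 - e₃(D,N)/3
  > (DN/12)(1/(e^γ log log D + 3/log log D)) - 7√(DN)/3`,
i.e. the genus bound `g(X₀^D(N)) - 1 > (DN/12)(1/(e^γ log log D + 3/log log D)) - 7√(DN)/3`. -/
theorem genus_lower_bound (D N : ℕ) (hD1 : 1 < D) (hDsf : Squarefree D)
    (hDeven : Even D.primeFactors.card) (hNpos : 0 < N) (hgcd : Nat.gcd D N = 1) :
    (Nat.totient D : ℝ) * dedekindPsi N / 12 - (eOne D N : ℝ) / 4 - (eThree D N : ℝ) / 3 >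
      ((D : ℝ) * N) / 12 *
        (1 / (Real.exp Real.eulerMascheroniConstant * Real.log (Real.log D) +
          3 / Real.log (Real.log D))) -
      7 / 3 * Real.sqrt ((D : ℝ) * N) := by
  have hD0 : 0 < D := by omega
  have hD' : (0:ℝ) < D := by exact_mod_cast hD0
  have hN' : (0:ℝ) < N := by exact_mod_cast hNpos
  have hll := loglog_pos D hD1 hDsf hDeven
  have hm := main_lemma D hDsf hll
  have hphi : (0:ℝ) < Nat.totient D := by exact_mod_cast Nat.totient_pos.mpr hD0
  set G := Real.exp Real.eulerMascheroniConstant * Real.log (Real.log D) + 3 / Real.log (Real.log D) with hGd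
  have hG : 0 < G := by
    have := Real.exp_pos Real.eulerMascheroniConstant
    positivity
  have h1 : (D:ℝ) / Nat.totient D ≤ G := (Real.log_le_log_iff (by positivity) hG).mp hm
  have h2 : (D:ℝ) * (1 / G) ≤ Nat.totient D := by
    rw [div_le_iff₀ hphi] at h1
    rw [mul_one_div, div_le_iff₀ hG]
    linarith
  have h3 : (D:ℝ) * N / 12 * (1 / G) ≤ (Nat.totient D : ℝ) * dedekindPsi N / 12 := by
    calc (D:ℝ) * N / 12 * (1 / G) = (D:ℝ) * (1 / G) * N / 12 := by ring
      _ ≤ (Nat.totient D : ℝ) * dedekindPsi N / 12 := by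
        have := psi_ge N
        gcongr
  have h4 : (eOne D N : ℝ) ≤ 2 ^ D.primeFactors.card * 2 ^ N.primeFactors.card := by
    exact_mod_cast e_le chiFour chiFour_abs D N
  have h5 : (eThree D N : ℝ) ≤ 2 ^ D.primeFactors.card * 2 ^ N.primeFactors.card := by
    exact_mod_cast e_le chiThree chiThree_abs D N
  have h6 := two_pow_lt D N hD0 hNpos
  linarith
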